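/- arXiv:2310.06267 — 2 statements merged into one kernel-verified Lean document; each statement's English description precedes it below -/
import Mathlib

section
/- For all g, h ∈ W with g ⪯ h, we have m(g) ⪯ m(h). -/
/-!
Let `(W,S)` be a Coxeter system, given by a Coxeter matrix `M : CoxeterMatrix B`
and `cs : CoxeterSystem M W`; the set `S` of simple reflections is the range of
`cs.simple`, and `S` is finite since `B` is finite.
-/

variable {B W : Type*} [Group W] {M : CoxeterMatrix B}

/-- The weak order on `W`: `p ⪯ g` iff `ℓ(p) + ℓ(p⁻¹g) = ℓ(g)`. -/
def WeakLe (cs : CoxeterSystem M W) (p g : W) : Prop :=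
  cs.length p + cs.length (p⁻¹ * g) = cs.length g

/-- `f ∈ W` is adjacent to the wall of the reflection `r` if `f⁻¹rf ∈ S`. -/
def AdjWall (cs : CoxeterSystem M W) (f r : W) : Prop :=
  ∃ i : B, f⁻¹ * r * f = cs.simple i

/-- The reflection `q` separates the identity from the wall of the reflection `r`
if `ℓ(qf) < ℓ(f)` for every `f` adjacent to the wall of `r`. -/
def SepIdWall (cs : CoxeterSystem M W) (q r : W) : Prop :=
  cs.IsReflection q ∧ ∀ f : W, AdjWall cs f r → cs.length (q * f) < cs.length f

/-- A reflection `r` is elementary if no reflection separates the identity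
from the wall of `r`. -/
def IsElementary (cs : CoxeterSystem M W) (r : W) : Prop :=
  cs.IsReflection r ∧ ¬ ∃ q : W, SepIdWall cs q r

/-- One step `g → gs` (with `s ∈ S`) crossing a non-elementary wall `gsg⁻¹ ∉ ℰ`. -/
def ShiStep (cs : CoxeterSystem M W) (g h : W) : Prop :=
  ∃ i : B, h = g * cs.simple i ∧ ¬ IsElementary cs (g * cs.simple i * g⁻¹)

/-- `g` and `h` lie in the same Shi part: there is a sequence `g = g₀, …, gₙ = h`
with `gᵢ₊₁ = gᵢsᵢ`, `sᵢ ∈ S`, and `gᵢsᵢgᵢ⁻¹ ∉ ℰ`. -/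
def SameShiPart (cs : CoxeterSystem M W) : W → W → Prop :=
  Relation.ReflTransGen (ShiStep cs)

set_option maxHeartbeats 4000000 in
theorem core3 (R : ℝ → ℝ → ℝ → Prop) (κ p q x y Ha Hb Hl r r' t : ℝ)
    (hκ0 : 0 < κ) (hκ1 : κ < 1) (hκ2 : 1 / 2 ≤ κ ^ 2) (hx : 1 ≤ x) (hy : 2 * κ ≤ y)
    (T1 : 3 / 4 ≤ κ ^ 2 → x < 2 → (x = 1 ∧ y = 2 * κ) ∨ 2 ≤ y)
    (T2 : 3 / 4 ≤ κ ^ 2 → y < 2 → (x = 1 ∧ y = 2 * κ) ∨ 2 ≤ x)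
    (T3 : 3 / 4 ≤ κ ^ 2 → 2 * κ * (2 * κ ^ 2 - 1) < 1 → κ ^ 2 = 3 / 4)
    (Ra : R 1 0 0) (Rb : R 0 1 0) (Rl : R 0 0 1)
    (RA : ∀ i j k, R i j k → R (-i + 2 * κ * j + 2 * p * k) j k)
    (RB : ∀ i j k, R i j k → R i (-j + 2 * κ * i + 2 * q * k) k)
    (RL : ∀ i j k, R i j k → R i j (-k + 2 * p * i + 2 * q * j))
    (RN : ∀ i j k, R i j k → R (-i) (-j) (-k))
    (Rnorm : ∀ i j k, R i j k → i ^ 2 + j ^ 2 + k ^ 2 - 2 * κ * i * j - 2 * p * i * k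
      - 2 * q * j * k = 1)
    (Key : ∀ i j k, R i j k → 0 < k → i ≤ 0 → j ≤ 0 → i = 0 ∧ j = 0)
    (R4 : ∀ i j, R i j 0 → i < 0 → 0 < j → False)
    (hHa : 0 < Ha) (hHb : 0 < Hb) (hHl : Hl < 0)
    (Con : ∀ i j k, R i j k → 0 < k → i * Ha + j * Hb + k * Hl < 0 →
      -1 < x * (i - κ * j - p * k) + y * (j - κ * i - q * k))
    (hr : 0 ≤ r) (hr' : 0 ≤ r') (ht : 0 < t) (Rρ : R r r' t)
    (Hρ : r * Ha + r' * Hb + t * Hl < 0) (hρb : r' - κ * r - q * t ≤ -1) : False := by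
  have R' : ∀ i j k i' j' k', R i j k → i = i' → j = j' → k = k' → R i' j' k' := by
    rintro i j k i' j' k' h rfl rfl rfl; exact h
  have hp0 : 0 ≤ p := by
    by_contra h
    push Not at h
    have := Key _ _ _ (RA _ _ _ Rl) (by norm_num) (by linarith) (by linarith)
    linarith [this.1]
  have hq0 : 0 ≤ q := by
    by_contra h
    push Not at h
    have := Key _ _ _ (RB _ _ _ Rl) (by norm_num) (by linarith) (by linarith)
    linarith [this.2]
  have hp1 : 0 < p → 1 / 2 ≤ p := by
    intro h
    by_contra h2
    push Not at h2
    have := Key _ _ _ (RN _ _ _ (RL _ _ _ (RA _ _ _ Rl))) (by clear * - h h2; nlinarith) (by linarith) (by linarith)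
    linarith [this.1]
  have hq1 : 0 < q → 1 / 2 ≤ q := by
    intro h
    by_contra h2
    push Not at h2
    have := Key _ _ _ (RN _ _ _ (RL _ _ _ (RB _ _ _ Rl))) (by clear * - h h2; nlinarith) (by linarith) (by linarith)
    linarith [this.2]
  have hp2 : 0 < p → p ^ 2 < 1 / 2 → p = 1 / 2 := by
    intro h h3
    by_contra h2
    have h4 : 1 / 2 < p := lt_of_le_of_ne (hp1 h) (Ne.symm h2)
    have := Key _ _ _ (RA _ _ _ (RL _ _ _ (RA _ _ _ Rl))) (by clear * - h h3 h4; nlinarith) (by clear * - h h3 h4; nlinarith) (by linarith)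
    have h5 := this.1
    clear * - h h3 h4 h5
    nlinarith
  have hq2 : 0 < q → q ^ 2 < 1 / 2 → q = 1 / 2 := by
    intro h h3
    by_contra h2
    have h4 : 1 / 2 < q := lt_of_le_of_ne (hq1 h) (Ne.symm h2)
    have := Key _ _ _ (RB _ _ _ (RL _ _ _ (RB _ _ _ Rl))) (by clear * - h h3 h4; nlinarith) (by linarith) (by clear * - h h3 h4; nlinarith)
    have h5 := this.2
    clear * - h h3 h4 h5
    nlinarith
  have hκ3 : 1 / 2 < κ := by clear * - hκ0 hκ2; nlinarith
  have hy1 : 1 ≤ y := by linarith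
  have hcl := Con _ _ _ Rl (by norm_num) (by linarith)
  have hcr := Con _ _ _ Rρ ht Hρ
  have hA : 0 < r - κ * r' - p * t := by
    by_contra h
    push Not at h
    have e1 := mul_nonneg (show 0 ≤ x by linarith) (neg_nonneg.2 h)
    have e2 := mul_nonneg (show 0 ≤ y by linarith) (show 0 ≤ -1 - (r' - κ * r - q * t) by linarith)
    linarith
  have hnρ := Rnorm _ _ _ Rρ
  rcases hp0.eq_or_lt with hp | hp
  · subst hp
    rcases hq0.eq_or_lt with hq | hq
    · subst hq
      have e0 : 0 < 1 - κ ^ 2 := by clear * - hκ0 hκ1; nlinarith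
      have e1 : 1 ≤ (r' - κ * r) ^ 2 := by
        have : r' - κ * r ≤ -1 := by linarith
        clear * - this
        nlinarith
      have e2 := mul_nonneg e0.le (sq_nonneg r)
      have e3 : 0 < t ^ 2 := by positivity
      ring_nf at e1 e2 e3 hnρ
      linarith
    -- case II
    have hq : q = 1 / 2 := by
      apply hq2 hq
      have : q * (2 * κ) < 1 := by
        have := mul_le_mul_of_nonneg_left hy hq0
        linarith
      have h2 : (q * (2 * κ)) ^ 2 < 1 := by
        have h0 : 0 ≤ q * (2 * κ) := by positivity
        clear * - this h0
        nlinarith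
      have h3 := mul_le_mul_of_nonneg_left hκ2 (sq_nonneg q)
      ring_nf at h2 h3
      linarith
    subst hq
    have hy2 : y < 2 := by linarith
    have hr1 : 0 < r := by
      have := mul_nonneg hκ0.le hr'
      linarith
    have htr : t ≤ r' := by
      by_contra h
      push Not at h
      have := Key _ _ _ (RN _ _ _ (RL _ _ _ Rρ)) (by linarith) (by linarith) (by linarith)
      linarith [this.1]
    have hsq : (t - (r' + 1) / 2) ^ 2 + (r - κ * (r' + 1)) ^ 2 + (r' + 1) ^ 2 * (3 / 4 - κ ^ 2) ≤ 0 := by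
      ring_nf at hnρ hρb ⊢
      linarith
    have hrk : κ * t < r := by
      have := mul_le_mul_of_nonneg_left htr hκ0.le
      linarith
    rcases lt_or_ge (κ ^ 2) (3 / 4) with hk | hk
    · have : 0 < (r' + 1) ^ 2 * (3 / 4 - κ ^ 2) := mul_pos (by positivity) (by linarith)
      linarith [sq_nonneg (t - (r' + 1) / 2), sq_nonneg (r - κ * (r' + 1))]
    rcases T2 hk hy2 with ⟨rfl, rfl⟩ | hx2
    · have R3 : R (2 * κ) (4 * κ ^ 2 - 1) (4 * κ ^ 2 - 1) :=
        R' _ _ _ _ _ _ (RL _ _ _ (RB _ _ _ (RA _ _ _ Rb))) (by ring) (by ring) (by ring)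
      have h3 : 2 * κ * Ha + (4 * κ ^ 2 - 1) * Hb + (4 * κ ^ 2 - 1) * Hl < 0 := by
        by_contra h
        push Not at h
        have hd : 0 < 4 * κ ^ 2 - 1 := by linarith
        have e1 : 0 ≤ (4 * κ ^ 2 - 1) * r - 2 * κ * t := by clear * - hrk hk ht hκ0; nlinarith [mul_le_mul_of_nonneg_left hrk.le (show 0 ≤ 4 * κ ^ 2 - 1 by linarith), mul_nonneg (mul_pos hκ0 ht).le (show 0 ≤ 4 * κ ^ 2 - 3 by linarith)]
        linarith [mul_nonneg e1 hHa.le, mul_nonneg ht.le h, mul_nonneg hd.le (mul_nonneg (sub_nonneg.2 htr) hHb.le), mul_pos hd (neg_pos.2 Hρ)]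
      have hc3 := Con _ _ _ R3 (by linarith) h3
      have hk34 := T3 hk (by linarith)
      have e0 : (t - (r' + 1) / 2) ^ 2 + (r - κ * (r' + 1)) ^ 2 ≤ 0 := by rw [hk34] at hsq; linarith
      have e1 : t = (r' + 1) / 2 := by
        have : (t - (r' + 1) / 2) ^ 2 = 0 := le_antisymm (by linarith [sq_nonneg (r - κ * (r' + 1))]) (sq_nonneg _)
        linarith [pow_eq_zero_iff (two_ne_zero) |>.1 this]
      have e2 : r = κ * (r' + 1) := by
        have : (r - κ * (r' + 1)) ^ 2 = 0 := le_antisymm (by linarith [sq_nonneg (t - (r' + 1) / 2)]) (sq_nonneg _)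
        linarith [pow_eq_zero_iff (two_ne_zero) |>.1 this]
      have R7 : R 2 (2 * κ) (2 * κ) :=
        R' _ _ _ _ _ _ (RL _ _ _ (RA _ _ _ (RB _ _ _ Ra))) (by linarith) (by ring) (by ring)
      have h7 : 2 * Ha + 2 * κ * Hb + 2 * κ * Hl < 0 := by
        have hu : 1 ≤ r' := by linarith
        have key : (r' + 1) * (2 * Ha + 2 * κ * Hb + 2 * κ * Hl) =
          4 * κ * (r * Ha + r' * Hb + t * Hl) - (r' + 1) * Ha - 2 * κ * (r' - 1) * Hb := by
          rw [e1, e2]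
          linear_combination (-4) * (r' + 1) * Ha * hk34
        have : (r' + 1) * (2 * Ha + 2 * κ * Hb + 2 * κ * Hl) < 0 := by
          rw [key]
          have a1 : 0 < 4 * κ * (-(r * Ha + r' * Hb + t * Hl)) := by apply mul_pos <;> linarith
          have a2 : 0 < (r' + 1) * Ha := by positivity
          have a3 : 0 ≤ 2 * κ * (r' - 1) * Hb := mul_nonneg (mul_nonneg (by linarith) (by linarith)) hHb.le
          linarith
        by_contra h
        push Not at h
        exact absurd this (not_lt.2 (mul_nonneg (by linarith) h))
      have hc7 := Con _ _ _ R7 (by linarith) h7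
      linarith
    · have R2 : R 1 (2 * κ) (2 * κ) :=
        R' _ _ _ _ _ _ (RL _ _ _ (RB _ _ _ Ra)) (by ring) (by ring) (by ring)
      have h2 : 1 * Ha + 2 * κ * Hb + 2 * κ * Hl < 0 := by
        by_contra h
        push Not at h
        have e1 : 0 ≤ 2 * κ * r - t := by linarith
        linarith [mul_nonneg e1 hHa.le, mul_nonneg ht.le h, mul_nonneg hκ0.le (mul_nonneg (sub_nonneg.2 htr) hHb.le), mul_pos hκ0 (neg_pos.2 Hρ)]
      have hc2 := Con _ _ _ R2 (by linarith) h2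
      clear * - hc2 hx2 hk; nlinarith
  · rcases hq0.eq_or_lt with hq | hq
    swap
    · have e1 := hp1 hp
      have e2 := hq1 hq
      have e3 := mul_le_mul_of_nonneg_left e1 (show 0 ≤ x by linarith)
      have e4 := mul_le_mul_of_nonneg_left e2 (show 0 ≤ y by linarith)
      linarith
    subst hq
    have hr1 : 0 < r := by
      have e1 := mul_nonneg hκ0.le hr'
      have e2 := mul_nonneg hp.le ht.le
      linarith
    have hpx : p * x < 1 := by linarith
    have htr : t ≤ 2 * p * r := by
      by_contra h
      push Not at h
      rcases lt_or_ge (p ^ 2) (1 / 2) with h2 | h2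
      · have hpp := hp2 hp h2
        subst hpp
        have := Key _ _ _ (RN _ _ _ (RL _ _ _ Rρ)) (by linarith) (by linarith) (by linarith)
        linarith [this.1]
      · have e0 := mul_nonneg hκ0.le hr'
        clear * - e0 h h2 hA hp hr1
        nlinarith
    have R1 : R 1 0 (2 * p) := R' _ _ _ _ _ _ (RL _ _ _ Ra) (by ring) (by ring) (by ring)
    have h1 : 1 * Ha + 0 * Hb + 2 * p * Hl < 0 := by
      by_contra h
      push Not at h
      linarith [mul_nonneg ht.le h, mul_nonneg (sub_nonneg.2 htr) hHa.le, mul_nonneg hp.le (mul_nonneg hr' hHb.le), mul_pos hp (neg_pos.2 Hρ)]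
    have hc1 := Con _ _ _ R1 (by linarith) h1
    rcases lt_or_ge (p ^ 2) (1 / 2) with h2 | h2
    swap
    · clear * - hc1 h2 hx hy hκ0 hκ2; nlinarith
    have hpp := hp2 hp h2
    subst hpp
    have R2 : R (2 * κ) 1 (2 * κ) :=
        R' _ _ _ _ _ _ (RL _ _ _ (RA _ _ _ Rb)) (by ring) (by ring) (by ring)
    have h2 : 2 * κ * Ha + 1 * Hb + 2 * κ * Hl < 0 := by
      by_contra h
      push Not at h
      rcases lt_or_ge (2 * κ * r') t with h3 | h3
      · have RR : R (2 * κ * r' - t) r' (r - t) :=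
          R' _ _ _ _ _ _ (RA _ _ _ (RL _ _ _ Rρ)) (by ring) (by ring) (by ring)
        rcases (show t ≤ r by linarith).eq_or_lt with h4 | h4
        · subst h4
          rw [sub_self] at RR
          rcases hr'.eq_or_lt with h5 | h5
          · subst h5
            have := Rnorm _ _ _ RR
            have : t = 1 := by nlinarith
            nlinarith
          · exact R4 _ _ RR (by linarith) h5
        · have := Key _ _ _ (RB _ _ _ RR) (by linarith) (by linarith) (by nlinarith)
          linarith [this.1]
      · linarith [mul_nonneg ht.le h, mul_nonneg hκ0.le (mul_nonneg (show 0 ≤ r - t by linarith) hHa.le), mul_nonneg (sub_nonneg.2 h3) hHb.le, mul_pos hκ0 (neg_pos.2 Hρ)]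
    have hc2 := Con _ _ _ R2 (by linarith) h2
    have hsq : (t - r / 2) ^ 2 + (r' + 1 - κ * r) ^ 2 + r ^ 2 * (3 / 4 - κ ^ 2) ≤ 0 := by
      ring_nf at hnρ hρb ⊢
      linarith
    rcases lt_or_ge (κ ^ 2) (3 / 4) with hk | hk
    · have : 0 < r ^ 2 * (3 / 4 - κ ^ 2) := mul_pos (by positivity) (by linarith)
      linarith [sq_nonneg (t - r / 2), sq_nonneg (r' + 1 - κ * r)]
    rcases T1 hk (by linarith) with ⟨rfl, rfl⟩ | hy2
    · have hk34 := T3 hk (by linarith)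
      have e0 : (t - r / 2) ^ 2 + (r' + 1 - κ * r) ^ 2 ≤ 0 := by rw [hk34] at hsq; linarith
      have e1 : t = r / 2 := by
        have : (t - r / 2) ^ 2 = 0 := le_antisymm (by linarith [sq_nonneg (r' + 1 - κ * r)]) (sq_nonneg _)
        linarith [pow_eq_zero_iff (two_ne_zero) |>.1 this]
      have e2 : r' = κ * r - 1 := by
        have : (r' + 1 - κ * r) ^ 2 = 0 := le_antisymm (by linarith [sq_nonneg (t - r / 2)]) (sq_nonneg _)
        linarith [pow_eq_zero_iff (two_ne_zero) |>.1 this]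
      have RR : R (r - 2 * κ) (κ * r - 1) (r / 2) := by
        refine R' _ _ _ _ _ _ (RA _ _ _ Rρ) ?_ e2 e1
        rw [e1, e2]
        linear_combination 2 * r * hk34
      have h5 : 2 * κ ≤ r := by
        by_contra h
        push Not at h
        have := Key _ _ _ (RB _ _ _ RR) (by linarith) (by linarith) (by linarith)
        linarith [this.1]
      have h6 : 4 * κ ≤ r := by
        by_contra h
        push Not at h
        have := Key _ _ _ (RN _ _ _ (RL _ _ _ RR)) (by linarith) (by linarith) (by linarith)
        linarith [this.1, this.2]
      have R6 : R 3 (2 * κ) 2 :=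
        R' _ _ _ _ _ _ (RL _ _ _ (RA _ _ _ (RB _ _ _ (RA _ _ _ Rl)))) (by linarith) (by ring) (by linarith)
      have h7 : 3 * Ha + 2 * κ * Hb + 2 * Hl < 0 := by
        have key : r * (3 * Ha + 2 * κ * Hb + 2 * Hl) =
          3 * (r * Ha + r' * Hb + t * Hl) + r / 2 * Hl - (κ * r - 3) * Hb := by
          rw [e1, e2]; ring
        have : r * (3 * Ha + 2 * κ * Hb + 2 * Hl) < 0 := by
          rw [key]
          have a2 : r / 2 * Hl < 0 := by linarith
          have a3 : 0 ≤ (κ * r - 3) * Hb := mul_nonneg (by linarith) hHb.le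
          linarith
        by_contra h
        push Not at h
        linarith
      have hc7 := Con _ _ _ R6 (by linarith) h7
      linarith
    · clear * - hc2 hy2 hk; nlinarith

namespace Shi
open Real

/-- Chebyshev numbers. -/
def U (c : ℝ) : ℕ → ℝ
  | 0 => 0
  | 1 => 1
  | (k+2) => 2 * c * U c (k+1) - U c k

theorem U_zero (c : ℝ) : U c 0 = 0 := rfl
theorem U_one (c : ℝ) : U c 1 = 1 := rfl
theorem U_add_two (c : ℝ) (k : ℕ) : U c (k+2) = 2 * c * U c (k+1) - U c k := rfl

theorem U_sin (φ : ℝ) (k : ℕ) : U (cos φ) k * sin φ = sin (k * φ) := by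
  induction k using Nat.strong_induction_on with
  | _ k ih =>
    match k with
    | 0 => simp [U_zero]
    | 1 => simp [U_one]
    | (k+2) =>
      rw [U_add_two, sub_mul, mul_assoc, ih (k+1) (by omega), ih k (by omega)]
      have h1 : ((k+2 : ℕ) : ℝ) * φ = ((k+1 : ℕ):ℝ) * φ + φ := by push_cast; ring
      have h2 : ((k : ℕ) : ℝ) * φ = ((k+1 : ℕ):ℝ) * φ - φ := by push_cast; ring
      rw [h1, h2, sin_add, sin_sub]; ring

theorem U_cst (k : ℕ) : U 1 k = k := by
  induction k using Nat.strong_induction_on with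
  | _ k ih =>
    match k with
    | 0 => simp [U_zero]
    | 1 => simp [U_one]
    | (k+2) =>
      rw [U_add_two, ih (k+1) (by omega), ih k (by omega)]; push_cast; ring

/-- cosine of the angle. -/
noncomputable def kap (m : ℕ) : ℝ := cos (π / m)

theorem sin_pos_m {m : ℕ} (hm : 2 ≤ m) : 0 < sin (π / m) := by
  have h : (2:ℝ) ≤ m := by exact_mod_cast hm
  apply sin_pos_of_pos_of_lt_pi
  · positivity
  · rw [div_lt_iff₀ (by linarith)]; nlinarith [pi_pos]

theorem U_eq {m : ℕ} (hm : 2 ≤ m) (k : ℕ) : U (kap m) k = sin (k * (π / m)) / sin (π / m) := by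
  rw [eq_div_iff (sin_pos_m hm).ne', kap, U_sin]

theorem U_pos {m k : ℕ} (hm : m = 0 ∨ 2 ≤ m) (hk : 0 < k) (hkm : m ≠ 0 → k < m) : 0 < U (kap m) k := by
  rcases hm with rfl | hm
  · simp [kap, U_cst, hk]
  · rw [U_eq hm]
    apply div_pos _ (sin_pos_m hm)
    have h : (2:ℝ) ≤ m := by exact_mod_cast hm
    have h2 : (k:ℝ) < m := by exact_mod_cast hkm (by omega)
    have h3 : (0:ℝ) < k := by exact_mod_cast hk
    apply sin_pos_of_pos_of_lt_pi
    · positivity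
    · rw [mul_div_assoc', div_lt_iff₀ (by linarith)]; nlinarith [pi_pos]

theorem U_refl {m k : ℕ} (hm : 2 ≤ m) (hk : k ≤ m) : U (kap m) (m - k) = U (kap m) k := by
  rw [U_eq hm, U_eq hm, Nat.cast_sub hk]
  have h : (m:ℝ) ≠ 0 := by positivity
  have : ((m:ℝ) - k) * (π / m) = π - k * (π / m) := by field_simp
  rw [this, sin_pi_sub]

theorem U_m {m : ℕ} (hm : 2 ≤ m) : U (kap m) m = 0 := by
  have := U_refl hm (le_refl m)
  simpa [U_zero] using this.symm

theorem U_m1 {m : ℕ} (hm : 2 ≤ m) : U (kap m) (m-1) = 1 := U_refl (k := 1) hm (by omega)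

theorem kap_sq_lt {m : ℕ} (hm : 2 ≤ m) : (kap m)^2 < 1 := by
  have := sin_pos_m hm
  have h := sin_sq_add_cos_sq (π / m)
  unfold kap; nlinarith

theorem U_2m {m : ℕ} (hm : 2 ≤ m) : U (kap m) (2*m) = 0 := by
  rw [U_eq hm]
  have h : (m:ℝ) ≠ 0 := by positivity
  have : ((2*m:ℕ):ℝ) * (π / m) = 2 * π := by push_cast; field_simp
  rw [this, sin_two_pi, zero_div]

theorem U_2m1 {m : ℕ} (hm : 2 ≤ m) : U (kap m) (2*m+1) = 1 := by
  rw [U_eq hm]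
  have h : (m:ℝ) ≠ 0 := by positivity
  have : ((2*m+1:ℕ):ℝ) * (π / m) = π / m + 2 * π := by push_cast; field_simp; ring
  rw [this, sin_add_two_pi, div_self (sin_pos_m hm).ne']

/-- unimodality -/
theorem U_le {m n l : ℕ} (hm : 2 ≤ m) (h1 : n ≤ l) (h2 : l + n ≤ m) : U (kap m) n ≤ U (kap m) l := by
  rw [U_eq hm, U_eq hm]
  have hm0 : (0:ℝ) < m := by positivity
  apply div_le_div_of_nonneg_right _ (sin_pos_m hm).le
  have h3 : (n:ℝ) ≤ l := by exact_mod_cast h1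
  have h4 : (l:ℝ) + n ≤ m := by exact_mod_cast h2
  have h5 : (0:ℝ) ≤ n := by positivity
  set φ := π / m with hφ
  have hφ0 : 0 < φ := by positivity
  have hmφ : m * φ = π := by rw [hφ]; field_simp
  have := sin_sub_sin (l * φ) (n * φ)
  have a1 : 0 ≤ sin ((l * φ - n * φ) / 2) := by
    apply sin_nonneg_of_nonneg_of_le_pi <;> nlinarith
  have a2 : 0 ≤ cos ((l * φ + n * φ) / 2) := by
    apply cos_nonneg_of_neg_pi_div_two_le_of_le <;> nlinarith
  nlinarith [mul_nonneg a1 a2]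

theorem kap_mono {m n : ℕ} (hm : 2 ≤ m) (h : m ≤ n) : kap m ≤ kap n := by
  unfold kap
  have h1 : (2:ℝ) ≤ m := by exact_mod_cast hm
  have h2 : (m:ℝ) ≤ n := by exact_mod_cast h
  apply cos_le_cos_of_nonneg_of_le_pi
  · positivity
  · rw [div_le_iff₀ (by linarith)]; nlinarith [pi_pos]
  · apply div_le_div_of_nonneg_left pi_pos.le (by linarith) h2

theorem kap4 : kap 4 ^ 2 = 1/2 := by
  unfold kap
  have : ((4:ℕ):ℝ) = 4 := by norm_num
  rw [this, cos_pi_div_four, div_pow, sq_sqrt (by norm_num)]; norm_num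

theorem kap6 : kap 6 ^ 2 = 3/4 := by
  unfold kap
  have : ((6:ℕ):ℝ) = 6 := by norm_num
  rw [this, cos_pi_div_six, div_pow, sq_sqrt (by norm_num)]; norm_num

theorem kap_nonneg {m : ℕ} (hm : 2 ≤ m) : 0 ≤ kap m := by
  unfold kap
  have h1 : (2:ℝ) ≤ m := by exact_mod_cast hm
  have h0 : 0 < π / m := by positivity
  apply cos_nonneg_of_neg_pi_div_two_le_of_le
  · linarith [pi_pos]
  · apply div_le_div_of_nonneg_left pi_pos.le (by linarith) h1

theorem kap5 : kap 5 ^ 2 < 3/4 := by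
  unfold kap
  have : ((5:ℕ):ℝ) = 5 := by norm_num
  rw [this, cos_pi_div_five]
  have h := sq_sqrt (show (0:ℝ) ≤ 5 by norm_num)
  have h2 : √5 < 3 := by rw [sqrt_lt' (by norm_num)]; norm_num
  nlinarith

theorem six_le {m : ℕ} (hm : 2 ≤ m) (h : 3/4 ≤ kap m ^ 2) : 6 ≤ m := by
  by_contra h2
  have := kap_mono hm (show m ≤ 5 by omega)
  have := kap_nonneg hm
  nlinarith [kap5]

theorem kap7 : 2 * kap 7 * (2 * kap 7 ^ 2 - 1) ≥ 1 := by
  have h : 0.89 ≤ kap 7 := by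
    unfold kap
    have h1 := one_sub_sq_div_two_le_cos (x := π / (7:ℕ))
    have h2 : ((7:ℕ):ℝ) = 7 := by norm_num
    rw [h2] at h1 ⊢
    have h3 : π / 7 ≤ 0.45 := by linarith [pi_lt_d2]
    have h4 : 0 ≤ π / 7 := by positivity
    nlinarith
  nlinarith [mul_nonneg (show (0:ℝ) ≤ kap 7 - 0.89 by linarith) (sq_nonneg (kap 7)), sq_nonneg (kap 7 - 0.89)]

theorem trig3 {m : ℕ} (hm : 2 ≤ m) (h : 3/4 ≤ kap m ^ 2) (h2 : 2 * kap m * (2 * kap m ^ 2 - 1) < 1) :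
    kap m ^ 2 = 3/4 := by
  have h6 := six_le hm h
  rcases h6.eq_or_lt with rfl | h7
  · exact kap6
  · exfalso
    have a := kap_mono (by norm_num) (show 7 ≤ m from h7)
    have b := kap7
    have c := kap_nonneg (show 2 ≤ 7 by norm_num)
    have d : 3/4 ≤ kap 7 ^ 2 := by
      rw [← kap6]
      exact pow_le_pow_left₀ (kap_nonneg (by norm_num)) (kap_mono (by norm_num) (by norm_num)) 2
    have e := pow_le_pow_left₀ c a 2
    nlinarith [mul_nonneg (sub_nonneg.2 a) (show 0 ≤ 2 * kap m ^ 2 - 1 by linarith), mul_nonneg c (sub_nonneg.2 e)]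

theorem trig1 {m k : ℕ} (hm : 2 ≤ m) (h : 3/4 ≤ kap m ^ 2) (hk : 2 ≤ k) (hk2 : k + 2 ≤ m)
    (hx : U (kap m) (k-1) < 2) : (U (kap m) (k-1) = 1 ∧ U (kap m) k = 2 * kap m) ∨ 2 ≤ U (kap m) k := by
  have h6 := six_le hm h
  have h3 : 2 ≤ U (kap m) 3 := by simp only [U]; linarith
  rcases hk.eq_or_lt with rfl | hk
  · left; simp [U]
  rcases (show 3 ≤ k by omega).eq_or_lt with rfl | hk
  · right; exact h3
  exfalso
  have := U_le hm (show 3 ≤ k - 1 by omega) (by omega)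
  linarith

theorem trig2 {m k : ℕ} (hm : 2 ≤ m) (h : 3/4 ≤ kap m ^ 2) (hk : 2 ≤ k) (hk2 : k + 2 ≤ m)
    (hx : U (kap m) k < 2) : (U (kap m) (k-1) = 1 ∧ U (kap m) k = 2 * kap m) ∨ 2 ≤ U (kap m) (k-1) := by
  have h6 := six_le hm h
  have h3 : 2 ≤ U (kap m) 3 := by simp only [U]; linarith
  rcases hk.eq_or_lt with rfl | hk
  · left; simp [U]
  rcases hk2.eq_or_lt with rfl | hk2
  · right
    have := U_le hm (show 3 ≤ k - 1 by omega) (by omega)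
    linarith
  exfalso
  have := U_le hm (show 3 ≤ k by omega) (by omega)
  linarith

end Shi

namespace Shi
open Real

section rep
variable [Fintype B] [DecidableEq B]

/-- simple root -/
def al (i : B) : B → ℝ := Pi.single i 1

/-- the bilinear form -/
noncomputable def bf (M : CoxeterMatrix B) : LinearMap.BilinForm ℝ (B → ℝ) :=
  Matrix.toBilin' (Matrix.of fun i j => - kap (M i j))

theorem bf_al (M : CoxeterMatrix B) (i j : B) : bf M (al i) (al j) = - kap (M i j) := by
  unfold bf al; rw [Matrix.toBilin'_single]; rfl

theorem kap_one : kap 1 = -1 := by simp [kap]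

theorem bf_al_self (M : CoxeterMatrix B) (i : B) : bf M (al i) (al i) = 1 := by
  rw [bf_al, M.diagonal, kap_one]; norm_num

theorem bf_comm (M : CoxeterMatrix B) (u v : B → ℝ) : bf M u v = bf M v u := by
  unfold bf
  rw [Matrix.toBilin'_apply, Matrix.toBilin'_apply, Finset.sum_comm]
  refine Finset.sum_congr rfl fun i _ => Finset.sum_congr rfl fun j _ => ?_
  simp only [Matrix.of_apply]
  rw [M.symmetric j i]; ring

theorem M_ne {i j : B} (M : CoxeterMatrix B) (h : i ≠ j) : M i j = 0 ∨ 2 ≤ M i j := by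
  have := M.off_diagonal i j h
  omega

/-- reflection in a vector -/
noncomputable def rf (M : CoxeterMatrix B) (η : B → ℝ) : Module.End ℝ (B → ℝ) :=
  LinearMap.id - (2:ℝ) • ((bf M η).smulRight η)

theorem rf_apply (M : CoxeterMatrix B) (η v : B → ℝ) : rf M η v = v - (2 * bf M η v) • η := by
  simp [rf, smul_smul]

theorem rf_bf (M : CoxeterMatrix B) {η : B → ℝ} (h : bf M η η = 1) (u v : B → ℝ) :
    bf M (rf M η u) (rf M η v) = bf M u v := by
  simp only [rf_apply, map_sub, map_smul, LinearMap.sub_apply, LinearMap.smul_apply, smul_eq_mul, h]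
  rw [bf_comm M u η]; ring

theorem rf_self (M : CoxeterMatrix B) {η : B → ℝ} (h : bf M η η = 1) : rf M η η = - η := by
  rw [rf_apply, h]; module

theorem rf_rf (M : CoxeterMatrix B) {η : B → ℝ} (h : bf M η η = 1) : rf M η * rf M η = 1 := by
  ext1 x; ext1
  simp only [Module.End.mul_apply, LinearMap.comp_apply]
  simp only [rf_apply, map_sub, map_smul, smul_eq_mul, h, Module.End.one_apply]
  module

theorem T_pow (M : CoxeterMatrix B) (i j : B) (n : ℕ) :
    ((rf M (al i) * rf M (al j))^n) (al i) = U (kap (M i j)) (2*n+1) • al i + U (kap (M i j)) (2*n) • al j := by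
  induction n with
  | zero => simp [U]
  | succ n ih =>
    rw [pow_succ', Module.End.mul_apply, ih]
    rw [show 2 * (n+1) + 1 = (2*n+1) + 2 by ring, U_add_two, show (2*n+1)+1 = 2 * n + 2 by ring,
      show 2 * (n+1) = 2 * n + 2 by ring, U_add_two]
    simp only [Module.End.mul_apply, rf_apply, map_add, map_sub, map_smul, bf_al_self, bf_al, smul_eq_mul,
      M.symmetric j i]
    module

theorem T_m (M : CoxeterMatrix B) {i j : B} (hm : 2 ≤ M i j) :
    ((rf M (al i) * rf M (al j))^(M i j)) (al i) = al i := by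
  rw [T_pow, U_2m hm, U_2m1 hm]; simp

theorem T_inv (M : CoxeterMatrix B) (i j : B) (n : ℕ) :
    (rf M (al i) * rf M (al j))^n * (rf M (al j) * rf M (al i))^n = 1 := by
  have h : (rf M (al i) * rf M (al j)) * (rf M (al j) * rf M (al i)) = 1 := by
    rw [mul_assoc, ← mul_assoc (rf M (al j)), rf_rf M (bf_al_self M j), one_mul, rf_rf M (bf_al_self M i)]
  have h2 : (rf M (al j) * rf M (al i)) * (rf M (al i) * rf M (al j)) = 1 := by
    rw [mul_assoc, ← mul_assoc (rf M (al i)), rf_rf M (bf_al_self M i), one_mul, rf_rf M (bf_al_self M j)]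
  have hc : Commute (rf M (al i) * rf M (al j)) (rf M (al j) * rf M (al i)) := h.trans h2.symm
  rw [← hc.mul_pow, h, one_pow]

theorem liftable (M : CoxeterMatrix B) : M.IsLiftable (fun i => rf M (al i)) := by
  intro i j
  by_cases hij : i = j
  · subst hij; simp [rf_rf M (bf_al_self M i)]
  rcases M_ne M hij with h | h
  · simp [h]
  · have h1 := T_m M h
    have h2 : ((rf M (al i) * rf M (al j))^(M i j)) (al j) = al j := by
      have h3 := T_m M (i := j) (j := i) (by rwa [M.symmetric j i])
      have h4 := T_inv M i j (M i j)
      rw [M.symmetric j i] at h3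
      have := congrArg (fun f : Module.End ℝ (B → ℝ) => f (al j)) h4
      simpa [Module.End.mul_apply, h3] using this
    apply LinearMap.ext
    intro v
    have hk := kap_sq_lt h
    set κ := kap (M i j) with hκ
    have hk' : kap (M j i) = κ := by rw [M.symmetric j i]
    have hk0 : 1 - κ^2 ≠ 0 := by linarith
    set A := bf M (al i) v with hA
    set C := bf M (al j) v with hC
    set x := (A + κ * C) / (1 - κ^2) with hx
    set y := (C + κ * A) / (1 - κ^2) with hy
    set u := v - x • al i - y • al j with hu
    have hv : v = x • al i + y • al j + u := by rw [hu]; module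
    have u1 : bf M (al i) u = 0 := by
      rw [hu]; simp only [map_sub, map_smul, bf_al_self, bf_al, ← hA, smul_eq_mul, ← hκ]
      rw [hx, hy]; field_simp; ring
    have u2 : bf M (al j) u = 0 := by
      rw [hu]; simp only [map_sub, map_smul, bf_al_self, bf_al, ← hC, smul_eq_mul, hk']
      rw [hx, hy]; field_simp; ring
    have u3 : ∀ n, ((rf M (al i) * rf M (al j))^n) u = u := by
      intro n
      induction n with
      | zero => simp
      | succ n ih =>
        rw [pow_succ', Module.End.mul_apply, ih, Module.End.mul_apply, rf_apply M (al j), u2, mul_zero, zero_smul,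
          sub_zero, rf_apply, u1, mul_zero, zero_smul, sub_zero]
    rw [hv, map_add, map_add, map_smul, map_smul, h1, h2, u3]
    rfl

/-- geometric representation -/
noncomputable def rho (cs : CoxeterSystem M W) : W →* Module.End ℝ (B → ℝ) :=
  cs.lift ⟨fun i => rf M (al i), liftable M⟩

theorem rho_simple (cs : CoxeterSystem M W) (i : B) : rho cs (cs.simple i) = rf M (al i) :=
  cs.lift_apply_simple (liftable M) i

theorem rho_mul (cs : CoxeterSystem M W) (x y : W) (v : B → ℝ) :
    rho cs (x * y) v = rho cs x (rho cs y v) := by rw [map_mul]; rfl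

theorem rho_one (cs : CoxeterSystem M W) (v : B → ℝ) : rho cs 1 v = v := by rw [map_one]; rfl

theorem rho_inv_mul (cs : CoxeterSystem M W) (x : W) (v : B → ℝ) :
    rho cs x⁻¹ (rho cs x v) = v := by rw [← rho_mul]; simp

theorem rho_mul_inv (cs : CoxeterSystem M W) (x : W) (v : B → ℝ) :
    rho cs x (rho cs x⁻¹ v) = v := by rw [← rho_mul]; simp

theorem rho_s (cs : CoxeterSystem M W) (i : B) (v : B → ℝ) :
    rho cs (cs.simple i) v = v - (2 * bf M (al i) v) • al i := by rw [rho_simple, rf_apply]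

theorem rho_s_self (cs : CoxeterSystem M W) (i : B) : rho cs (cs.simple i) (al i) = - al i := by
  rw [rho_simple, rf_self M (bf_al_self M i)]

theorem rho_bf (cs : CoxeterSystem M W) (x : W) (u v : B → ℝ) :
    bf M (rho cs x u) (rho cs x v) = bf M u v := by
  induction x using cs.simple_induction_left with
  | one => simp [rho_one]
  | mul_simple_left w i ih => rw [rho_mul, rho_mul, rho_simple, rf_bf M (bf_al_self M i), ih]

theorem rho_refl (cs : CoxeterSystem M W) (z : W) (l : B) (v : B → ℝ) :
    rho cs (z * cs.simple l * z⁻¹) v = v - (2 * bf M (rho cs z (al l)) v) • rho cs z (al l) := by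
  rw [rho_mul, rho_mul, rho_s, map_sub, map_smul, rho_mul_inv]
  rw [← rho_bf cs z (al l), rho_mul_inv]

/-- alternating products -/
def P (cs : CoxeterSystem M W) : B → B → ℕ → W
  | _, _, 0 => 1
  | f, f', (k+1) => cs.simple f * P cs f' f k

/-- letters -/
def lt : B → B → ℕ → B
  | f, _, 0 => f
  | f, f', (k+1) => lt f' f k

theorem P_zero (cs : CoxeterSystem M W) (f f' : B) : P cs f f' 0 = 1 := rfl
theorem P_succ (cs : CoxeterSystem M W) (f f' : B) (k : ℕ) : P cs f f' (k+1) = cs.simple f * P cs f' f k := rfl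
theorem P_succ' (cs : CoxeterSystem M W) (f f' : B) (k : ℕ) :
    P cs f f' (k+1) = P cs f f' k * cs.simple (lt f f' k) := by
  induction k generalizing f f' with
  | zero => simp [P, lt]
  | succ k ih => rw [P_succ, ih, P_succ, mul_assoc]; rfl

theorem lt_mem (f f' : B) (k : ℕ) : lt f f' k = f ∧ lt f' f k = f' ∨ lt f f' k = f' ∧ lt f' f k = f := by
  induction k generalizing f f' with
  | zero => simp [lt]
  | succ k ih => have := ih f' f; simp only [lt]; tauto

theorem P_root (cs : CoxeterSystem M W) (f f' : B) (k : ℕ) :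
    rho cs (P cs f f' k) (al (lt f f' k)) = U (kap (M f f')) (k+1) • al f + U (kap (M f f')) k • al f' := by
  induction k generalizing f f' with
  | zero => simp [P, lt, U, rho_one]
  | succ k ih =>
    rw [P_succ, rho_mul, lt, ih, map_add, map_smul, map_smul, rho_s_self, rho_s, bf_al, U_add_two,
      M.symmetric f' f]
    module

theorem P_two (cs : CoxeterSystem M W) (f f' : B) (k : ℕ) :
    P cs f f' (2 * k) = (cs.simple f * cs.simple f')^k := by
  induction k with
  | zero => simp [P]
  | succ k ih => rw [show 2 * (k+1) = (2*k+1)+1 by ring, P_succ, P_succ, ih, pow_succ', mul_assoc]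

theorem P_add_inv (cs : CoxeterSystem M W) (f f' : B) (k : ℕ) :
    P cs f f' (k + 1) * cs.simple (lt f f' k) = P cs f f' k := by
  rw [P_succ', mul_assoc, cs.simple_mul_simple_self, mul_one]

/-- `P f f' a * P (l) (l') b = P f f' (a+b)` via letters -/
theorem P_add (cs : CoxeterSystem M W) (f f' : B) (a b : ℕ) :
    P cs f f' (a + b) = P cs f f' a * P cs (lt f f' a) (lt f' f a) b := by
  induction a generalizing f f' with
  | zero => simp [P, lt]
  | succ a ih => rw [show a + 1 + b = (a + b) + 1 by ring, P_succ, P_succ, ih, mul_assoc]; rfl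

theorem lt_add (f f' : B) (a b : ℕ) : lt f f' (a + b) = lt (lt f f' a) (lt f' f a) b := by
  induction a generalizing f f' with
  | zero => simp [lt]
  | succ a ih => rw [show a + 1 + b = (a + b) + 1 by ring, lt, ih]; rfl

theorem P_inv (cs : CoxeterSystem M W) (f f' : B) (k : ℕ) :
    (P cs f f' (k+1))⁻¹ = P cs (lt f f' k) (lt f' f k) (k+1) := by
  induction k generalizing f f' with
  | zero => simp [P, lt]
  | succ k ih =>
    rw [P_succ cs f, mul_inv_rev, ih, cs.inv_simple]
    rw [P_succ' cs (lt f f' (k+1))]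
    have : lt (lt f f' (k+1)) (lt f' f (k+1)) (k+1) = f := by
      have e := lt_mem f' f k
      simp only [lt]
      rcases e with ⟨e1, e2⟩ | ⟨e1, e2⟩
      · rw [e1, e2, e2]
      · rw [e1, e2, e1]
    rw [this]; rfl

theorem braid (cs : CoxeterSystem M W) (f f' : B) : P cs f f' (M f f') = P cs f' f (M f f') := by
  rcases Nat.eq_zero_or_pos (M f f') with h | h
  · simp [h, P]
  obtain ⟨k, hk⟩ := Nat.exists_eq_succ_of_ne_zero h.ne'
  have h1 := P_two cs f f' (M f f')
  rw [cs.simple_mul_simple_pow, two_mul, P_add] at h1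
  have h2 := eq_inv_of_mul_eq_one_left h1
  rw [h2, hk, P_inv]
  have h3 := lt_mem f f' k
  simp only [lt]
  rcases h3 with ⟨e1, e2⟩ | ⟨e1, e2⟩
  · rw [e1, e2, e1, e2]
  · rw [e1, e2, e1, e2]

end rep
end Shi

namespace Shi
section roots
variable [Fintype B] [DecidableEq B]

theorem lt_succ_ne {f f' e e' : B} {n : ℕ} (h : f = e ∧ f' = e' ∨ f = e' ∧ f' = e) (h1 : lt f f' n = e)
    (hne : e ≠ e') : lt f f' (n+1) = e' := by
  have h2 := lt_mem f f' n
  simp only [lt]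
  rcases h with ⟨rfl, rfl⟩ | ⟨rfl, rfl⟩ <;> rcases h2 with ⟨a, b⟩ | ⟨a, b⟩
  · exact b
  · exact absurd (h1.symm.trans a) hne
  · exact absurd (h1.symm.trans a) hne
  · exact b

theorem ss (cs : CoxeterSystem M W) (w : W) (i : B) : w * cs.simple i * cs.simple i = w := by
  rw [mul_assoc, cs.simple_mul_simple_self, mul_one]

theorem strip (cs : CoxeterSystem M W) (N : ℕ) : ∀ (w : W) (e e' : B), cs.length w = N → e ≠ e' →
    cs.length (w * cs.simple e) + 1 = cs.length w →
    ∃ (h0 : W) (n : ℕ) (f f' : B), (f = e ∧ f' = e' ∨ f = e' ∧ f' = e) ∧ 1 ≤ n ∧ w = h0 * P cs f f' n ∧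
      cs.length w = cs.length h0 + n ∧ lt f f' n = e' ∧
      cs.length (h0 * cs.simple e) = cs.length h0 + 1 ∧ cs.length (h0 * cs.simple e') = cs.length h0 + 1 := by
  induction N with
  | zero => intro w e e' h _ h2; omega
  | succ N ih =>
    intro w e e' hw hne hd
    rcases cs.length_mul_simple (w * cs.simple e) e' with h | h
    · refine ⟨w * cs.simple e, 1, e, e', Or.inl ⟨rfl, rfl⟩, le_refl _, ?_, hd.symm, rfl, ?_, h⟩
      · simp [P]
      · rw [ss]; omega
    · obtain ⟨h0, n, f, f', hf, hn, hw1, hl, hlt, a1, a2⟩ := ih (w * cs.simple e) e' e (by omega) hne.symm h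
      refine ⟨h0, n+1, f, f', hf.symm, by omega, ?_, by omega, lt_succ_ne hf.symm hlt hne, a2, a1⟩
      rw [P_succ', hlt, ← mul_assoc, ← hw1, ss]

theorem len_P (cs : CoxeterSystem M W) (f f' : B) (k : ℕ) : cs.length (P cs f f' k) ≤ k := by
  induction k with
  | zero => simp [P]
  | succ k ih =>
    rw [P_succ']
    have := cs.length_mul_le (P cs f f' k) (cs.simple (lt f f' k))
    rw [cs.length_simple] at this; omega

theorem lt_swap {f f' : B} (k : ℕ) : lt f' f k = lt f f' (k+1) := rfl

theorem P_m1 (cs : CoxeterSystem M W) {f f' : B} (hm : M f f' ≠ 0) :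
    P cs f f' (M f f' + 1) = P cs f' f (M f f' - 1) := by
  obtain ⟨k, hk⟩ := Nat.exists_eq_succ_of_ne_zero hm
  rw [P_succ', braid, hk, Nat.succ_eq_add_one, Nat.add_sub_cancel, ← lt_swap, P_add_inv]

theorem len_bound (cs : CoxeterSystem M W) {f f' : B} (hm : M f f' ≠ 0) {h0 : W} {k : ℕ}
    (h : cs.length (h0 * P cs f f' k) = cs.length h0 + k) : k ≤ M f f' := by
  by_contra hk
  obtain ⟨j, rfl⟩ := Nat.exists_eq_add_of_le (show M f f' + 1 ≤ k by omega)
  rw [P_add, P_m1 cs hm, ← mul_assoc] at h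
  have a1 := cs.length_mul_le (h0 * P cs f' f (M f f' - 1)) (P cs (lt f f' (M f f' + 1)) (lt f' f (M f f' + 1)) j)
  have a2 := cs.length_mul_le h0 (P cs f' f (M f f' - 1))
  have a3 := len_P cs f' f (M f f' - 1)
  have a4 := len_P cs (lt f f' (M f f' + 1)) (lt f' f (M f f' + 1)) j
  omega

theorem al_nonneg (i : B) : (0 : B → ℝ) ≤ al i := by
  unfold al; rw [Pi.le_def]; intro j; simp only [Pi.zero_apply, Pi.single_apply]; split_ifs <;> norm_num

theorem dih_pos {f f' : B} (cs : CoxeterSystem M W) (hne : f ≠ f') (h0 : W) (k : ℕ) (h1 : 0 ≤ rho cs h0 (al f))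
    (h2 : 0 ≤ rho cs h0 (al f')) (hk : M f f' ≠ 0 → k + 1 ≤ M f f') :
    0 ≤ rho cs (h0 * P cs f f' k) (al (lt f f' k)) := by
  rw [rho_mul, P_root, map_add, map_smul, map_smul]
  have hU : ∀ l, (M f f' ≠ 0 → l ≤ M f f') → 0 ≤ U (kap (M f f')) l := by
    intro l hl
    rcases Nat.eq_zero_or_pos l with rfl | hl0
    · simp [U]
    by_cases h : M f f' ≠ 0 ∧ l = M f f'
    · rw [h.2, U_m]; have := M_ne M hne; omega
    · exact (U_pos (M_ne M hne) hl0 (fun h3 => by have := hl h3; omega)).le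
  exact add_nonneg (smul_nonneg (hU _ hk) h1) (smul_nonneg (hU _ (fun h => by have := hk h; omega)) h2)

theorem pos_aux (cs : CoxeterSystem M W) (N : ℕ) : ∀ (w : W) (i : B), cs.length w = N →
    cs.length (w * cs.simple i) = cs.length w + 1 → 0 ≤ rho cs w (al i) := by
  induction N using Nat.strong_induction_on with
  | _ N ih =>
    intro w i hN hi
    by_cases hw : w = 1
    · subst hw; rw [rho_one]; exact al_nonneg i
    obtain ⟨t, ht⟩ := cs.exists_rightDescent_of_ne_one hw
    rw [cs.isRightDescent_iff] at ht
    have hti : t ≠ i := by rintro rfl; omega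
    obtain ⟨h0, n, f, f', hf, hn, hw1, hl, hlt, a1, a2⟩ := strip cs _ w t i rfl hti ht
    have b1 := ih (cs.length h0) (by omega) h0 t rfl a1
    have b2 := ih (cs.length h0) (by omega) h0 i rfl a2
    have hff : f ≠ f' := by rcases hf with ⟨rfl, rfl⟩ | ⟨rfl, rfl⟩ <;> [exact hti; exact hti.symm]
    have := dih_pos cs hff h0 n (by rcases hf with ⟨rfl, rfl⟩ | ⟨rfl, rfl⟩ <;> assumption)
      (by rcases hf with ⟨rfl, rfl⟩ | ⟨rfl, rfl⟩ <;> assumption) (fun hm => by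
        apply len_bound cs hm (h0 := h0)
        rw [P_succ', hlt, ← mul_assoc, ← hw1]; omega)
    rwa [hlt, ← hw1] at this

theorem pos_of_asc (cs : CoxeterSystem M W) {w : W} {i : B}
    (h : cs.length (w * cs.simple i) = cs.length w + 1) : 0 ≤ rho cs w (al i) := pos_aux cs _ w i rfl h

theorem neg_of_desc (cs : CoxeterSystem M W) {w : W} {i : B}
    (h : cs.length (w * cs.simple i) + 1 = cs.length w) : rho cs w (al i) ≤ 0 := by
  have := pos_of_asc cs (w := w * cs.simple i) (i := i) (by rw [ss]; omega)
  rw [rho_mul, rho_s_self, map_neg] at this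
  exact neg_nonneg.1 this

/-- roots -/
def IsRoot (cs : CoxeterSystem M W) (v : B → ℝ) : Prop := ∃ w i, v = rho cs w (al i)

theorem IsRoot.al (cs : CoxeterSystem M W) (i : B) : IsRoot cs (Shi.al i) := ⟨1, i, (rho_one cs _).symm⟩

theorem IsRoot.rho {cs : CoxeterSystem M W} {v : B → ℝ} (h : IsRoot cs v) (x : W) : IsRoot cs (Shi.rho cs x v) := by
  obtain ⟨w, i, rfl⟩ := h; exact ⟨x * w, i, (rho_mul cs _ _ _).symm⟩

theorem IsRoot.neg {cs : CoxeterSystem M W} {v : B → ℝ} (h : IsRoot cs v) : IsRoot cs (-v) := by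
  obtain ⟨w, i, rfl⟩ := h
  exact ⟨w * cs.simple i, i, by rw [rho_mul, rho_s_self, map_neg]⟩

theorem IsRoot.norm {cs : CoxeterSystem M W} {v : B → ℝ} (h : IsRoot cs v) : bf M v v = 1 := by
  obtain ⟨w, i, rfl⟩ := h; rw [rho_bf, bf_al_self]

theorem IsRoot.ne {cs : CoxeterSystem M W} {v : B → ℝ} (h : IsRoot cs v) : v ≠ 0 := by
  rintro rfl; have := h.norm; simp at this

theorem IsRoot.pos_or {cs : CoxeterSystem M W} {v : B → ℝ} (h : IsRoot cs v) : 0 ≤ v ∨ v ≤ 0 := by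
  obtain ⟨w, i, rfl⟩ := h
  rcases cs.length_mul_simple w i with h | h
  · exact Or.inl (pos_of_asc cs h)
  · exact Or.inr (neg_of_desc cs h)

theorem IsRoot.not_both {cs : CoxeterSystem M W} {v : B → ℝ} (h : IsRoot cs v) (h1 : 0 ≤ v) (h2 : v ≤ 0) : False :=
  h.ne (le_antisymm h2 h1)

theorem IsRoot.refl {cs : CoxeterSystem M W} {v η : B → ℝ} (h : IsRoot cs v) (hη : IsRoot cs η) :
    IsRoot cs (v - (2 * bf M η v) • η) := by
  obtain ⟨w, i, rfl⟩ := hη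
  rw [← rho_refl]; exact h.rho _

theorem asc_of_pos (cs : CoxeterSystem M W) {w : W} {i : B} (h : 0 ≤ rho cs w (al i)) :
    cs.length (w * cs.simple i) = cs.length w + 1 := by
  rcases cs.length_mul_simple w i with h1 | h1
  · exact h1
  · exact (IsRoot.not_both ⟨w, i, rfl⟩ h (neg_of_desc cs h1)).elim

theorem desc_of_neg (cs : CoxeterSystem M W) {w : W} {i : B} (h : rho cs w (al i) ≤ 0) :
    cs.length (w * cs.simple i) + 1 = cs.length w := by
  rcases cs.length_mul_simple w i with h1 | h1
  · exact (IsRoot.not_both ⟨w, i, rfl⟩ (pos_of_asc cs h1) h).elim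
  · exact h1

theorem al_apply_ne {i k : B} (h : k ≠ i) : al i k = 0 := by simp [al, h]
theorem al_apply_self (i : B) : al i i = 1 := by simp [al]

theorem rho_s_apply_ne (cs : CoxeterSystem M W) {i k : B} (h : k ≠ i) (v : B → ℝ) :
    rho cs (cs.simple i) v k = v k := by
  rw [rho_s]; simp [al_apply_ne h]

theorem IsRoot.simple_of_supp {cs : CoxeterSystem M W} {v : B → ℝ} (h : IsRoot cs v) (h0 : 0 ≤ v) (i : B)
    (h1 : ∀ k, k ≠ i → v k = 0) : v = Shi.al i := by
  have hv : v = (v i) • Shi.al i := by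
    ext k
    by_cases hk : k = i
    · subst hk; simp [al_apply_self]
    · simp [al_apply_ne hk, h1 k hk]
  have hn := h.norm
  rw [hv] at hn
  simp only [map_smul, LinearMap.smul_apply, bf_al_self, smul_eq_mul] at hn
  have hi : 0 ≤ v i := h0 i
  have : v i = 1 := by nlinarith
  rw [hv, this, one_smul]

theorem IsRoot.simple_of_neg {cs : CoxeterSystem M W} {v : B → ℝ} (h : IsRoot cs v) (h0 : 0 ≤ v) (i : B)
    (h1 : Shi.rho cs (cs.simple i) v ≤ 0) : v = Shi.al i := by
  apply h.simple_of_supp h0 i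
  intro k hk
  have := h1 k
  rw [rho_s_apply_ne cs hk] at this
  exact le_antisymm this (h0 k)

theorem faithful (cs : CoxeterSystem M W) {w : W} (h : ∀ v, rho cs w v = v) : w = 1 := by
  by_contra hw
  obtain ⟨t, ht⟩ := cs.exists_rightDescent_of_ne_one hw
  rw [cs.isRightDescent_iff] at ht
  have := neg_of_desc cs ht
  rw [h] at this
  exact (IsRoot.al cs t).not_both (al_nonneg t) this

theorem faithful' (cs : CoxeterSystem M W) {w w' : W} (h : ∀ v, rho cs w v = rho cs w' v) : w = w' := by
  have : w'⁻¹ * w = 1 := faithful cs (fun v => by rw [rho_mul, h, rho_inv_mul])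
  exact (inv_mul_eq_one.1 this).symm

theorem refl_eq (cs : CoxeterSystem M W) {z z' : W} {l l' : B}
    (h : rho cs z (al l) = rho cs z' (al l') ∨ rho cs z (al l) = - rho cs z' (al l')) :
    z * cs.simple l * z⁻¹ = z' * cs.simple l' * z'⁻¹ := by
  apply faithful' cs
  intro v
  rw [rho_refl, rho_refl]
  rcases h with h | h
  · rw [h]
  · rw [h]; simp

theorem refl_len1 (cs : CoxeterSystem M W) (z : W) (l : B) (h0 : 0 ≤ rho cs z (al l)) (N : ℕ) :
    ∀ x, cs.length x = N → rho cs x⁻¹ (rho cs z (al l)) ≤ 0 →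
      cs.length (z * cs.simple l * z⁻¹ * x) < cs.length x := by
  have hr : IsRoot cs (rho cs z (al l)) := ⟨z, l, rfl⟩
  induction N with
  | zero =>
    intro x hx h
    rw [cs.length_eq_zero_iff] at hx
    subst hx
    rw [inv_one, rho_one] at h
    exact (hr.not_both h0 h).elim
  | succ N ih =>
    intro x hx h
    have hx1 : x ≠ 1 := by rintro rfl; simp at hx
    obtain ⟨i, hi⟩ := cs.exists_rightDescent_of_ne_one hx1
    rw [cs.isRightDescent_iff] at hi
    obtain ⟨y, hy⟩ : ∃ y, y = x * cs.simple i := ⟨_, rfl⟩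
    have hxy : x = y * cs.simple i := by rw [hy, ss]
    rw [← hy] at hi
    rcases (hr.rho y⁻¹).pos_or with h1 | h1
    · rw [hxy, mul_inv_rev, cs.inv_simple, rho_mul] at h
      have h2 := (hr.rho y⁻¹).simple_of_neg h1 i h
      have h3 : rho cs z (al l) = rho cs y (al i) := by rw [← h2, rho_mul_inv]
      rw [refl_eq cs (Or.inl h3), hxy]
      have : y * cs.simple i * y⁻¹ * (y * cs.simple i) = y := by
        simp [mul_assoc]
      rw [this, ← hxy]; omega
    · have := ih y (by omega) h1
      have h2 := cs.length_mul_le (z * cs.simple l * z⁻¹ * y) (cs.simple i)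
      rw [cs.length_simple] at h2
      rw [hxy, ← mul_assoc, ← hxy]
      omega

theorem refl_sq (cs : CoxeterSystem M W) (z : W) (l : B) (x : W) :
    z * cs.simple l * z⁻¹ * (z * cs.simple l * z⁻¹ * x) = x := by simp [mul_assoc]

theorem refl_inv (cs : CoxeterSystem M W) (z : W) (l : B) :
    (z * cs.simple l * z⁻¹)⁻¹ = z * cs.simple l * z⁻¹ := by simp [mul_assoc]

theorem rho_refl_self (cs : CoxeterSystem M W) (z : W) (l : B) :
    rho cs (z * cs.simple l * z⁻¹) (rho cs z (al l)) = - rho cs z (al l) := by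
  rw [rho_refl, rho_bf, bf_al_self]; module

theorem refl_len_neg (cs : CoxeterSystem M W) {z : W} {l : B} (h0 : 0 ≤ rho cs z (al l)) {x : W}
    (h : rho cs x⁻¹ (rho cs z (al l)) ≤ 0) : cs.length (z * cs.simple l * z⁻¹ * x) < cs.length x :=
  refl_len1 cs z l h0 _ x rfl h

theorem refl_len_pos (cs : CoxeterSystem M W) {z : W} {l : B} (h0 : 0 ≤ rho cs z (al l)) {x : W}
    (h : 0 ≤ rho cs x⁻¹ (rho cs z (al l))) : cs.length x < cs.length (z * cs.simple l * z⁻¹ * x) := by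
  have := refl_len_neg cs h0 (x := z * cs.simple l * z⁻¹ * x) (by
    rw [mul_inv_rev, refl_inv, rho_mul, rho_refl_self, map_neg]
    exact neg_nonpos.2 h)
  rwa [refl_sq] at this

theorem refl_len_iff (cs : CoxeterSystem M W) {z : W} {l : B} (h0 : 0 ≤ rho cs z (al l)) {x : W} :
    cs.length (z * cs.simple l * z⁻¹ * x) < cs.length x ↔ rho cs x⁻¹ (rho cs z (al l)) ≤ 0 := by
  refine ⟨fun h => ?_, refl_len_neg cs h0⟩
  rcases (IsRoot.rho (cs := cs) ⟨z, l, rfl⟩ x⁻¹).pos_or with h1 | h1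
  · have := refl_len_pos cs h0 h1; omega
  · exact h1

theorem inv_fin (cs : CoxeterSystem M W) (x : W) : {v | IsRoot cs v ∧ 0 ≤ v ∧ rho cs x v ≤ 0}.Finite := by
  induction x using cs.simple_induction_left with
  | one =>
    convert Set.finite_empty
    rw [Set.eq_empty_iff_forall_notMem]
    rintro v ⟨h, h1, h2⟩
    rw [rho_one] at h2
    exact h.not_both h1 h2
  | mul_simple_left y i ih =>
    apply (ih.union (Set.finite_singleton (rho cs y⁻¹ (al i)))).subset
    rintro v ⟨h, h1, h2⟩
    rcases (h.rho y).pos_or with h3 | h3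
    · right
      rw [rho_mul] at h2
      have := (h.rho y).simple_of_neg h3 i h2
      rw [Set.mem_singleton_iff, ← this, rho_inv_mul]
    · exact Or.inl ⟨h, h1, h3⟩

end roots
end Shi

namespace Shi
section links
variable [Fintype B] [DecidableEq B]

/-- height -/
def ht : (B → ℝ) →ₗ[ℝ] ℝ := ∑ k, LinearMap.proj k

theorem ht_apply (v : B → ℝ) : ht v = ∑ k, v k := by simp [ht]

theorem ht_pos {v : B → ℝ} (h : 0 ≤ v) (h0 : v ≠ 0) : 0 < ht v := by
  rw [ht_apply]
  apply Finset.sum_pos' (fun k _ => h k)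
  by_contra hc
  push Not at hc
  apply h0
  ext k
  exact le_antisymm (hc k (Finset.mem_univ k)) (h k)

theorem one_le_of_seq (c : ℝ) (s : ℕ → ℝ) (hs : ∀ n, 0 < s n) (hr : ∀ n, s (n+2) = 2 * c * s (n+1) - s n) : 1 ≤ c := by
  by_contra hc
  push Not at hc
  have h : ∀ n : ℕ, s (n+1) / s n ≤ s 1 / s 0 - n * (2 - 2 * c) := by
    intro n
    induction n with
    | zero => simp
    | succ n ih =>
      have a := hs n
      have b := hs (n+1)
      have e1 : s (n+1+1) / s (n+1) = 2 * c - s n / s (n+1) := by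
        rw [hr]; field_simp
      have e2 : 2 ≤ s n / s (n+1) + s (n+1) / s n := by
        rw [div_add_div _ _ b.ne' a.ne', le_div_iff₀ (mul_pos b a)]
        nlinarith [sq_nonneg (s n - s (n+1))]
      rw [e1]; push_cast; linarith
  obtain ⟨n, hn⟩ := exists_nat_gt (s 1 / s 0 / (2 - 2 * c))
  rw [div_lt_iff₀ (by linarith)] at hn
  have := div_pos (hs (n+1)) (hs n)
  linarith [h n]

theorem refl_pos (cs : CoxeterSystem M W) {q : W} (h : cs.IsReflection q) :
    ∃ z l, q = z * cs.simple l * z⁻¹ ∧ 0 ≤ rho cs z (al l) := by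
  obtain ⟨z, l, rfl⟩ := h
  rcases (show IsRoot cs (rho cs z (al l)) from ⟨z, l, rfl⟩).pos_or with h | h
  · exact ⟨z, l, rfl, h⟩
  · refine ⟨z * cs.simple l, l, by simp [mul_assoc], ?_⟩
    rw [rho_mul, rho_s_self, map_neg]; exact neg_nonneg.2 h

theorem neg_mono (cs : CoxeterSystem M W) {δ : B → ℝ} (hδ : IsRoot cs δ) (h0 : 0 ≤ δ) {y : W} {i : B}
    (ha : cs.length (y * cs.simple i) = cs.length y + 1) (h : rho cs y⁻¹ δ ≤ 0) :
    rho cs (y * cs.simple i)⁻¹ δ ≤ 0 := by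
  rcases (hδ.rho (y * cs.simple i)⁻¹).pos_or with h1 | h1
  · exfalso
    rw [mul_inv_rev, cs.inv_simple, rho_mul] at h1
    have h2 := (hδ.rho y⁻¹).neg.simple_of_neg (neg_nonneg.2 h) i (by rw [map_neg]; exact neg_nonpos.2 h1)
    have h3 : rho cs y (al i) = - δ := by rw [← h2, map_neg, rho_mul_inv]
    have h4 := pos_of_asc cs ha
    rw [h3] at h4
    exact hδ.not_both h0 (neg_nonneg.1 h4)
  · exact h1

/-- dominance -/
def Pd (cs : CoxeterSystem M W) (ξ η : B → ℝ) : Prop := ∀ y, rho cs y η ≤ 0 → rho cs y ξ ≤ 0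

theorem Pd_flip {cs : CoxeterSystem M W} {ξ η : B → ℝ} (h : Pd cs ξ η) (h1 : IsRoot cs ξ) (h2 : IsRoot cs η) :
    Pd cs (-η) (-ξ) := by
  intro y hy
  rw [map_neg] at hy ⊢
  rcases (h2.rho y).pos_or with h3 | h3
  · exact neg_nonpos.2 h3
  · exact ((h1.rho y).not_both (neg_nonpos.1 hy) (h y h3)).elim

theorem Pd_rho {cs : CoxeterSystem M W} {ξ η : B → ℝ} (h : Pd cs ξ η) (g : W) :
    Pd cs (rho cs g ξ) (rho cs g η) := by
  intro y hy
  rw [← rho_mul] at hy ⊢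
  exact h _ hy

theorem Pd_step {cs : CoxeterSystem M W} {u v : B → ℝ} (h : Pd cs u v) (h1 : IsRoot cs u) (h2 : IsRoot cs v) :
    Pd cs v ((2 * bf M v u) • v - u) := by
  obtain ⟨w, i, hw⟩ := h2
  have h3 := Pd_rho h (w * cs.simple i * w⁻¹)
  have h2' : IsRoot cs v := ⟨w, i, hw⟩
  have h4 := Pd_flip h3 (h1.rho _) (h2'.rho _)
  have e1 : rho cs (w * cs.simple i * w⁻¹) v = - v := by rw [hw, rho_refl_self]
  have e2 : rho cs (w * cs.simple i * w⁻¹) u = u - (2 * bf M v u) • v := by rw [hw, rho_refl]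
  rw [e1, e2, neg_neg, neg_sub] at h4
  exact h4

/-- iterated sequence -/
noncomputable def vs (c : ℝ) (δ β : B → ℝ) : ℕ → (B → ℝ)
  | 0 => δ
  | 1 => β
  | (n+2) => (2 * c) • vs c δ β (n+1) - vs c δ β n

theorem dom_ge_one (cs : CoxeterSystem M W) {δ β : B → ℝ} (hδ : IsRoot cs δ) (hβ : IsRoot cs β) (h0 : 0 ≤ δ)
    (h : Pd cs δ β) : 1 ≤ bf M β δ := by
  set c := bf M β δ with hc
  have key : ∀ n, IsRoot cs (vs c δ β n) ∧ IsRoot cs (vs c δ β (n+1)) ∧ Pd cs (vs c δ β n) (vs c δ β (n+1)) ∧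
      0 ≤ vs c δ β n ∧ bf M (vs c δ β (n+1)) (vs c δ β n) = c := by
    intro n
    induction n with
    | zero => exact ⟨hδ, hβ, h, h0, rfl⟩
    | succ n ih =>
      obtain ⟨a1, a2, a3, a4, a5⟩ := ih
      refine ⟨a2, ?_, ?_, ?_, ?_⟩
      · have := (a1.refl a2).neg
        rw [neg_sub, a5] at this
        exact this
      · have := Pd_step a3 a1 a2
        rw [a5] at this
        exact this
      · rcases a2.pos_or with h3 | h3
        · exact h3
        · have := a3 1 (by rwa [rho_one])
          rw [rho_one] at this
          exact (a1.not_both a4 this).elim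
      · show bf M ((2 * c) • vs c δ β (n+1) - vs c δ β n) (vs c δ β (n+1)) = c
        rw [map_sub, map_smul, LinearMap.sub_apply, LinearMap.smul_apply, a2.norm, bf_comm M, a5, smul_eq_mul]; ring
  apply one_le_of_seq c (fun n => ht (vs c δ β n)) (fun n => ht_pos (key n).2.2.2.1 (key n).1.ne)
  intro n
  show ht ((2 * c) • vs c δ β (n+1) - vs c δ β n) = _
  rw [map_sub, map_smul, smul_eq_mul]

theorem sep_dom (cs : CoxeterSystem M W) {h0 z : W} {j l : B} (hβ : 0 ≤ rho cs h0 (al j)) (hδ : 0 ≤ rho cs z (al l))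
    (hs : SepIdWall cs (z * cs.simple l * z⁻¹) (h0 * cs.simple j * h0⁻¹)) (N : ℕ) :
    ∀ x, cs.length x = N → rho cs x⁻¹ (rho cs h0 (al j)) ≤ 0 → rho cs x⁻¹ (rho cs z (al l)) ≤ 0 := by
  have hr : IsRoot cs (rho cs h0 (al j)) := ⟨h0, j, rfl⟩
  have hrδ : IsRoot cs (rho cs z (al l)) := ⟨z, l, rfl⟩
  induction N with
  | zero =>
    intro x hx h
    rw [cs.length_eq_zero_iff] at hx
    subst hx
    rw [inv_one, rho_one] at h
    exact (hr.not_both hβ h).elim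
  | succ N ih =>
    intro x hx h
    have hx1 : x ≠ 1 := by rintro rfl; simp at hx
    obtain ⟨i, hi⟩ := cs.exists_rightDescent_of_ne_one hx1
    rw [cs.isRightDescent_iff] at hi
    obtain ⟨y, hy⟩ : ∃ y, y = x * cs.simple i := ⟨_, rfl⟩
    have hxy : x = y * cs.simple i := by rw [hy, ss]
    rw [← hy] at hi
    rcases (hr.rho y⁻¹).pos_or with h1 | h1
    · rw [hxy, mul_inv_rev, cs.inv_simple, rho_mul] at h
      have h2 := (hr.rho y⁻¹).simple_of_neg h1 i h
      have h3 : rho cs h0 (al j) = rho cs y (al i) := by rw [← h2, rho_mul_inv]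
      have h4 := hs.2 x ⟨i, by rw [refl_eq cs (Or.inl h3), hxy]; simp [mul_assoc]⟩
      exact (refl_len_iff cs hδ).1 h4
    · have := ih y (by omega) h1
      rw [hxy]
      exact neg_mono cs hrδ hδ (by rw [← hxy]; omega) this

theorem link1 (cs : CoxeterSystem M W) {h0 : W} {j : B} (hβ : 0 ≤ rho cs h0 (al j))
    (hne : ¬ IsElementary cs (h0 * cs.simple j * h0⁻¹)) :
    ∃ ε, IsRoot cs ε ∧ 0 ≤ ε ∧ rho cs h0 ε ≤ 0 ∧ bf M ε (al j) ≤ -1 := by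
  have hr : ∃ q, SepIdWall cs q (h0 * cs.simple j * h0⁻¹) := by
    by_contra h
    exact hne ⟨⟨h0, j, rfl⟩, h⟩
  obtain ⟨q, hq⟩ := hr
  obtain ⟨z, l, rfl, hδ⟩ := refl_pos cs hq.1
  have hrδ : IsRoot cs (rho cs z (al l)) := ⟨z, l, rfl⟩
  have hd : Pd cs (rho cs z (al l)) (rho cs h0 (al j)) := by
    intro y hy
    have := sep_dom cs hβ hδ hq _ y⁻¹ rfl
    rw [inv_inv] at this
    exact this hy
  have h1 := dom_ge_one cs hrδ ⟨h0, j, rfl⟩ hδ hd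
  have h2 := (refl_len_iff cs hδ).1 (hq.2 h0 ⟨j, by simp [mul_assoc]⟩)
  refine ⟨- rho cs h0⁻¹ (rho cs z (al l)), (hrδ.rho _).neg, neg_nonneg.2 h2, ?_, ?_⟩
  · rw [map_neg, rho_mul_inv]; exact neg_nonpos.2 hδ
  · rw [map_neg, LinearMap.neg_apply, ← rho_bf cs h0, rho_mul_inv, bf_comm]; linarith

theorem U_inc {c : ℝ} (hc : 1 ≤ c) (n : ℕ) : 0 ≤ U c n ∧ U c n + 1 ≤ U c (n+1) := by
  induction n with
  | zero => simp [U]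
  | succ n ih => rw [U_add_two]; constructor <;> nlinarith

theorem root_of_refl_eq (cs : CoxeterSystem M W) {z f : W} {l i : B}
    (h : z * cs.simple l * z⁻¹ = f * cs.simple i * f⁻¹) :
    rho cs z (al l) = rho cs f (al i) ∨ rho cs z (al l) = - rho cs f (al i) := by
  have h1 := rho_refl_self cs z l
  rw [h, rho_refl] at h1
  set u := rho cs z (al l)
  set v := rho cs f (al i)
  have hu : bf M u u = 1 := IsRoot.norm (cs := cs) ⟨z, l, rfl⟩
  have hv : bf M v v = 1 := IsRoot.norm (cs := cs) ⟨f, i, rfl⟩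
  have h2 : u = (bf M v u) • v := by
    have : (2:ℝ) • u = (2:ℝ) • ((bf M v u) • v) := by
      have : u - (2 * bf M v u) • v + u = 0 := by rw [h1]; simp
      rw [← sub_eq_zero, ← this]; module
    exact smul_right_injective _ (two_ne_zero) this
  set c := bf M v u
  have h3 : c * c = 1 := by
    have := hu
    rw [h2] at this
    simp only [map_smul, LinearMap.smul_apply, hv, smul_eq_mul] at this
    linarith
  rcases mul_self_eq_one_iff.1 h3 with h4 | h4
  · left; rw [h2, h4, one_smul]
  · right; rw [h2, h4]; simp

theorem link2 (cs : CoxeterSystem M W) {h0 z : W} {l : B} {γ ε : B → ℝ} (hel : IsElementary cs (z * cs.simple l * z⁻¹))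
    (hz : rho cs z (al l) = rho cs h0 γ) (hγ : 0 ≤ γ) (hε : IsRoot cs ε) (hε0 : 0 ≤ ε) (hε1 : rho cs h0 ε ≤ 0) :
    -1 < bf M ε γ := by
  by_contra hb
  push Not at hb
  obtain ⟨c, hc⟩ : ∃ c, c = - bf M ε γ := ⟨_, rfl⟩
  have hc1 : 1 ≤ c := by linarith
  have hrγ : IsRoot cs γ := by
    have : γ = rho cs h0⁻¹ (rho cs z (al l)) := by rw [hz, rho_inv_mul]
    rw [this]; exact IsRoot.rho ⟨z, l, rfl⟩ _
  apply hel.2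
  have hδr := (hε.rho h0).neg
  obtain ⟨w, k, hw⟩ := hδr
  have hw0 : 0 ≤ rho cs w (al k) := by rw [← hw]; exact neg_nonneg.2 hε1
  refine ⟨w * cs.simple k * w⁻¹, ⟨w, k, rfl⟩, ?_⟩
  rintro f ⟨i, hi⟩
  rw [refl_len_iff cs hw0, ← hw, map_neg, ← rho_mul]
  obtain ⟨g, hg⟩ : ∃ g, g = f⁻¹ * h0 := ⟨_, rfl⟩
  rw [← hg]
  rcases (hε.rho g).pos_or with h1 | h1
  · exact neg_nonpos.2 h1
  exfalso
  have hγi : rho cs g γ = al i ∨ rho cs g γ = - al i := by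
    have : z * cs.simple l * z⁻¹ = f * cs.simple i * f⁻¹ := by rw [← hi]; simp [mul_assoc]
    rw [hg, rho_mul, ← hz]
    rcases root_of_refl_eq cs this with h | h
    · left; rw [h, rho_inv_mul]
    · right; rw [h, map_neg, rho_inv_mul]
  have hY : ∀ n, IsRoot cs (U c (n+1) • γ + U c n • ε) ∧ IsRoot cs (U c (n+2) • γ + U c (n+1) • ε) ∧
      bf M (U c (n+2) • γ + U c (n+1) • ε) (U c (n+1) • γ + U c n • ε) = c := by
    intro n
    have eγ := hrγ.norm
    have eε := hε.norm
    have eγε : bf M γ ε = -c := by rw [bf_comm, hc, neg_neg]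
    have eεγ : bf M ε γ = -c := by rw [hc, neg_neg]
    induction n with
    | zero =>
      refine ⟨by simpa [U] using hrγ, ?_, ?_⟩
      · have := hε.refl hrγ
        rw [eγε] at this
        convert this using 1
        simp only [U]; module
      · simp [U, eγ, eεγ]; ring
    | succ n ih =>
      obtain ⟨a1, a2, a3⟩ := ih
      have e : U c (n+3) • γ + U c (n+2) • ε = (2 * c) • (U c (n+2) • γ + U c (n+1) • ε) - (U c (n+1) • γ + U c n • ε) := by
        rw [U_add_two c (n+1), U_add_two c n]; module
      refine ⟨a2, ?_, ?_⟩
      · have := (a1.refl a2).neg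
        rw [neg_sub, a3, ← e] at this
        exact this
      · show bf M (U c (n+3) • γ + U c (n+2) • ε) _ = c
        rw [e, map_sub, map_smul, LinearMap.sub_apply, LinearMap.smul_apply, a2.norm, bf_comm M, a3, smul_eq_mul]; ring
  have hpos : ∀ n, 0 ≤ U c (n+1) • γ + U c n • ε := fun n =>
    add_nonneg (smul_nonneg (U_inc hc1 _).1 hγ) (smul_nonneg (U_inc hc1 _).1 hε0)
  have hneg : ∀ n, rho cs g (U c (n+2) • γ + U c (n+1) • ε) ≤ 0 := by
    intro n
    rcases ((hY n).2.1.rho g).pos_or with h2 | h2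
    swap
    · exact h2
    have u1 : 0 < U c (n+1) := by have := U_inc hc1 n; linarith
    rw [map_add, map_smul, map_smul] at h2
    rcases hγi with h3 | h3
    · exfalso
      have h4 : - rho cs g ε = al i := by
        apply (hε.rho g).neg.simple_of_supp (neg_nonneg.2 h1)
        intro k hk
        have h5 := h2 k
        have h6 := h1 k
        rw [h3] at h5
        simp only [Pi.add_apply, Pi.smul_apply, al_apply_ne hk, smul_eq_mul, Pi.zero_apply, mul_zero, zero_add] at h5 h6
        simp only [Pi.neg_apply, neg_eq_zero]
        nlinarith
      rw [← h3] at h4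
      have h5 : - ε = γ := by
        have := congrArg (rho cs g⁻¹) h4
        rwa [map_neg, rho_inv_mul, rho_inv_mul] at this
      rw [← h5] at hγ
      exact hε.not_both hε0 (neg_nonneg.1 hγ)
    · rw [map_add, map_smul, map_smul, h3]
      exact add_nonpos (smul_nonpos_of_nonneg_of_nonpos (U_inc hc1 _).1 (neg_nonpos.2 (al_nonneg i)))
        (smul_nonpos_of_nonneg_of_nonpos (U_inc hc1 _).1 h1)
  have hmono : StrictMono (fun n : ℕ => ht (U c (n+2) • γ + U c (n+1) • ε)) := by
    apply strictMono_nat_of_lt_succ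
    intro n
    simp only [map_add, map_smul, smul_eq_mul]
    have b1 := ht_pos hγ hrγ.ne
    have b2 := ht_pos hε0 hε.ne
    have b3 := U_inc hc1 (n+1)
    have b4 := U_inc hc1 (n+2)
    rw [show n + 1 + 2 = n + 2 + 1 by ring]
    rw [show n + 1 + 1 = n + 2 by ring] at *
    nlinarith
  have hinj : Function.Injective (fun n : ℕ => U c (n+2) • γ + U c (n+1) • ε) := by
    intro a b hab
    exact hmono.injective (congrArg ht hab)
  have hmem : ∀ n : ℕ, (fun n : ℕ => U c (n+2) • γ + U c (n+1) • ε) n ∈ {v | IsRoot cs v ∧ 0 ≤ v ∧ rho cs g v ≤ 0} :=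
    fun n => ⟨(hY n).2.1, hpos (n+1), hneg n⟩
  exact Set.infinite_of_injective_forall_mem hinj hmem (inv_fin cs g)

end links
end Shi

namespace Shi
section bip
variable [Fintype B] [DecidableEq B]

/-- sum of coordinates outside `i, j` -/
def cf (i j : B) : (B → ℝ) →ₗ[ℝ] ℝ := ∑ k ∈ (Finset.univ \ {i, j}), LinearMap.proj k

theorem cf_apply (i j : B) (v : B → ℝ) : cf i j v = ∑ k ∈ (Finset.univ \ {i, j}), v k := by simp [cf]

theorem cf_i (i j : B) : cf i j (al i) = 0 := by
  rw [cf_apply]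
  apply Finset.sum_eq_zero
  intro k hk
  simp at hk
  exact al_apply_ne hk.1

theorem cf_j (i j : B) : cf i j (al j) = 0 := by
  rw [cf_apply]
  apply Finset.sum_eq_zero
  intro k hk
  simp at hk
  exact al_apply_ne hk.2

theorem N_of {cs : CoxeterSystem M W} {h0 : W} {i j : B} {v : B → ℝ} (hv : IsRoot cs v) (hc : 0 < cf i j v)
    (hH : ht (rho cs h0 v) < 0) : 0 ≤ v ∧ rho cs h0 v ≤ 0 := by
  constructor
  · rcases hv.pos_or with h | h
    · exact h
    · exfalso
      rw [cf_apply] at hc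
      exact absurd (Finset.sum_nonpos (fun k _ => h k)) (not_le.2 hc)
  · rcases (hv.rho h0).pos_or with h | h
    · exact absurd (ht_pos h (hv.rho h0).ne) (not_lt.2 hH.le)
    · exact h

theorem of_N {cs : CoxeterSystem M W} {h0 : W} {i j : B} (hij : i ≠ j) (hi : 0 ≤ rho cs h0 (al i)) (hj : 0 ≤ rho cs h0 (al j))
    {v : B → ℝ} (hv : IsRoot cs v) (h1 : 0 ≤ v) (h2 : rho cs h0 v ≤ 0) :
    0 < cf i j v ∧ ht (rho cs h0 v) < 0 := by
  constructor
  · have hc : 0 ≤ cf i j v := by rw [cf_apply]; exact Finset.sum_nonneg (fun k _ => h1 k)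
    rcases hc.eq_or_lt with hc | hc
    · exfalso
      rw [cf_apply] at hc
      have hz := (Finset.sum_eq_zero_iff_of_nonneg (fun k _ => h1 k)).1 hc.symm
      have e : v = v i • al i + v j • al j := by
        ext k
        simp only [Pi.add_apply, Pi.smul_apply, smul_eq_mul]
        by_cases h3 : k = i
        · subst h3; rw [al_apply_self, al_apply_ne hij]; ring
        · by_cases h4 : k = j
          · subst h4; rw [al_apply_self, al_apply_ne hij.symm]; ring
          · rw [al_apply_ne h3, al_apply_ne h4, hz k (by simp [h3, h4])]; ring
      refine (hv.rho h0).not_both ?_ h2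
      rw [e, map_add, map_smul, map_smul]
      exact add_nonneg (smul_nonneg (h1 i) hi) (smul_nonneg (h1 j) hj)
    · exact hc
  · have := ht_pos (neg_nonneg.2 h2) (neg_ne_zero.2 (hv.rho h0).ne)
    rw [map_neg] at this
    linarith

theorem bip (cs : CoxeterSystem M W) {h0 z : W} {i j l : B} (hij : i ≠ j)
    (hi : 0 ≤ rho cs h0 (al i)) (hj : 0 ≤ rho cs h0 (al j)) {k : ℕ} (hk : 2 ≤ k) (hkm : k + 1 ≤ M i j)
    (hne : ¬ IsElementary cs (h0 * cs.simple j * h0⁻¹))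
    (hz : rho cs z (al l) = rho cs h0 (U (kap (M i j)) k • al j + U (kap (M i j)) (k-1) • al i)) :
    ¬ IsElementary cs (z * cs.simple l * z⁻¹) := by
  intro hel
  obtain ⟨m, hm⟩ : ∃ m, m = M i j := ⟨_, rfl⟩
  rw [← hm] at hkm hz
  have hm2 : 2 ≤ m := by omega
  have hab : bf M (al i) (al j) = - kap m := by rw [bf_al, ← hm]
  have hba : bf M (al j) (al i) = - kap m := by rw [bf_comm, hab]
  have haa := bf_al_self M i
  have hbb := bf_al_self M j
  obtain ⟨ρ₀, hρ, hρ0, hρ1, hρ2⟩ := link1 cs hj hne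
  have hγ : 0 ≤ U (kap m) k • al j + U (kap m) (k-1) • al i :=
    add_nonneg (smul_nonneg (U_pos (Or.inr hm2) (by omega) (by omega)).le (al_nonneg j))
      (smul_nonneg (U_pos (Or.inr hm2) (by omega) (by omega)).le (al_nonneg i))
  have L2 : ∀ ε, IsRoot cs ε → 0 ≤ ε → rho cs h0 ε ≤ 0 →
      -1 < U (kap m) (k-1) * bf M ε (al i) + U (kap m) k * bf M ε (al j) := by
    intro ε e1 e2 e3
    have := link2 cs hel hz hγ e1 e2 e3
    rw [map_add, map_smul, map_smul, smul_eq_mul, smul_eq_mul] at this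
    linarith
  have hκ0 := kap_nonneg hm2
  rcases (show k + 1 = m ∨ k + 2 ≤ m by omega) with hk1 | hk2
  · have ey : U (kap m) k = 1 := by rw [show k = m - 1 by omega]; exact U_m1 hm2
    have ex : U (kap m) (k-1) = 2 * kap m := by
      rw [show k - 1 = m - 2 by omega, U_refl hm2 (by omega)]; simp [U]
    rw [ex, ey] at L2
    have A0 := L2 ρ₀ hρ hρ0 hρ1
    have hA : 0 ≤ bf M ρ₀ (al i) := by
      by_contra hc
      push Not at hc
      nlinarith
    have hs := rho_s cs i ρ₀
    have hr := hρ.rho (cs.simple i)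
    have h3 : 0 ≤ rho cs (cs.simple i) ρ₀ := by
      rcases hr.pos_or with h | h
      · exact h
      · have := hρ.simple_of_neg hρ0 i h
        rw [this] at hρ1
        exact (((IsRoot.al cs i).rho h0).not_both hi hρ1).elim
    have h4 : rho cs h0 (rho cs (cs.simple i) ρ₀) ≤ 0 := by
      rw [hs, map_sub, map_smul, bf_comm]
      exact (sub_le_self _ (smul_nonneg (by linarith) hi)).trans hρ1
    have h5 := L2 _ hr h3 h4
    rw [hs] at h5
    simp only [map_sub, map_smul, LinearMap.sub_apply, LinearMap.smul_apply, smul_eq_mul, haa, hab] at h5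
    rw [bf_comm M (al i) ρ₀] at h5
    nlinarith
  · have hm4 : 4 ≤ m := by omega
    -- choose the minimizing element
    let S : Set (B → ℝ) := {ε | (IsRoot cs ε ∧ 0 ≤ ε ∧ rho cs h0 ε ≤ 0) ∧
      ∃ r r' t : ℝ, 0 ≤ r ∧ 0 ≤ r' ∧ 0 < t ∧ ρ₀ = r • al i + r' • al j + t • ε}
    have hSf : S.Finite := (inv_fin cs h0).subset (fun ε hε => hε.1)
    have hSn : S.Nonempty := ⟨ρ₀, ⟨hρ, hρ0, hρ1⟩, 0, 0, 1, le_rfl, le_rfl, one_pos, by simp⟩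
    obtain ⟨lam, ⟨⟨l1, l2, l3⟩, r, r', t, hr, hr', ht0, hρe⟩, hmin⟩ :=
      Set.exists_min_image S (fun ε => ht (rho cs h0 ε) / cf i j ε) hSf hSn
    obtain ⟨lc, lH⟩ := of_N hij hi hj l1 l2 l3
    have Ha : 0 < ht (rho cs h0 (al i)) := ht_pos hi ((IsRoot.al cs i).rho h0).ne
    have Hb : 0 < ht (rho cs h0 (al j)) := ht_pos hj ((IsRoot.al cs j).rho h0).ne
    have hcomb : ∀ u v w : ℝ, cf i j (u • al i + v • al j + w • lam) = w * cf i j lam := by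
      intro u v w
      rw [map_add, map_add, map_smul, map_smul, map_smul, cf_i, cf_j]; simp
    have hHc : ∀ u v w : ℝ, ht (rho cs h0 (u • al i + v • al j + w • lam)) =
        u * ht (rho cs h0 (al i)) + v * ht (rho cs h0 (al j)) + w * ht (rho cs h0 lam) := by
      intro u v w
      simp only [map_add, map_smul, smul_eq_mul]
    have hNc : ∀ u v w : ℝ, IsRoot cs (u • al i + v • al j + w • lam) → 0 < w →
        u * ht (rho cs h0 (al i)) + v * ht (rho cs h0 (al j)) + w * ht (rho cs h0 lam) < 0 →
        0 ≤ u • al i + v • al j + w • lam ∧ rho cs h0 (u • al i + v • al j + w • lam) ≤ 0 := by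
      intro u v w h1 h2 h3
      exact N_of (i := i) (j := j) h1 (by rw [hcomb]; positivity) (by rw [hHc]; exact h3)
    have Li : bf M lam (al i) = - (- bf M lam (al i)) := by ring
    have Lj : bf M lam (al j) = - (- bf M lam (al j)) := by ring
    generalize hp : - bf M lam (al i) = p at Li
    generalize hq : - bf M lam (al j) = q at Lj
    have iL : bf M (al i) lam = - p := by rw [bf_comm, Li]
    have jL : bf M (al j) lam = - q := by rw [bf_comm, Lj]
    have LL := l1.norm
    have hk4 := kap_mono (by norm_num) hm4
    have k4 := kap4
    have k40 := kap_nonneg (m := 4) (by norm_num)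
    have hκ2 : 1/2 ≤ kap m ^ 2 := by nlinarith
    have hκp : 0 < kap m := by nlinarith
    apply core3 (fun u v w => IsRoot cs (u • al i + v • al j + w • lam)) (kap m) p q (U (kap m) (k-1)) (U (kap m) k)
      (ht (rho cs h0 (al i))) (ht (rho cs h0 (al j))) (ht (rho cs h0 lam)) r r' t hκp
    · nlinarith [kap_sq_lt hm2]
    · exact hκ2
    · have := U_le (n := 1) (l := k-1) hm2 (by omega) (by omega)
      rwa [U_one] at this
    · have := U_le (n := 2) (l := k) hm2 (by omega) (by omega)
      have e : U (kap m) 2 = 2 * kap m := by simp [U]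
      rwa [e] at this
    · exact fun h h' => trig1 hm2 h hk hk2 h'
    · exact fun h h' => trig2 hm2 h hk hk2 h'
    · exact fun h h' => trig3 hm2 h h'
    · simpa using IsRoot.al cs i
    · simpa using IsRoot.al cs j
    · simpa using l1
    · intro u v w h
      have := h.refl (IsRoot.al cs i)
      simp only [map_add, map_smul, smul_eq_mul, haa, hab, iL] at this
      convert this using 1
      module
    · intro u v w h
      have := h.refl (IsRoot.al cs j)
      simp only [map_add, map_smul, smul_eq_mul, hbb, hba, jL] at this
      convert this using 1
      module
    · intro u v w h
      have := h.refl l1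
      simp only [map_add, map_smul, smul_eq_mul, Li, Lj, LL] at this
      convert this using 1
      module
    · intro u v w h
      convert h.neg using 1
      module
    · intro u v w h
      have := h.norm
      simp only [map_add, map_smul, LinearMap.add_apply, LinearMap.smul_apply, smul_eq_mul, haa, hab, hba, hbb, iL, jL, Li, Lj, LL] at this
      linarith
    · intro u v w h hw hu hv
      have h1 : u * ht (rho cs h0 (al i)) ≤ 0 := mul_nonpos_of_nonpos_of_nonneg hu Ha.le
      have h2 : v * ht (rho cs h0 (al j)) ≤ 0 := mul_nonpos_of_nonpos_of_nonneg hv Hb.le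
      have h3 : w * ht (rho cs h0 lam) < 0 := mul_neg_of_pos_of_neg hw lH
      have h4 := hNc u v w h hw (by linarith)
      have h5 : u • al i + v • al j + w • lam ∈ S := by
        refine ⟨⟨h, h4⟩, r + t / w * (-u), r' + t / w * (-v), t / w, ?_, ?_, by positivity, ?_⟩
        · have := mul_nonneg (div_pos ht0 hw).le (neg_nonneg.2 hu); linarith
        · have := mul_nonneg (div_pos ht0 hw).le (neg_nonneg.2 hv); linarith
        · rw [hρe]
          have e : t • lam = (t / w * w) • lam := by rw [div_mul_cancel₀ _ hw.ne']
          rw [e]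
          module
      have h6 := hmin _ h5
      simp only [hcomb, hHc] at h6
      rw [div_le_div_iff₀ lc (by positivity)] at h6
      have h7 : 0 ≤ u * ht (rho cs h0 (al i)) + v * ht (rho cs h0 (al j)) := by
        by_contra hc
        push Not at hc
        nlinarith
      have h8 : u * ht (rho cs h0 (al i)) = 0 := by linarith
      have h9 : v * ht (rho cs h0 (al j)) = 0 := by linarith
      exact ⟨(mul_eq_zero.1 h8).resolve_right Ha.ne', (mul_eq_zero.1 h9).resolve_right Hb.ne'⟩
    · intro u v h hu hv
      rcases h.pos_or with h1 | h1
      · have := h1 i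
        simp [al_apply_self, al_apply_ne hij] at this
        linarith
      · have := h1 j
        simp [al_apply_self, al_apply_ne hij.symm] at this
        linarith
    · exact Ha
    · exact Hb
    · exact lH
    · intro u v w h hw hH
      obtain ⟨h1, h2⟩ := hNc u v w h hw hH
      have := L2 _ h h1 h2
      simp only [map_add, map_smul, LinearMap.add_apply, LinearMap.smul_apply, smul_eq_mul, haa, hab, hba, hbb, Li, Lj] at this
      linarith
    · exact hr
    · exact hr'
    · exact ht0
    · show IsRoot cs _
      rw [← hρe]; exact hρ
    · have := (of_N hij hi hj hρ hρ0 hρ1).2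
      rw [hρe, hHc] at this
      exact this
    · rw [hρe] at hρ2
      simp only [map_add, map_smul, LinearMap.add_apply, LinearMap.smul_apply, smul_eq_mul, hab, hbb, Lj] at hρ2
      linarith

end bip
end Shi

namespace Shi
section order

theorem wl_trans (cs : CoxeterSystem M W) {p q r : W} (h1 : WeakLe cs p q) (h2 : WeakLe cs q r) : WeakLe cs p r := by
  unfold WeakLe at *
  have a := cs.length_mul_le (p⁻¹ * q) (q⁻¹ * r)
  have b := cs.length_mul_le p (p⁻¹ * r)
  rw [show p⁻¹ * q * (q⁻¹ * r) = p⁻¹ * r by group] at a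
  rw [show p * (p⁻¹ * r) = r by group] at b
  omega

theorem wl_refl (cs : CoxeterSystem M W) (p : W) : WeakLe cs p p := by
  simp [WeakLe]

theorem wl_antisymm (cs : CoxeterSystem M W) {p q : W} (h1 : WeakLe cs p q) (h2 : WeakLe cs q p) : p = q := by
  unfold WeakLe at *
  have : cs.length (p⁻¹ * q) = 0 := by omega
  rw [cs.length_eq_zero_iff] at this
  exact (inv_mul_eq_one.1 this)

theorem step_symm (cs : CoxeterSystem M W) {x y : W} (h : ShiStep cs x y) : ShiStep cs y x := by
  obtain ⟨i, rfl, h⟩ := h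
  refine ⟨i, by simp [mul_assoc], ?_⟩
  rwa [show x * cs.simple i * cs.simple i * (x * cs.simple i)⁻¹ = x * cs.simple i * x⁻¹ by simp [mul_assoc]]

theorem same_symm (cs : CoxeterSystem M W) {x y : W} (h : SameShiPart cs x y) : SameShiPart cs y x := by
  have : Std.Symm (ShiStep cs) := ⟨fun _ _ h => step_symm cs h⟩
  unfold SameShiPart at *
  exact Relation.ReflTransGen.symmetric.symm _ _ h

theorem m_eq (cs : CoxeterSystem M W) {m : W → W}
    (hm : ∀ g : W, SameShiPart cs g (m g) ∧ ∀ h : W, SameShiPart cs g h → WeakLe cs (m g) h)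
    {x y : W} (h : SameShiPart cs x y) : m x = m y := by
  apply wl_antisymm cs
  · exact (hm x).2 _ (Relation.ReflTransGen.trans h (hm y).1)
  · exact (hm y).2 _ (Relation.ReflTransGen.trans (same_symm cs h) (hm x).1)

variable [Fintype B] [DecidableEq B]

theorem no_sep (cs : CoxeterSystem M W) {r : W} (hr : IsElementary cs r) {x y : W} (h : SameShiPart cs x y)
    (hx : cs.length (r * x) < cs.length x) : cs.length (r * y) < cs.length y := by
  obtain ⟨z, l, rfl, hz⟩ := refl_pos cs hr.1
  have hroot : IsRoot cs (rho cs z (al l)) := ⟨z, l, rfl⟩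
  induction h with
  | refl => exact hx
  | tail h1 h2 ih =>
    rename_i u v
    obtain ⟨i, rfl, h3⟩ := h2
    rw [refl_len_iff cs hz] at ih ⊢
    rcases (hroot.rho (u * cs.simple i)⁻¹).pos_or with h4 | h4
    · exfalso
      rw [mul_inv_rev, cs.inv_simple, rho_mul] at h4
      have h5 := (hroot.rho u⁻¹).neg.simple_of_neg (neg_nonneg.2 ih) i (by rw [map_neg]; exact neg_nonpos.2 h4)
      have h6 : rho cs u (al i) = - rho cs z (al l) := by rw [← h5, map_neg, rho_mul_inv]
      rw [refl_eq cs (Or.inr h6)] at h3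
      exact h3 hr
    · exact h4

theorem nonel (cs : CoxeterSystem M W) {h0 z : W} {i j l : B} (hij : i ≠ j)
    (hi : 0 ≤ rho cs h0 (al i)) (hj : 0 ≤ rho cs h0 (al j)) {k : ℕ} (hk : 1 ≤ k) (hkm : k + 1 ≤ M i j)
    (hne : ¬ IsElementary cs (h0 * cs.simple j * h0⁻¹))
    (hz : rho cs z (al l) = rho cs h0 (U (kap (M i j)) k • al j + U (kap (M i j)) (k-1) • al i)) :
    ¬ IsElementary cs (z * cs.simple l * z⁻¹) := by
  rcases hk.eq_or_lt with rfl | hk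
  · simp only [Nat.sub_self, U_zero, U_one, one_smul, zero_smul, add_zero] at hz
    rwa [refl_eq cs (Or.inl hz)]
  · exact bip cs hij hi hj hk hkm hne hz

theorem path1 (cs : CoxeterSystem M W) {h0 : W} {f f' : B} (hij : f ≠ f')
    (hi : 0 ≤ rho cs h0 (al f)) (hj : 0 ≤ rho cs h0 (al f'))
    (hne : ¬ IsElementary cs (h0 * cs.simple f' * h0⁻¹)) (n : ℕ) (hn : n + 1 ≤ M f f') :
    SameShiPart cs h0 (h0 * P cs f' f n) := by
  induction n with
  | zero => rw [P_zero, mul_one]; exact Relation.ReflTransGen.refl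
  | succ n ih =>
    refine Relation.ReflTransGen.tail (ih (by omega)) ⟨lt f' f n, by rw [P_succ', mul_assoc], ?_⟩
    apply nonel cs hij hi hj (k := n+1) (by omega) (by omega) hne
    rw [rho_mul, P_root, M.symmetric f f']; rfl

theorem path2 (cs : CoxeterSystem M W) {h0 : W} {f f' : B} (hij : f ≠ f')
    (hi : 0 ≤ rho cs h0 (al f)) (hj : 0 ≤ rho cs h0 (al f'))
    (hne : ¬ IsElementary cs (h0 * cs.simple f' * h0⁻¹)) (n : ℕ) (hn : n + 1 ≤ M f f') :
    SameShiPart cs (h0 * cs.simple f) (h0 * P cs f f' (n+1)) := by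
  induction n with
  | zero => rw [P_succ, P_zero, mul_one]; exact Relation.ReflTransGen.refl
  | succ n ih =>
    refine Relation.ReflTransGen.tail (ih (by omega)) ⟨lt f f' (n+1), by rw [P_succ', mul_assoc], ?_⟩
    apply nonel cs hij hi hj (k := M f f' - (n+1)) (by omega) (by omega) hne
    have e1 : U (kap (M f f')) (M f f' - (n+1)) = U (kap (M f f')) (n+1) := U_refl (by omega) (by omega)
    have e2 : U (kap (M f f')) (M f f' - (n+1) - 1) = U (kap (M f f')) (n+1+1) := by
      rw [show M f f' - (n+1) - 1 = M f f' - (n+1+1) by omega]; exact U_refl (by omega) (by omega)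
    rw [rho_mul, P_root, e1, e2, add_comm]

theorem main_step (cs : CoxeterSystem M W) {m : W → W}
    (hm : ∀ g : W, SameShiPart cs g (m g) ∧ ∀ h : W, SameShiPart cs g h → WeakLe cs (m g) h) (N : ℕ) :
    ∀ (h : W) (s : B), cs.length h = N → cs.length (h * cs.simple s) + 1 = cs.length h →
      WeakLe cs (m (h * cs.simple s)) (m h) := by
  induction N using Nat.strong_induction_on with
  | _ N ih =>
  intro h s hN hs
  obtain ⟨g, hg⟩ : ∃ g, g = h * cs.simple s := ⟨_, rfl⟩
  rw [← hg] at hs ⊢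
  by_cases hel : IsElementary cs (h * cs.simple s * h⁻¹)
  swap
  · rw [m_eq cs hm (Relation.ReflTransGen.single (show ShiStep cs h g from ⟨s, hg, hel⟩))]
    exact wl_refl cs _
  by_cases hmh : m h = h
  · rw [hmh]
    apply wl_trans cs ((hm g).2 g Relation.ReflTransGen.refl)
    unfold WeakLe
    rw [hg, mul_inv_rev, mul_assoc, inv_mul_cancel, mul_one, cs.length_inv, cs.length_simple, ← hg, hs]
  obtain ⟨k, hk⟩ : ∃ k, k = m h := ⟨_, rfl⟩
  have hkh : WeakLe cs k h := hk ▸ (hm h).2 h Relation.ReflTransGen.refl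
  have hpart : SameShiPart cs h k := hk ▸ (hm h).1
  have hne1 : k⁻¹ * h ≠ 1 := fun hc => hmh (hk ▸ (inv_mul_eq_one.1 hc))
  obtain ⟨t, ht⟩ := cs.exists_rightDescent_of_ne_one hne1
  rw [cs.isRightDescent_iff] at ht
  unfold WeakLe at hkh
  have htd : cs.length (h * cs.simple t) + 1 = cs.length h := by
    have a := cs.length_mul_le k (k⁻¹ * h * cs.simple t)
    rw [show k * (k⁻¹ * h * cs.simple t) = h * cs.simple t by group] at a
    have b := cs.length_mul_le (h * cs.simple t) (cs.simple t)
    rw [ss, cs.length_simple] at b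
    omega
  have hnt : ¬ IsElementary cs (h * cs.simple t * h⁻¹) := by
    intro hc
    have a := no_sep cs hc hpart (by rw [inv_mul_cancel_right]; omega)
    have b := cs.length_mul_le (h * cs.simple t * h⁻¹ * k) (k⁻¹ * h * cs.simple t)
    rw [show h * cs.simple t * h⁻¹ * k * (k⁻¹ * h * cs.simple t) = h * cs.simple t * cs.simple t by group, ss] at b
    omega
  have hts : t ≠ s := by rintro rfl; exact hnt hel
  obtain ⟨h0, n, f, f', hff, hn1, hw, hl, hlt, ha1, ha2⟩ := strip cs N h t s hN hts htd
  have hne : f ≠ f' := by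
    rcases hff with ⟨rfl, rfl⟩ | ⟨rfl, rfl⟩
    · exact hts
    · exact hts.symm
  have hf : cs.length (h0 * cs.simple f) = cs.length h0 + 1 := by
    rcases hff with ⟨rfl, rfl⟩ | ⟨rfl, rfl⟩ <;> assumption
  have hf' : cs.length (h0 * cs.simple f') = cs.length h0 + 1 := by
    rcases hff with ⟨rfl, rfl⟩ | ⟨rfl, rfl⟩ <;> assumption
  have pf := pos_of_asc cs hf
  have pf' := pos_of_asc cs hf'
  have hneg := neg_of_desc cs (hg ▸ hs)
  have hM : ¬ (M f f' ≠ 0 → n + 1 ≤ M f f') := by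
    intro hc
    have := dih_pos cs hne h0 n pf pf' hc
    rw [hlt, ← hw] at this
    exact ((IsRoot.al cs s).rho h).not_both this hneg
  push Not at hM
  obtain ⟨hM0, hM1⟩ := hM
  have hM2 := len_bound cs hM0 (h0 := h0) (k := n) (by rw [← hw, hl])
  have hnM : n = M f f' := le_antisymm hM2 (by omega)
  have hn2 : 2 ≤ n := by
    have := M.off_diagonal f f' hne
    change M f f' ≠ 1 at this
    omega
  obtain ⟨n', rfl⟩ : ∃ n', n = n' + 1 := ⟨n - 1, by omega⟩
  have hls : lt f' f n' = s := by rw [lt_swap, hlt]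
  have hlt2 : lt f f' n' = t := by
    rcases lt_mem f f' n' with ⟨a, b⟩ | ⟨a, b⟩ <;> rcases hff with ⟨c, d⟩ | ⟨c, d⟩
    · rw [a, c]
    · exact absurd (by rw [← hls, b, d]) hts
    · exact absurd (by rw [← hls, b, c]) hts
    · rw [a, d]
  have hgp : g = h0 * P cs f' f n' := by
    rw [hg, hw, hnM, braid, ← hnM, P_succ', hls, ← mul_assoc, ss]
  have hr : h * cs.simple t * h⁻¹ = h0 * cs.simple f' * h0⁻¹ := by
    have e : h = h0 * P cs f f' n' * cs.simple t := by rw [hw, P_succ', hlt2, mul_assoc]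
    have e2 : h * cs.simple t * h⁻¹ = (h0 * P cs f f' n') * cs.simple t * (h0 * P cs f f' n')⁻¹ := by
      rw [e]; simp [mul_assoc]
    rw [e2]
    apply refl_eq cs (Or.inl _)
    have hu1 : U (kap (M f f')) (n'+1) = 0 := by rw [hnM]; exact U_m (by omega)
    have hu2 : U (kap (M f f')) n' = 1 := by
      have := U_m1 (m := M f f') (by omega)
      rwa [← hnM] at this ⊢
    have := P_root cs f f' n'
    rw [hlt2] at this
    rw [rho_mul, this]
    change rho cs h0 (U (kap (M f f')) (n'+1) • al f + U (kap (M f f')) n' • al f') = _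
    rw [hu1, hu2]; simp
  rw [hr] at hnt
  have s1 := path1 cs hne pf pf' hnt n' (by omega)
  have s2 := path2 cs hne pf pf' hnt n' (by omega)
  rw [← hgp] at s1
  rw [← hw] at s2
  rw [← m_eq cs hm s1, ← m_eq cs hm s2]
  have := ih (cs.length (h0 * cs.simple f)) (by omega) (h0 * cs.simple f) f rfl (by rw [ss]; omega)
  rwa [ss] at this

theorem main_all (cs : CoxeterSystem M W) {m : W → W}
    (hm : ∀ g : W, SameShiPart cs g (m g) ∧ ∀ h : W, SameShiPart cs g h → WeakLe cs (m g) h) (N : ℕ) :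
    ∀ g h : W, cs.length (g⁻¹ * h) = N → WeakLe cs g h → WeakLe cs (m g) (m h) := by
  induction N with
  | zero =>
    intro g h hN _
    rw [cs.length_eq_zero_iff] at hN
    rw [inv_mul_eq_one.1 hN]
    exact wl_refl cs _
  | succ N ih =>
    intro g h hN hgh
    have hne1 : g⁻¹ * h ≠ 1 := by intro hc; rw [hc] at hN; simp at hN
    obtain ⟨t, ht⟩ := cs.exists_rightDescent_of_ne_one hne1
    rw [cs.isRightDescent_iff] at ht
    unfold WeakLe at hgh
    have a := cs.length_mul_le g (g⁻¹ * h * cs.simple t)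
    rw [show g * (g⁻¹ * h * cs.simple t) = h * cs.simple t by group] at a
    have b := cs.length_mul_le (h * cs.simple t) (cs.simple t)
    rw [ss, cs.length_simple] at b
    refine wl_trans cs (ih g (h * cs.simple t) (by rw [← mul_assoc]; omega) ?_) (main_step cs hm _ h t rfl (by omega))
    unfold WeakLe
    rw [← mul_assoc]; omega

end order
end Shi

/-- For all `g, h ∈ W` with `g ⪯ h`, we have `m(g) ⪯ m(h)`. -/
theorem m_monotone [Finite B] (cs : CoxeterSystem M W) (m : W → W)
    (hm : ∀ g : W, SameShiPart cs g (m g) ∧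
      ∀ h : W, SameShiPart cs g h → WeakLe cs (m g) h)
    (g h : W) (hgh : WeakLe cs g h) :
    WeakLe cs (m g) (m h) := by
  classical
  have := Fintype.ofFinite B
  exact Shi.main_all cs hm _ g h rfl hgh
end

section
/- For any g, g' ∈ M, if the join of g and g' with respect to the weak order exists, then it belongs to M. -/
/-!
Let `(W,S)` be a Coxeter system, given by a Coxeter matrix `M : CoxeterMatrix B`
and `cs : CoxeterSystem M W`; the set `S` of simple reflections is the range of
`cs.simple`, and `S` is finite since `B` is finite.
-/

variable {B W : Type*} [Group W] {M : CoxeterMatrix B}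

/-- `j` is the join of `g` and `g'` with respect to the weak order. -/
def IsJoin (cs : CoxeterSystem M W) (g g' j : W) : Prop :=
  WeakLe cs g j ∧ WeakLe cs g' j ∧
    ∀ f : W, WeakLe cs g f → WeakLe cs g' f → WeakLe cs j f

namespace ShiJoin

set_option linter.unusedSectionVars false

section Geo

open Module

/-- matrix coefficients of the canonical form -/
noncomputable def cf (M : CoxeterMatrix B) (i j : B) : ℝ := -Real.cos (Real.pi / (M i j : ℝ))

lemma cf_symm (M : CoxeterMatrix B) (i j : B) : cf M i j = cf M j i := by
  unfold cf; rw [M.symmetric]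

lemma cf_self (M : CoxeterMatrix B) (i : B) : cf M i i = 1 := by
  unfold cf; simp

variable [Fintype B] [DecidableEq B]

/-- canonical bilinear form -/
noncomputable def bf (M : CoxeterMatrix B) : (B → ℝ) →ₗ[ℝ] (B → ℝ) →ₗ[ℝ] ℝ :=
  Matrix.toBilin' (Matrix.of (cf M))

/-- simple root -/
noncomputable def al (i : B) : B → ℝ := Pi.single i 1

lemma bf_al (M : CoxeterMatrix B) (i j : B) : bf M (al i) (al j) = cf M i j := by
  unfold bf al
  exact Matrix.toBilin'_single _ _ _

lemma bf_al_self (M : CoxeterMatrix B) (i : B) : bf M (al i) (al i) = 1 := by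
  rw [bf_al, cf_self]

lemma bf_symm (M : CoxeterMatrix B) (x y : B → ℝ) : bf M x y = bf M y x := by
  unfold bf
  simp only [Matrix.toBilin'_apply, Matrix.of_apply]
  rw [Finset.sum_comm]
  refine Finset.sum_congr rfl fun i _ => Finset.sum_congr rfl fun j _ => ?_
  rw [cf_symm]; ring

lemma vec_eq_sum (v : B → ℝ) : v = ∑ i, v i • (al i : B → ℝ) := by
  unfold al
  ext j; simp [Finset.sum_apply, Pi.single_apply]

/-- the functional `2 B(α_i, ·)` -/
noncomputable def fn (M : CoxeterMatrix B) (i : B) : Dual ℝ (B → ℝ) := (2:ℝ) • bf M (al i)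

lemma fn_al (M : CoxeterMatrix B) (i j : B) : fn M i (al j) = 2 * cf M i j := by
  simp [fn, bf_al]

lemma fn_self (M : CoxeterMatrix B) (i : B) : fn M i (al i) = 2 := by
  rw [fn_al, cf_self]; norm_num

/-- simple reflection -/
noncomputable def sg (M : CoxeterMatrix B) (i : B) : (B → ℝ) ≃ₗ[ℝ] (B → ℝ) :=
  Module.reflection (fn_self M i)

lemma sg_apply (M : CoxeterMatrix B) (i : B) (v : B → ℝ) :
    sg M i v = v - (2 * bf M (al i) v) • al i := by
  simp [sg, Module.reflection_apply, fn]

lemma sg_rel (M : CoxeterMatrix B) : M.IsLiftable (sg M) := by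
  intro i j
  by_cases hij : i = j
  · subst hij
    ext1 v
    simp only [M.diagonal, pow_one, LinearEquiv.mul_apply]
    exact Module.involutive_reflection (fn_self M i) v
  by_cases h0 : M i j = 0
  · simp [h0]
  have h1 : M i j ≠ 1 := M.off_diagonal i j hij
  by_cases h2 : M i j = 2
  · have hc : cf M i j = 0 := by
      simp [cf, h2]
    have hc' : cf M j i = 0 := by rw [cf_symm, hc]
    rw [h2]
    ext1 v
    simp only [pow_two, LinearEquiv.mul_apply, sg_apply, map_sub, map_smul, bf_al, hc, hc', cf_self,
      LinearEquiv.coe_one, id]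
    module
  have hm : 3 ≤ M i j := by omega
  set m := M i j with hmdef
  set w : ℝ := Real.pi / m with hw
  have hmR : (3:ℝ) ≤ m := by exact_mod_cast hm
  have hmw : (m:ℝ) * w = Real.pi := by rw [hw]; field_simp
  have hpi := Real.pi_pos
  have hw0 : 0 < w := by positivity
  have hs : Real.sin (2 * w) ≠ 0 := by
    apply ne_of_gt
    apply Real.sin_pos_of_pos_of_lt_pi <;> nlinarith
  have ht : 2 * Real.cos (2 * w) = fn M i (al j) * fn M j (al i) - 2 := by
    rw [fn_al, fn_al, cf_symm M j i]
    have : cf M i j = - Real.cos w := rfl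
    rw [this, Real.cos_two_mul]; ring
  have hS : ∀ n : ℤ, (Polynomial.Chebyshev.S ℝ n).eval (2 * Real.cos (2*w)) =
      Real.sin ((n+1) * (2*w)) / Real.sin (2*w) := by
    intro n
    rw [eq_div_iff hs]
    exact Polynomial.Chebyshev.S_two_mul_real_cos _ _
  ext1 v
  have key := Module.reflection_mul_reflection_pow_apply (fn_self M i) (fn_self M j) m v
    (2 * Real.cos (2*w)) ht
  rcases Nat.even_or_odd' m with ⟨k, hk | hk⟩
  · have hkR : (m:ℝ) = 2 * k := by exact_mod_cast hk
    have e1 : ((m:ℤ) - 2) / 2 = k - 1 := by omega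
    have e2 : ((m:ℤ) - 1) / 2 = k - 1 := by omega
    have z : (Polynomial.Chebyshev.S ℝ ((k:ℤ)-1)).eval (2 * Real.cos (2*w)) = 0 := by
      rw [hS]
      have : (((k:ℤ) - 1 : ℤ) + 1 : ℝ) * (2 * w) = Real.pi := by
        push_cast; rw [← hmw, hkR]; ring
      rw [this]; simp
    rw [e1, e2, z] at key
    simpa [sg] using key
  · have hkR : (m:ℝ) = 2 * k + 1 := by exact_mod_cast hk
    have e1 : ((m:ℤ) - 2) / 2 = k - 1 := by omega
    have e2 : ((m:ℤ) - 1) / 2 = k := by omega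
    have e3 : ((m:ℤ) - 3) / 2 = k - 1 := by omega
    have e4 : (m:ℤ) / 2 = k := by omega
    have z : (Polynomial.Chebyshev.S ℝ (k:ℤ)).eval (2 * Real.cos (2*w)) +
        (Polynomial.Chebyshev.S ℝ ((k:ℤ)-1)).eval (2 * Real.cos (2*w)) = 0 := by
      rw [hS, hS]
      have a1 : (((k:ℤ) - 1 : ℤ) + 1 : ℝ) * (2 * w) = Real.pi - w := by
        push_cast; rw [← hmw, hkR]; ring
      have a2 : (((k:ℤ) : ℝ) + 1 : ℝ) * (2 * w) = w + Real.pi := by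
        push_cast; rw [← hmw, hkR]; ring
      rw [a1, a2, Real.sin_pi_sub, Real.sin_add_pi]; ring
    rw [e1, e2, e3, e4, z] at key
    simpa [sg] using key

/-- geometric representation -/
noncomputable def rh (cs : CoxeterSystem M W) : W →* ((B → ℝ) ≃ₗ[ℝ] (B → ℝ)) :=
  cs.lift ⟨sg M, sg_rel M⟩

variable (cs : CoxeterSystem M W)

lemma rh_simple (i : B) (v : B → ℝ) : rh cs (cs.simple i) v = v - (2 * bf M (al i) v) • al i := by
  unfold rh; rw [cs.lift_apply_simple (sg_rel M)]; exact sg_apply M i v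

lemma rh_mul (g h : W) (v : B → ℝ) : rh cs (g * h) v = rh cs g (rh cs h v) := by
  rw [map_mul]; rfl

lemma rh_one (v : B → ℝ) : rh cs 1 v = v := by
  rw [map_one]; rfl

lemma rh_inv_apply (g : W) (v : B → ℝ) : rh cs g⁻¹ (rh cs g v) = v := by
  rw [← rh_mul]; simp

lemma rh_apply_inv (g : W) (v : B → ℝ) : rh cs g (rh cs g⁻¹ v) = v := by
  rw [← rh_mul]; simp

lemma bf_rh (g : W) (x y : B → ℝ) : bf M (rh cs g x) (rh cs g y) = bf M x y := by
  induction g using cs.simple_induction_left generalizing x y with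
  | one => simp only [rh_one]
  | mul_simple_left g i ih =>
    rw [rh_mul, rh_mul, rh_simple, rh_simple, ← ih x y]
    simp only [map_sub, map_smul, LinearMap.sub_apply, LinearMap.smul_apply, smul_eq_mul, bf_al_self,
      bf_symm M _ (al i)]
    ring

lemma bf_rh_left (g : W) (x y : B → ℝ) : bf M (rh cs g x) y = bf M x (rh cs g⁻¹ y) := by
  rw [← bf_rh cs g⁻¹, rh_inv_apply]

end Geo

end ShiJoin
namespace ShiJoin

set_option linter.unusedSectionVars false
section Pos
variable [Fintype B] [DecidableEq B] (cs : CoxeterSystem M W)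

lemma strip (n : ℕ) : ∀ (w : W), cs.length w = n → ∀ i j : B, ¬ cs.IsRightDescent w i →
    ∃ (v : W) (k : ℕ), w = v * cs.wordProd (CoxeterSystem.alternatingWord i j k) ∧
      cs.length w = cs.length v + k ∧ ¬ cs.IsRightDescent v i ∧ ¬ cs.IsRightDescent v j := by
  induction n with
  | zero =>
    intro w hw i j _
    have : w = 1 := cs.length_eq_zero_iff.1 hw
    subst this
    exact ⟨1, 0, by simp [CoxeterSystem.alternatingWord], by simp, cs.not_isRightDescent_one i,
      cs.not_isRightDescent_one j⟩
  | succ n ih =>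
    intro w hw i j hi
    by_cases hj : cs.IsRightDescent w j
    · have h1 := cs.isRightDescent_iff.1 hj
      have h2 := cs.isRightDescent_iff_not_isRightDescent_mul.1 hj
      obtain ⟨v, k, e, el, a, b⟩ := ih (w * cs.simple j) (by omega) j i h2
      refine ⟨v, k+1, ?_, by omega, b, a⟩
      rw [CoxeterSystem.alternatingWord_succ, cs.wordProd_concat, ← mul_assoc, ← e]
      simp
    · exact ⟨w, 0, by simp [CoxeterSystem.alternatingWord], by simp, hi, hj⟩

/-- Chebyshev-like sequence -/
noncomputable def Us (c : ℝ) : ℕ → ℝ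
  | 0 => 0
  | 1 => 1
  | (k+2) => 2 * c * Us c (k+1) - Us c k

lemma Us_one (k : ℕ) : Us 1 k = k := by
  induction k using Nat.twoStepInduction with
  | zero => simp [Us]
  | one => simp [Us]
  | more k h1 h2 => rw [Us, h1, h2]; push_cast; ring

lemma Us_cos (t : ℝ) (k : ℕ) : Us (Real.cos t) k * Real.sin t = Real.sin (k * t) := by
  induction k using Nat.twoStepInduction with
  | zero => simp [Us]
  | one => simp [Us]
  | more k h1 h2 =>
    rw [Us, sub_mul, mul_assoc, h1, h2]
    push_cast
    have e1 : ((k:ℝ)+2) * t = (k+1)*t + t := by ring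
    have e2 : (k:ℝ) * t = (k+1)*t - t := by ring
    rw [e1, e2, Real.sin_add, Real.sin_sub]; ring

lemma Us_nonneg (m k : ℕ) (hm : m = 0 ∨ (2 ≤ m ∧ k ≤ m)) : 0 ≤ Us (Real.cos (Real.pi / m)) k := by
  rcases hm with h | ⟨h, hk⟩
  · subst h; simp [Us_one]
  · have hpi := Real.pi_pos
    have hmR : (2:ℝ) ≤ m := by exact_mod_cast h
    have hkR : (k:ℝ) ≤ m := by exact_mod_cast hk
    have hmw : (m:ℝ) * (Real.pi / m) = Real.pi := by field_simp
    have h0 : 0 < Real.pi / m := by positivity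
    have hs : 0 < Real.sin (Real.pi / m) := by
      apply Real.sin_pos_of_pos_of_lt_pi h0; nlinarith
    have h2 : 0 ≤ Real.sin (k * (Real.pi / m)) := by
      apply Real.sin_nonneg_of_nonneg_of_le_pi (by positivity); nlinarith
    rw [← Us_cos] at h2
    exact nonneg_of_mul_nonneg_left h2 hs

lemma alt_al (k : ℕ) : ∀ i j : B, rh cs (cs.wordProd (CoxeterSystem.alternatingWord i j k)) (al i) =
    if Even k then Us (-cf M i j) (k+1) • al i + Us (-cf M i j) k • al j
    else Us (-cf M i j) k • al i + Us (-cf M i j) (k+1) • al j := by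
  induction k using Nat.twoStepInduction with
  | zero => intro i j; simp [CoxeterSystem.alternatingWord, Us]
  | one =>
    intro i j
    simp only [CoxeterSystem.alternatingWord, List.concat_nil, cs.wordProd_singleton, rh_simple,
      bf_al, Us, cf_symm M j i]
    simp only [Nat.not_even_one, if_false]
    module
  | more k h1 h2 =>
    intro i j
    rw [CoxeterSystem.alternatingWord_succ, cs.wordProd_concat, rh_mul, rh_simple, map_sub, map_smul,
      bf_al]
    rw [h2 j i, CoxeterSystem.alternatingWord_succ, cs.wordProd_concat, rh_mul, rh_simple, bf_al_self]
    have : (al i - (2 * 1 : ℝ) • al i : B → ℝ) = - al i := by module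
    rw [this, map_neg, h1 i j, cf_symm M j i]
    by_cases he : Even k
    · have e1 : ¬ Even (k+1) := by simpa [Nat.even_add_one] using he
      have e2 : Even (k+1+1) := by simp [he]
      rw [if_pos he, if_neg e1, if_pos e2]
      simp only [Us]
      module
    · have e1 : Even (k+1) := by simpa [Nat.even_add_one] using he
      have e2 : ¬ Even (k+1+1) := by simp [Nat.even_add_one] at he ⊢; simpa using he
      rw [if_neg he, if_pos e1, if_neg e2]
      simp only [Us]
      module

lemma alt_split (i j : B) (m a : ℕ) : ∃ x : W, cs.length x ≤ a ∧
    cs.wordProd (CoxeterSystem.alternatingWord i j (a+m)) =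
      x * cs.wordProd (CoxeterSystem.alternatingWord i j m) := by
  induction a with
  | zero => exact ⟨1, by simp, by simp⟩
  | succ a ih =>
    obtain ⟨x, hx, e⟩ := ih
    have : a + 1 + m = (a + m) + 1 := by omega
    rw [this, CoxeterSystem.alternatingWord_succ', cs.wordProd_cons, e, ← mul_assoc]
    refine ⟨_, ?_, rfl⟩
    refine (cs.length_mul_le _ _).trans ?_
    rw [cs.length_simple]; omega

lemma alt_bound (w v : W) (i j : B) (k : ℕ) (hm : M i j ≠ 0) (hk : M i j ≤ k)
    (e : w = v * cs.wordProd (CoxeterSystem.alternatingWord i j k))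
    (el : cs.length w = cs.length v + k) : cs.IsRightDescent w i := by
  obtain ⟨a, rfl⟩ := Nat.exists_eq_add_of_le hk
  rw [add_comm] at e
  obtain ⟨x, hx, ex⟩ := alt_split cs i j (M i j) a
  have hb := cs.wordProd_braidWord_eq i j
  unfold CoxeterSystem.braidWord at hb
  rw [ex, hb, M.symmetric j i] at e
  obtain ⟨m, hm'⟩ := Nat.exists_eq_succ_of_ne_zero hm
  rw [hm', Nat.succ_eq_add_one, CoxeterSystem.alternatingWord_succ, cs.wordProd_concat] at e
  unfold CoxeterSystem.IsRightDescent
  have h1 : w * cs.simple i = v * (x * cs.wordProd (CoxeterSystem.alternatingWord i j m)) := by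
    rw [e]; simp [mul_assoc]
  have h2 := cs.length_mul_le v (x * cs.wordProd (CoxeterSystem.alternatingWord i j m))
  have h3 := cs.length_mul_le x (cs.wordProd (CoxeterSystem.alternatingWord i j m))
  have h4 := cs.length_wordProd_le (CoxeterSystem.alternatingWord i j m)
  rw [CoxeterSystem.length_alternatingWord] at h4
  rw [h1]; omega

lemma al_nonneg (i : B) : (0 : B → ℝ) ≤ al i := by
  unfold al; exact Pi.single_nonneg.2 zero_le_one

theorem pos_of_not_descent (n : ℕ) : ∀ (w : W), cs.length w = n → ∀ i, ¬ cs.IsRightDescent w i →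
    0 ≤ rh cs w (al i) := by
  induction n using Nat.strong_induction_on with
  | _ n ih =>
  intro w hw i hi
  by_cases h1 : w = 1
  · subst h1; rw [rh_one]; exact al_nonneg i
  obtain ⟨j, hj⟩ := cs.exists_rightDescent_of_ne_one h1
  have hij : i ≠ j := by rintro rfl; exact hi hj
  obtain ⟨v, k, e, el, a, b⟩ := strip cs n w hw i j hi
  have hk : k ≠ 0 := by
    rintro rfl
    apply b
    have : w = v := by simpa [CoxeterSystem.alternatingWord] using e
    rwa [← this]
  have pi' := ih (cs.length v) (by omega) v rfl i a
  have pj' := ih (cs.length v) (by omega) v rfl j b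
  have hM : M i j = 0 ∨ (2 ≤ M i j ∧ k + 1 ≤ M i j) := by
    by_cases h0 : M i j = 0
    · exact Or.inl h0
    · right
      have := M.off_diagonal i j hij
      refine ⟨by omega, ?_⟩
      by_contra hc
      exact hi (alt_bound cs w v i j k h0 (by omega) e el)
  have u1 := Us_nonneg (M i j) (k+1) hM
  have u2 := Us_nonneg (M i j) k (hM.imp id (fun h => ⟨h.1, by omega⟩))
  have hc : Real.cos (Real.pi / M i j) = - cf M i j := by unfold cf; ring
  rw [hc] at u1 u2
  rw [e, rh_mul, alt_al]
  split_ifs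
  · rw [map_add, map_smul, map_smul]
    exact add_nonneg (smul_nonneg u1 pi') (smul_nonneg u2 pj')
  · rw [map_add, map_smul, map_smul]
    exact add_nonneg (smul_nonneg u2 pi') (smul_nonneg u1 pj')

lemma nonneg_of_nd {w : W} {i : B} (h : ¬ cs.IsRightDescent w i) : 0 ≤ rh cs w (al i) :=
  pos_of_not_descent cs _ w rfl i h

lemma rh_simple_self (i : B) : rh cs (cs.simple i) (al i) = - al i := by
  rw [rh_simple, bf_al_self]; module

lemma nonpos_of_d {w : W} {i : B} (h : cs.IsRightDescent w i) : rh cs w (al i) ≤ 0 := by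
  have h2 := nonneg_of_nd cs (cs.isRightDescent_iff_not_isRightDescent_mul.1 h)
  rw [rh_mul, rh_simple_self, map_neg] at h2
  exact neg_nonneg.1 h2

lemma al_ne_zero (i : B) : (al i : B → ℝ) ≠ 0 := by
  unfold al; simp

end Pos
end ShiJoin
namespace ShiJoin

set_option linter.unusedSectionVars false

section Roots
variable [Fintype B] [DecidableEq B] (cs : CoxeterSystem M W)

/-- roots -/
def IsRt (v : B → ℝ) : Prop := ∃ (w : W) (i : B), v = rh cs w (al i)

variable {cs}

lemma IsRt.al (i : B) : IsRt cs (al i) := ⟨1, i, by rw [rh_one]⟩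

lemma IsRt.act {v : B → ℝ} (h : IsRt cs v) (g : W) : IsRt cs (rh cs g v) := by
  obtain ⟨w, i, rfl⟩ := h
  exact ⟨g * w, i, by rw [rh_mul]⟩

lemma IsRt.neg {v : B → ℝ} (h : IsRt cs v) : IsRt cs (-v) := by
  obtain ⟨w, i, rfl⟩ := h
  exact ⟨w * cs.simple i, i, by rw [rh_mul, rh_simple_self, map_neg]⟩

lemma IsRt.norm {v : B → ℝ} (h : IsRt cs v) : bf M v v = 1 := by
  obtain ⟨w, i, rfl⟩ := h
  rw [bf_rh, bf_al_self]

lemma IsRt.ne_zero {v : B → ℝ} (h : IsRt cs v) : v ≠ 0 := by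
  rintro rfl
  have := h.norm
  simp at this

lemma IsRt.sign {v : B → ℝ} (h : IsRt cs v) : 0 ≤ v ∨ v ≤ 0 := by
  obtain ⟨w, i, rfl⟩ := h
  by_cases hd : cs.IsRightDescent w i
  · exact Or.inr (nonpos_of_d cs hd)
  · exact Or.inl (nonneg_of_nd cs hd)

lemma IsRt.absurd {v : B → ℝ} (h : IsRt cs v) (h1 : 0 ≤ v) (h2 : v ≤ 0) : False :=
  h.ne_zero (le_antisymm h2 h1)

variable (cs)

lemma descent_iff (w : W) (i : B) : cs.IsRightDescent w i ↔ rh cs w (al i) ≤ 0 := by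
  constructor
  · exact nonpos_of_d cs
  · intro h
    by_contra hd
    exact ((IsRt.al i).act w).absurd (nonneg_of_nd cs hd) h

lemma eq_one_of_rh (w : W) (h : ∀ i, 0 ≤ rh cs w (al i)) : w = 1 := by
  by_contra h1
  obtain ⟨i, hi⟩ := cs.exists_rightDescent_of_ne_one h1
  exact ((IsRt.al i).act w).absurd (h i) (nonpos_of_d cs hi)

lemma rh_inj {g h : W} (e : ∀ v, rh cs g v = rh cs h v) : g = h := by
  have : h⁻¹ * g = 1 := by
    apply eq_one_of_rh cs
    intro i
    rw [rh_mul, e, rh_inv_apply]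
    exact al_nonneg i
  exact (inv_mul_eq_one.1 this).symm

lemma rh_conj (w : W) (i : B) (x : B → ℝ) : rh cs (w * cs.simple i * w⁻¹) x =
    x - (2 * bf M (rh cs w (al i)) x) • rh cs w (al i) := by
  rw [rh_mul, rh_mul, rh_simple, map_sub, map_smul, rh_apply_inv, bf_rh_left]

open Classical in
/-- reflection attached to a root -/
noncomputable def rf (v : B → ℝ) : W :=
  if h : IsRt cs v then h.choose * cs.simple h.choose_spec.choose * h.choose⁻¹ else 1

variable {cs}

lemma rh_rf {v : B → ℝ} (h : IsRt cs v) (x : B → ℝ) :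
    rh cs (rf cs v) x = x - (2 * bf M v x) • v := by
  unfold rf
  rw [dif_pos h, rh_conj, ← h.choose_spec.choose_spec]

lemma rf_eq {v : B → ℝ} (h : IsRt cs v) {t : W}
    (ht : ∀ x, rh cs t x = x - (2 * bf M v x) • v) : rf cs v = t := by
  apply rh_inj cs
  intro x
  rw [rh_rf h, ht]

variable (cs) in
lemma rf_conj (w : W) (i : B) : rf cs (rh cs w (al i)) = w * cs.simple i * w⁻¹ :=
  rf_eq ((IsRt.al i).act w) (rh_conj cs w i)

variable (cs) in
lemma rf_al (i : B) : rf cs (al i) = cs.simple i := by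
  have := rf_conj cs 1 i
  simpa [rh_one] using this

lemma rf_act {v : B → ℝ} (h : IsRt cs v) (g : W) : rf cs (rh cs g v) = g * rf cs v * g⁻¹ := by
  apply rf_eq (h.act g)
  intro x
  rw [rh_mul, rh_mul, rh_rf h, map_sub, map_smul, rh_apply_inv, bf_rh_left]

lemma rf_neg {v : B → ℝ} (h : IsRt cs v) : rf cs (-v) = rf cs v := by
  apply rf_eq h.neg
  intro x
  rw [rh_rf h]; simp

lemma rf_isRefl {v : B → ℝ} (h : IsRt cs v) : cs.IsReflection (rf cs v) := by
  obtain ⟨w, i, rfl⟩ := h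
  exact ⟨w, i, rf_conj cs w i⟩

lemma rf_mul_self {v : B → ℝ} (h : IsRt cs v) : rf cs v * rf cs v = 1 := by
  obtain ⟨w, i, rfl⟩ := h
  rw [rf_conj]; simp [mul_assoc]

lemma rf_inv {v : B → ℝ} (h : IsRt cs v) : (rf cs v)⁻¹ = rf cs v :=
  inv_eq_of_mul_eq_one_left (rf_mul_self h)

lemma rh_rf_self {v : B → ℝ} (h : IsRt cs v) : rh cs (rf cs v) v = - v := by
  rw [rh_rf h, h.norm]; module

lemma exists_rf {t : W} (h : cs.IsReflection t) : ∃ v, IsRt cs v ∧ 0 ≤ v ∧ t = rf cs v := by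
  obtain ⟨w, i, rfl⟩ := h
  have hr : IsRt cs (rh cs w (al i)) := ⟨w, i, rfl⟩
  rcases hr.sign with h | h
  · exact ⟨_, hr, h, (rf_conj cs w i).symm⟩
  · exact ⟨_, hr.neg, neg_nonneg.2 h, by rw [rf_neg hr]; exact (rf_conj cs w i).symm⟩

lemma IsRt.s_root {v w : B → ℝ} (hv : IsRt cs v) (hw : IsRt cs w) :
    IsRt cs (w - (2 * bf M v w) • v) := by
  rw [← rh_rf hv]; exact hw.act _

lemma rf_inj {v w : B → ℝ} (hv : IsRt cs v) (hw : IsRt cs w) (h : rf cs v = rf cs w) :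
    v = w ∨ v = -w := by
  have e := rh_rf hv v
  rw [h, rh_rf hw, hv.norm] at e
  set c := bf M w v
  have e2 : v = c • w := by
    have : (2:ℝ) • v = (2:ℝ) • (c • w) := by
      have := congrArg (fun z => v - z) e
      simp only [sub_sub_cancel] at this
      rw [← smul_assoc, smul_eq_mul, this]; module
    exact smul_right_injective _ (two_ne_zero) this
  have n := hv.norm
  rw [e2] at n
  simp only [map_smul, LinearMap.smul_apply, hw.norm, smul_eq_mul] at n
  have : (c-1)*(c+1) = 0 := by linarith
  rcases mul_eq_zero.1 this with h | h
  · left; rw [e2, sub_eq_zero.1 h, one_smul]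
  · right; rw [e2, eq_neg_of_add_eq_zero_left h]; module

lemma rf_inj_pos {v w : B → ℝ} (hv : IsRt cs v) (hw : IsRt cs w) (pv : 0 ≤ v) (pw : 0 ≤ w)
    (h : rf cs v = rf cs w) : v = w := by
  rcases rf_inj hv hw h with h | h
  · exact h
  · exact (hv.absurd pv (by rw [h]; exact neg_nonpos.2 pw)).elim

lemma root_eq_al {v : B → ℝ} (h : IsRt cs v) (hp : 0 ≤ v) (i : B) (hz : ∀ j, j ≠ i → v j ≤ 0) :
    v = al i := by
  have e : v = v i • (al i : B → ℝ) := by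
    ext j
    by_cases hj : j = i
    · subst hj; simp [al]
    · have := le_antisymm (hz j hj) (hp j)
      rw [this]; simp [al, hj]
  have n := h.norm
  rw [e] at n
  simp only [map_smul, LinearMap.smul_apply, bf_al_self, smul_eq_mul] at n
  have h0 : 0 ≤ v i := hp i
  have : v i = 1 := by nlinarith
  rw [e, this, one_smul]

lemma s_pos {v : B → ℝ} (h : IsRt cs v) (hp : 0 ≤ v) (i : B) (hi : v ≠ al i) :
    0 ≤ rh cs (cs.simple i) v := by
  rcases (h.act (cs.simple i)).sign with h1 | h1
  · exact h1
  · exfalso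
    apply hi
    apply root_eq_al h hp i
    intro j hj
    have := h1 j
    rw [rh_simple] at this
    simpa [al, hj] using this

lemma inv_neg_imp {n : ℕ} : ∀ (g : W), cs.length g = n → ∀ (b : B → ℝ), IsRt cs b → 0 ≤ b →
    rh cs g⁻¹ b ≤ 0 → cs.length (rf cs b * g) < cs.length g := by
  induction n with
  | zero =>
    intro g hg b hb pb hn
    have : g = 1 := cs.length_eq_zero_iff.1 hg
    subst this
    rw [inv_one, rh_one] at hn
    exact (hb.absurd pb hn).elim
  | succ n ih =>
    intro g hg b hb pb hn
    have hg1 : g ≠ 1 := by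
      rintro rfl
      simp at hg
    obtain ⟨i, hi⟩ := cs.exists_leftDescent_of_ne_one hg1
    have hl := cs.isLeftDescent_iff.1 hi
    by_cases hbi : b = al i
    · subst hbi; rw [rf_al]; exact hi
    · have p' := s_pos hb pb i hbi
      have := ih (cs.simple i * g) (by omega) _ (hb.act (cs.simple i)) p' (by
        rw [mul_inv_rev, rh_mul, cs.inv_simple, ← rh_mul cs (cs.simple i)]
        simpa [rh_one] using hn)
      rw [rf_act hb] at this
      have e : rf cs b * g = cs.simple i * (cs.simple i * rf cs b * (cs.simple i)⁻¹ * (cs.simple i * g)) := by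
        simp [mul_assoc]
      rw [e]
      have h3 := cs.length_mul_le (cs.simple i)
        (cs.simple i * rf cs b * (cs.simple i)⁻¹ * (cs.simple i * g))
      rw [cs.length_simple] at h3
      omega

lemma inv_iff {b : B → ℝ} (hb : IsRt cs b) (pb : 0 ≤ b) (g : W) :
    cs.length (rf cs b * g) < cs.length g ↔ rh cs g⁻¹ b ≤ 0 := by
  constructor
  · intro h
    rcases (hb.act g⁻¹).sign with h1 | h1
    · exfalso
      have := inv_neg_imp (rf cs b * g) rfl b hb pb (by
        rw [mul_inv_rev, rf_inv hb, rh_mul, rh_rf_self hb, map_neg]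
        exact neg_nonpos.2 h1)
      rw [← mul_assoc, rf_mul_self hb, one_mul] at this
      omega
    · exact h1
  · exact inv_neg_imp g rfl b hb pb

variable (cs) in
lemma inv_finite (h : W) : {b : B → ℝ | IsRt cs b ∧ 0 ≤ b ∧ rh cs h b ≤ 0}.Finite := by
  induction h using cs.simple_induction_left with
  | one =>
    convert Set.finite_empty
    ext b
    simp only [Set.mem_ofPred_eq, Set.mem_empty_iff_false, iff_false]
    rintro ⟨h1, h2, h3⟩
    rw [rh_one] at h3
    exact h1.absurd h2 h3
  | mul_simple_left h i ih =>
    refine (ih.union (Set.finite_singleton (rh cs h⁻¹ (al i)))).subset ?_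
    rintro b ⟨h1, h2, h3⟩
    rcases (h1.act h).sign with h4 | h4
    · right
      have : rh cs h b = al i := by
        by_contra hc
        have := s_pos (h1.act h) h4 i hc
        rw [rh_mul] at h3
        exact ((h1.act h).act _).absurd this h3
      rw [← this, rh_inv_apply]; rfl
    · left; exact ⟨h1, h2, h4⟩

lemma bf_sum (x v : B → ℝ) : bf M x v = ∑ i, v i * bf M x (al i) := by
  conv_lhs => rw [vec_eq_sum v]
  simp [map_sum]

lemma exists_pos_simple {v : B → ℝ} (h : IsRt cs v) (hp : 0 ≤ v) : ∃ i, 0 < v i ∧ 0 < bf M v (al i) := by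
  have n := h.norm
  rw [bf_sum] at n
  by_contra hc
  push Not at hc
  have : ∑ i, v i * bf M v (al i) ≤ 0 := by
    apply Finset.sum_nonpos
    intro i _
    rcases (hp i).eq_or_lt with h0 | h0
    · have : v i = 0 := h0.symm
      rw [this]; simp
    · exact mul_nonpos_of_nonneg_of_nonpos h0.le (hc i h0)
  linarith

lemma rf_s_neg {v : B → ℝ} (h : IsRt cs v) (hp : 0 ≤ v) (i : B) (hi : v ≠ al i)
    (hb : 0 < bf M v (al i)) : rh cs (rf cs v) (al i) ≤ 0 := by
  rcases ((IsRt.al i).act (rf cs v)).sign with h1 | h1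
  · exfalso
    apply hi
    apply root_eq_al h hp i
    intro j hj
    have := h1 j
    rw [rh_rf h] at this
    simp [al, hj] at this
    have h2 : 2 * bf M v (al i) * v j ≤ 0 := this
    nlinarith
  · exact h1

lemma rf_len_lt {v : B → ℝ} (h : IsRt cs v) (hp : 0 ≤ v) (i : B) (hi : v ≠ al i)
    (hb : 0 < bf M v (al i)) :
    cs.length (rf cs (rh cs (cs.simple i) v)) < cs.length (rf cs v) := by
  have h1 := (descent_iff cs _ _).2 (rf_s_neg h hp i hi hb)
  have h2 : cs.IsRightDescent (cs.simple i * rf cs v) i := by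
    rw [descent_iff, rh_mul, rh_rf h, map_sub, map_smul, rh_simple_self]
    have := s_pos h hp i hi
    have : 0 ≤ (2 * bf M v (al i)) • rh cs (cs.simple i) v := smul_nonneg (by linarith) this
    have h3 := al_nonneg i
    rw [sub_nonpos]
    exact (neg_nonpos.2 h3).trans this
  rw [rf_act h, cs.inv_simple]
  have e : cs.length (cs.simple i * rf cs v) = cs.length (rf cs v * cs.simple i) := by
    rw [← cs.length_inv, mul_inv_rev, rf_inv h, cs.inv_simple]
  unfold CoxeterSystem.IsRightDescent at h1 h2
  omega

end Roots
end ShiJoin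
namespace ShiJoin

set_option linter.unusedSectionVars false

section Sep
variable [Fintype B] [DecidableEq B] {cs : CoxeterSystem M W}

lemma Us_ge (c : ℝ) (hc : 1 ≤ c) (k : ℕ) : 0 ≤ Us c k ∧ Us c k + 1 ≤ Us c (k+1) := by
  induction k with
  | zero => simp [Us]
  | succ k ih =>
    obtain ⟨h1, h2⟩ := ih
    refine ⟨by linarith, ?_⟩
    rw [Us]
    nlinarith

lemma dih_root {a b : B → ℝ} (ha : IsRt cs a) (hb : IsRt cs b) (k : ℕ) :
    IsRt cs (Us (-bf M a b) (2*k+1) • a + Us (-bf M a b) (2*k) • b) := by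
  induction k with
  | zero => simpa [Us] using ha
  | succ k ih =>
    have h1 := hb.s_root ih
    have h2 := ha.s_root h1
    convert h2 using 1
    have e : 2 * (k+1) = 2*k+2 := by ring
    rw [e]
    simp only [map_add, map_sub, map_smul, smul_eq_mul, ha.norm, hb.norm, bf_symm M b a, Us]
    module

lemma lemD {a b : B → ℝ} (ha : IsRt cs a) (hb : IsRt cs b) (pa : 0 ≤ a) (pb : 0 ≤ b)
    (hab : bf M a b ≤ -1) (h : W) (na : rh cs h a ≤ 0) (nb : rh cs h b ≤ 0) : False := by
  set c := -bf M a b with hc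
  have hc1 : 1 ≤ c := by linarith
  have hu := Us_ge c hc1
  obtain ⟨i, hi, -⟩ := exists_pos_simple ha pa
  let r : ℕ → (B → ℝ) := fun k => Us c (2*k+1) • a + Us c (2*k) • b
  have mono : StrictMono (fun k => r k i) := by
    apply strictMono_nat_of_lt_succ
    intro k
    have b0 : 0 ≤ b i := pb i
    have u0 := hu (2*k)
    have u1 := hu (2*k+1)
    have u2 := hu (2*k+2)
    have e : 2 * (k+1) = 2*k+2 := by ring
    simp only [r, Pi.add_apply, Pi.smul_apply, smul_eq_mul, e]
    have := mul_lt_mul_of_pos_right (show Us c (2*k+1) < Us c (2*k+2+1) by linarith [u1.2, u2.2]) hi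
    have := mul_le_mul_of_nonneg_right (show Us c (2*k) ≤ Us c (2*k+2) by linarith [u1.2, u0.2]) b0
    linarith
  have inj : Function.Injective r := by
    intro x y hxy
    exact mono.injective (by simp only [hxy])
  refine Set.infinite_of_injective_forall_mem (s := {b : B → ℝ | IsRt cs b ∧ 0 ≤ b ∧ rh cs h b ≤ 0})
    inj ?_ (inv_finite cs h)
  intro k
  refine ⟨dih_root ha hb k, add_nonneg (smul_nonneg (hu _).1 pa) (smul_nonneg (hu _).1 pb), ?_⟩
  simp only [r, map_add, map_smul]
  exact add_nonpos (smul_nonpos_of_nonneg_of_nonpos (hu _).1 na)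
    (smul_nonpos_of_nonneg_of_nonpos (hu _).1 nb)

lemma sep_a {b d : B → ℝ} (hb : IsRt cs b) (hd : IsRt cs d) (pd : 0 ≤ d)
    (hs : SepIdWall cs (rf cs d) (rf cs b)) (n : ℕ) : ∀ g : W,
    cs.length (rf cs (rh cs g⁻¹ b)) = n → 0 ≤ rh cs g⁻¹ b → 0 ≤ rh cs g⁻¹ d →
    0 ≤ rh cs g⁻¹ (rh cs (rf cs b) d) → False := by
  induction n using Nat.strong_induction_on with
  | _ n ih =>
  intro g hg h1 h2 h3
  have hk := hb.act g⁻¹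
  have e3 : rh cs g⁻¹ (rh cs (rf cs b) d) = rh cs (rf cs (rh cs g⁻¹ b)) (rh cs g⁻¹ d) := by
    rw [rf_act hb, ← rh_mul, ← rh_mul]; simp [mul_assoc]
  rw [e3] at h3
  have hd' := hd.act g⁻¹
  by_cases hsim : ∃ i, rh cs g⁻¹ b = al i
  · obtain ⟨i, hi⟩ := hsim
    have := hs.2 g ⟨i, by rw [← rf_al cs i, ← hi, rf_act hb]; simp⟩
    exact hd'.absurd h2 ((inv_iff hd pd g).1 this)
  · push Not at hsim
    obtain ⟨i, -, hi⟩ := exists_pos_simple hk h1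
    have hn := rf_s_neg hk h1 i (hsim i) hi
    have n1 : rh cs g⁻¹ d ≠ al i := by
      intro e
      rw [e] at h3
      exact ((IsRt.al i).act _).absurd h3 hn
    have n2 : rh cs (rf cs (rh cs g⁻¹ b)) (rh cs g⁻¹ d) ≠ al i := by
      intro e
      have : rh cs g⁻¹ d = rh cs (rf cs (rh cs g⁻¹ b)) (al i) := by
        rw [← e, ← rh_mul, rf_mul_self hk, rh_one]
      rw [this] at h2
      exact ((IsRt.al i).act _).absurd h2 hn
    have hinv : ∀ x, rh cs (g * cs.simple i)⁻¹ x = rh cs (cs.simple i) (rh cs g⁻¹ x) := by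
      intro x; rw [mul_inv_rev, rh_mul, cs.inv_simple]
    refine ih _ ?_ (g * cs.simple i) rfl ?_ ?_ ?_
    · rw [hinv, ← hg]; exact rf_len_lt hk h1 i (hsim i) hi
    · rw [hinv]; exact s_pos hk h1 i (hsim i)
    · rw [hinv]; exact s_pos hd' h2 i n1
    · rw [hinv, e3]; exact s_pos (hd'.act _) h3 i n2

lemma sep_a' {b d : B → ℝ} (hb : IsRt cs b) (hd : IsRt cs d) (pd : 0 ≤ d)
    (hs : SepIdWall cs (rf cs d) (rf cs b)) (g : W) (h2 : 0 ≤ rh cs g⁻¹ d)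
    (h3 : 0 ≤ rh cs g⁻¹ (rh cs (rf cs b) d)) : False := by
  rcases (hb.act g⁻¹).sign with h1 | h1
  · exact sep_a hb hd pd hs _ g rfl h1 h2 h3
  · have hinv : ∀ x, rh cs (rf cs b * g)⁻¹ x = rh cs g⁻¹ (rh cs (rf cs b) x) := by
      intro x; rw [mul_inv_rev, rh_mul, rf_inv hb]
    refine sep_a hb hd pd hs _ (rf cs b * g) rfl ?_ ?_ ?_
    · rw [hinv, rh_rf_self hb, map_neg]; exact neg_nonneg.2 h1
    · rw [hinv]; exact h3
    · rw [hinv, ← rh_mul cs (rf cs b), rf_mul_self hb, rh_one]; exact h2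

lemma concave_seq (a : ℕ → ℝ) (k : ℝ) (hk : 0 < k) (h0 : 0 < a 0) (hn : ∀ n, 0 ≤ a n)
    (hr : ∀ n, a (n+2) + a n = (2 - k) * a (n+1)) : False := by
  have hD : ∀ n, a (n+2) - a (n+1) ≤ a (n+1) - a n := by
    intro n
    have := hr n
    nlinarith [hn (n+1)]
  have inc : ∀ n, a n ≤ a (n+1) := by
    intro n
    by_contra hc
    push Not at hc
    have h1 : ∀ m, a (n+m+1) - a (n+m) ≤ a (n+1) - a n ∧ a (n+m) ≤ a n + m * (a (n+1) - a n) := by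
      intro m
      induction m with
      | zero => simp
      | succ m ih =>
        have := hD (n+m)
        refine ⟨?_, ?_⟩
        · show a (n+m+2) - a (n+m+1) ≤ _
          linarith [ih.1]
        · show a (n+m+1) ≤ _
          push_cast
          linarith [ih.1, ih.2]
    obtain ⟨m, hm⟩ := exists_nat_gt (a n / (a n - a (n+1)))
    rw [div_lt_iff₀ (by linarith)] at hm
    linarith [(h1 m).2, hn (n+m)]
  have ge : ∀ n, a 0 ≤ a n := by
    intro n
    induction n with
    | zero => exact le_refl _
    | succ n ih => exact ih.trans (inc n)
  have hd : ∀ n : ℕ, a (n+1) - a n ≤ (a 1 - a 0) - n * (k * a 0) := by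
    intro n
    induction n with
    | zero => simp
    | succ n ih =>
      have := hr n
      have h2 : k * a 0 ≤ k * a (n+1) := mul_le_mul_of_nonneg_left (ge _) hk.le
      push_cast
      show a (n+2) - a (n+1) ≤ _
      nlinarith
  obtain ⟨m, hm⟩ := exists_nat_gt ((a 1 - a 0) / (k * a 0))
  rw [div_lt_iff₀ (by positivity)] at hm
  linarith [hd m, inc m]

lemma sep_bf {b d : B → ℝ} (hb : IsRt cs b) (hd : IsRt cs d) (pb : 0 ≤ b) (pd : 0 ≤ d)
    (hs : SepIdWall cs (rf cs d) (rf cs b)) : 1 ≤ bf M b d := by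
  have key := sep_a' hb hd pd hs
  set c := bf M b d with hc
  have hc' : bf M d b = c := by rw [bf_symm]
  have c0 : 0 < c := by
    by_contra hcn
    push Not at hcn
    refine key 1 (by rw [inv_one, rh_one]; exact pd) ?_
    rw [inv_one, rh_one, rh_rf hb, ← hc]
    have : 0 ≤ (-(2 * c)) • b := smul_nonneg (by linarith) pb
    rw [neg_smul] at this
    rw [sub_eq_add_neg]
    exact add_nonneg pd this
  by_contra hlt
  push Not at hlt
  set T := rf cs b * rf cs d with hT
  let u : ℕ → (B → ℝ) := fun n => rh cs (T^n) d
  have u1 : rh cs T d = - rh cs (rf cs b) d := by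
    rw [hT, rh_mul, rh_rf_self hd, map_neg]
  have pos : ∀ n, 0 ≤ u n := by
    intro n
    induction n with
    | zero => simp only [u, pow_zero, rh_one]; exact pd
    | succ n ih =>
      have e : u (n+1) = - rh cs (T^n) (rh cs (rf cs b) d) := by
        simp only [u, pow_succ, rh_mul cs _ T, u1, map_neg]
      rw [e]
      rcases ((hd.act (rf cs b)).act (T^n)).sign with h | h
      · exact (key (T^n)⁻¹ (by rw [inv_inv]; exact ih) (by rw [inv_inv]; exact h)).elim
      · exact neg_nonneg.2 h
  have rec0 : rh cs (T^2) d + d = (2 - (4 - 4*c^2)) • rh cs T d := by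
    have hc2 : (bf M b) d = c := hc.symm
    simp only [pow_two, rh_mul, hT, rh_rf hd, rh_rf hb, map_sub, map_smul, smul_eq_mul, hd.norm,
      hb.norm, hc', hc2]
    module
  have hrec : ∀ n : ℕ, u (n+2) + u n = (2 - (4 - 4*c^2)) • u (n+1) := by
    intro n
    have := congrArg (rh cs (T^n)) rec0
    simpa only [map_add, map_smul, ← rh_mul, ← pow_add, ← pow_succ] using this
  obtain ⟨i, hi, -⟩ := exists_pos_simple hd pd
  refine concave_seq (fun n => u n i) (4 - 4*c^2) (by nlinarith) ?_ (fun n => pos n i) ?_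
  · simpa [u] using hi
  · intro n
    have := congrFun (hrec n) i
    simpa using this

lemma sep_ne {b d : B → ℝ} (hb : IsRt cs b) (hs : SepIdWall cs (rf cs d) (rf cs b)) : b ≠ d := by
  rintro rfl
  obtain ⟨w, i, e⟩ := hb
  have h1 := hs.2 w ⟨i, by rw [e, rf_conj]; simp [mul_assoc]⟩
  have h2 := hs.2 (rf cs b * w) ⟨i, by rw [e, rf_conj]; simp [mul_assoc]⟩
  rw [← mul_assoc, rf_mul_self ⟨w, i, e⟩, one_mul] at h2
  omega

lemma sep_of_block {b d : B → ℝ} (hb : IsRt cs b) (hd : IsRt cs d) (pd : 0 ≤ d)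
    (hbd : 1 ≤ bf M b d) (hne : b ≠ d) (f0 : W) (h1 : 0 ≤ rh cs f0⁻¹ b) (h2 : rh cs f0⁻¹ d ≤ 0) :
    SepIdWall cs (rf cs d) (rf cs b) := by
  have fin : ∀ f1 : W, rh cs f1⁻¹ b ≤ 0 → 0 ≤ rh cs f1⁻¹ d → False := by
    intro f1 h3 h4
    refine lemD (hb.act f0⁻¹) (hd.act f0⁻¹).neg h1 (neg_nonneg.2 h2) ?_ (f1⁻¹ * f0) ?_ ?_
    · rw [map_neg, bf_rh]; linarith
    · rw [rh_mul, rh_apply_inv]; exact h3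
    · rw [rh_mul, map_neg, rh_apply_inv, map_neg]; exact neg_nonpos.2 h4
  refine ⟨rf_isRefl hd, ?_⟩
  rintro f ⟨i, hi⟩
  rw [inv_iff hd pd]
  rcases (hd.act f⁻¹).sign with h | h
  swap
  · exact h
  exfalso
  have : rf cs (rh cs f⁻¹ b) = rf cs (al i) := by rw [rf_act hb, rf_al]; simpa using hi
  rcases rf_inj (hb.act f⁻¹) (IsRt.al i) this with e | e
  · apply fin (f * cs.simple i)
    · rw [mul_inv_rev, rh_mul, cs.inv_simple, e, rh_simple_self]
      exact neg_nonpos.2 (al_nonneg i)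
    · rw [mul_inv_rev, rh_mul, cs.inv_simple]
      apply s_pos (hd.act _) h
      intro e2
      apply hne
      have := congrArg (rh cs f) (e.trans e2.symm)
      simpa only [rh_apply_inv] using this
  · exact fin f (by rw [e]; exact neg_nonpos.2 (al_nonneg i)) h

end Sep
end ShiJoin
namespace ShiJoin

set_option linter.unusedSectionVars false

section RealAlg

lemma algA_S (C v g a b : ℝ) (hg : 0 < g) (hC : 1 ≤ 2 * C^2)
    (H1 : 1 ≤ a - b * C)
    (H3 : g^2 + a^2 + b^2 - 2*a*b*C + 2*g*b*v = 1) : 1 ≤ v^2 + C^2 := by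
  by_contra h
  push Not at h
  have e : g^2 + 2*g*v*b + b^2*(1-C^2) = 1 - (a - b*C)^2 := by linarith
  have h1 : g^2 + 2*g*v*b + b^2*(1-C^2) ≤ 0 := by rw [e]; nlinarith
  have h2 : (g + v*b)^2 + b^2*(1 - C^2 - v^2) ≤ 0 := by linarith
  have h3 : b^2 * (1-C^2-v^2) ≤ 0 := by nlinarith [sq_nonneg (g+v*b)]
  have hb : b = 0 := by
    by_contra hb
    have : 0 < b^2 := by positivity
    nlinarith
  subst hb
  nlinarith

lemma algA (C v g a b : ℝ) (hg : 0 < g) (hC0 : 0 < C) (hC : 1 ≤ 2 * C^2) (hC1 : C < 1) (ha : a ≤ 0)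
    (hv0 : 0 < v) (hv : v = 1/2 ∨ 1 ≤ 2 * v^2)
    (H1 : 1 ≤ a - b * C)
    (H2 : (g*v - a*C + b) + 2*C*(a - b*C) < 1)
    (H3 : g^2 + a^2 + b^2 - 2*a*b*C + 2*g*b*v = 1) : g ≤ -(2*v*b) := by
  have hS := algA_S C v g a b hg hC H1 H3
  have hb : b < 0 := by nlinarith
  have hbC : 1 ≤ -(b*C) := by linarith
  by_cases h : g * C ≤ 2 * v
  · have : g * C ≤ -(2*v*b) * C := by nlinarith
    exact le_of_mul_le_mul_right this hC0
  · push Not at h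
    have h1 : g*v + C - 1 < -b * (1 - C^2) := by nlinarith
    have hC2 : 1/2 ≤ C := by nlinarith
    have h2 : 1 + C - 2*C^2 ≤ 2*v^2 := by
      rcases hv with rfl | hv
      · have : 3/4 ≤ C^2 := by linarith
        nlinarith [sq_nonneg (C - 1/2)]
      · nlinarith
    have S0 : 0 < 1 - C^2 := by nlinarith
    have h3 : 2*v*(1-C) ≤ g * (2*v^2 - (1-C^2)) := by
      have h4 : C * (1-C) ≤ 2*v^2 - (1-C^2) := by linarith
      have h5 : g * (C * (1-C)) ≤ g * (2*v^2 - (1-C^2)) := mul_le_mul_of_nonneg_left h4 hg.le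
      nlinarith
    have : g * (1-C^2) ≤ -(2*v*b) * (1-C^2) := by nlinarith
    exact le_of_mul_le_mul_right this S0

lemma algB_S (C g a b : ℝ) (hg : 0 < g) (hC : 1 ≤ 2 * C^2)
    (H1 : 1 ≤ g/2 + a - b * C)
    (H3 : g^2 + a^2 + b^2 - 2*a*b*C + g*a = 1) : 3 ≤ 4 * C^2 := by
  by_contra h
  push Not at h
  have e : 3/4*g^2 + g*C*b + b^2*(1-C^2) = 1 - (g/2 + a - b*C)^2 := by linarith
  have h1 : 3/4*g^2 + g*C*b + b^2*(1-C^2) ≤ 0 := by rw [e]; nlinarith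
  have h2 : 3/4*(g + 2/3*C*b)^2 + b^2*(1 - 4/3*C^2) ≤ 0 := by linarith
  have h3 : b^2 * (1-4/3*C^2) ≤ 0 := by nlinarith [sq_nonneg (g+2/3*C*b)]
  have hb : b = 0 := by
    by_contra hb
    have : 0 < b^2 := by positivity
    nlinarith
  subst hb
  nlinarith

lemma algB (C g a b : ℝ) (hg : 0 < g) (hC0 : 0 < C) (hC : 1 ≤ 2 * C^2) (hC1 : C < 1) (ha : a ≤ -g)
    (H1 : 1 ≤ g/2 + a - b * C)
    (H2 : (- a*C + b) + 2*C*(g/2 + a - b*C) < 1)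
    (H3 : g^2 + a^2 + b^2 - 2*a*b*C + g*a = 1) : (4*C^2-1) * g ≤ -(2*C*b) := by
  have hS := algB_S C g a b hg hC H1 H3
  have hbC : 1 + g/2 ≤ -(b*C) := by linarith
  have hC2 : 1/2 ≤ C := by nlinarith
  by_cases h : g * (2*C^2 - 1) ≤ 1
  · nlinarith
  · push Not at h
    have h1 : C*g/2 + C - 1 < -b * (1 - C^2) := by nlinarith
    have S0 : 0 < 1 - C^2 := by nlinarith
    have q : 0 ≤ 4*C^2 - 2*C - 1 := by nlinarith [sq_nonneg (C - 1/2)]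
    have h3 : 2*C*(1-C) ≤ g * (2*C^2-1)^2 := by
      have h5 : (2*C^2-1) * 1 ≤ (2*C^2-1) * (g * (2*C^2-1)) :=
        mul_le_mul_of_nonneg_left h.le (by linarith)
      nlinarith
    have : (4*C^2-1) * g * (1-C^2) ≤ -(2*C*b) * (1-C^2) := by nlinarith
    exact le_of_mul_le_mul_right this S0

end RealAlg
end ShiJoin
namespace ShiJoin

set_option linter.unusedSectionVars false

section Alg
variable [Fintype B] [DecidableEq B] {cs : CoxeterSystem M W}

lemma root_w1 {z x : B → ℝ} (hz : IsRt cs z) (hx : IsRt cs x) :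
    IsRt cs ((1 - 4 * (bf M z x)^2) • z + (2 * bf M z x) • x) := by
  have := (hz.s_root (hx.s_root hz)).neg
  convert this using 1
  simp only [map_sub, map_smul, smul_eq_mul, hz.norm, bf_symm M x z]
  module

lemma root_w2 {z x : B → ℝ} (hz : IsRt cs z) (hx : IsRt cs x) :
    IsRt cs ((4 * (bf M z x)^2 - 1) • z + (4 * bf M z x * (1 - 2 * (bf M z x)^2)) • x) := by
  have := hx.s_root (hz.s_root (hx.s_root hz))
  convert this using 1
  simp only [map_sub, map_smul, smul_eq_mul, hz.norm, hx.norm, bf_symm M x z]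
  module

lemma choose_z {x y d : B → ℝ} {C : ℝ} (hx : IsRt cs x) (hy : IsRt cs y)
    (hxy : bf M x y = -C) (hC1 : C < 1) (hC0 : 0 < C) (L : (B → ℝ) →ₗ[ℝ] ℝ) (Lx : L x = 0) (Ly : L y = 0)
    (N : Set (B → ℝ)) (hfin : N.Finite) (hd : d ∈ N) (hL : ∀ e ∈ N, 0 < L e) :
    ∃ z ∈ N, ∀ c a b : ℝ, 0 < c → c • z + a • x + b • y ∈ N →
      a ≤ 0 ∧ (a = 0 → 1 ≤ c ∧ (c = 1 → b ≤ 0)) := by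
  let T : (B → ℝ) → ℝ := fun e => bf M e (x + C • y) / L e
  obtain ⟨z1, hz1, m1⟩ := Set.exists_max_image N T hfin ⟨d, hd⟩
  obtain ⟨z2, hz2, m2⟩ := Set.exists_max_image {e | e ∈ N ∧ T e = T z1} (fun e => - L e)
    (hfin.subset fun e he => he.1) ⟨z1, hz1, rfl⟩
  obtain ⟨z, hz, m3⟩ := Set.exists_max_image {e | e ∈ N ∧ T e = T z1 ∧ L e = L z2}
    (fun e => bf M e y) (hfin.subset fun e he => he.1) ⟨z2, hz2.1, hz2.2, rfl⟩
  refine ⟨z, hz.1, ?_⟩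
  intro c a b hc he
  set e := c • z + a • x + b • y with hedef
  have Lz := hL z hz.1
  have Le : L e = c * L z := by simp [hedef, Lx, Ly]
  have S0 : 0 < 1 - C^2 := by nlinarith
  have hTe : T e = T z + a * (1 - C^2) / (c * L z) := by
    have : bf M e (x + C • y) = c * bf M z (x + C • y) + a * (1 - C^2) := by
      simp only [hedef, map_add, map_smul, LinearMap.add_apply, LinearMap.smul_apply, smul_eq_mul,
        hx.norm, hy.norm, bf_symm M y x, hxy]
      ring
    simp only [T]
    rw [Le, this]
    field_simp
  have key := m1 e he
  rw [← hz.2.1, hTe] at key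
  have ha : a ≤ 0 := by
    by_contra h
    push Not at h
    have : 0 < a * (1 - C^2) / (c * L z) := by positivity
    linarith
  refine ⟨ha, ?_⟩
  rintro rfl
  have hT2 : T e = T z1 := by rw [hTe, ← hz.2.1]; simp
  have k2 := m2 e ⟨he, hT2⟩
  simp only [← hz.2.2, Le] at k2
  have c1 : 1 ≤ c := by
    have : 1 * L z ≤ c * L z := by linarith
    exact le_of_mul_le_mul_right this Lz
  refine ⟨c1, ?_⟩
  rintro rfl
  have k3 := m3 e ⟨he, hT2, by rw [Le, ← hz.2.2, one_mul]⟩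
  simp only [hedef, one_smul, zero_smul, add_zero, map_add, map_smul, LinearMap.add_apply,
    LinearMap.smul_apply, smul_eq_mul, hy.norm] at k3
  linarith

set_option maxHeartbeats 1600000 in
theorem ALG {x y d : B → ℝ} {C : ℝ} (hx : IsRt cs x) (hy : IsRt cs y)
    (hxy : bf M x y = -C) (hC0 : 0 < C) (hC : 1 ≤ 2 * C^2) (hC1 : C < 1)
    (L : (B → ℝ) →ₗ[ℝ] ℝ) (Lx : L x = 0) (Ly : L y = 0)
    (N : Set (B → ℝ)) (hfin : N.Finite) (hd : d ∈ N) (hL : ∀ e ∈ N, 0 < L e)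
    (hR : ∀ e ∈ N, IsRt cs e)
    (hspan : ∀ e ∈ N, ∃ g a b : ℝ, e = g • d + a • x + b • y)
    (hcl : ∀ e ∈ N, ∀ c a b : ℝ, 0 < c → 0 ≤ a → 0 ≤ b → IsRt cs (c • e + a • x + b • y) →
      c • e + a • x + b • y ∈ N)
    (hxd : 1 ≤ bf M x d) : ∃ e ∈ N, 1 ≤ bf M (y + (2*C) • x) e := by
  obtain ⟨z, hz, mx⟩ := choose_z (cs := cs) hx hy hxy hC1 hC0 L Lx Ly N hfin hd hL
  have rz := hR z hz
  by_contra hcon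
  push Not at hcon
  set l := bf M z x with hl
  set v := bf M z y with hv
  have hyx : bf M y x = -C := by rw [bf_symm, hxy]
  have hxz : bf M x z = l := by rw [bf_symm]
  have hyz : bf M y z = v := by rw [bf_symm]
  -- closure from z
  have step : ∀ c a b : ℝ, 0 < c → 0 ≤ a → 0 ≤ b → IsRt cs (c • z + a • x + b • y) →
      a ≤ 0 ∧ (a = 0 → 1 ≤ c ∧ (c = 1 → b ≤ 0)) := fun c a b hc ha hb hr =>
    mx c a b hc (hcl z hz c a b hc ha hb hr)
  have l0 : 0 ≤ l := by
    by_contra h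
    push Not at h
    have := (step 1 (-(2*l)) 0 one_pos (by linarith) le_rfl (by
      have := hx.s_root rz
      rw [hxz] at this
      convert this using 1; module)).1
    linarith
  have l1 : ¬ (0 < l ∧ l < 1/2) := by
    rintro ⟨h1, h2⟩
    have := (step (1 - 4*l^2) (2*l) 0 (by nlinarith) (by linarith) le_rfl (by
      have := root_w1 rz hx
      convert this using 1; module)).1
    linarith
  have l2 : ¬ (1/2 < l ∧ 2 * l^2 < 1) := by
    rintro ⟨h1, h2⟩
    have := (step (4*l^2 - 1) (4*l*(1-2*l^2)) 0 (by nlinarith)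
      (mul_nonneg (by linarith) (by linarith)) le_rfl (by
      have := root_w2 rz hx
      convert this using 1; module)).1
    have : 0 < 4*l*(1-2*l^2) := mul_pos (by linarith) (by linarith)
    linarith
  have v0 : 0 ≤ v := by
    by_contra h
    push Not at h
    have := ((step 1 0 (-(2*v)) one_pos le_rfl (by linarith) (by
      have := hy.s_root rz
      rw [hyz] at this
      convert this using 1; module)).2 rfl).2 rfl
    linarith
  have v1 : ¬ (0 < v ∧ v < 1/2) := by
    rintro ⟨h1, h2⟩
    have := ((step (1 - 4*v^2) 0 (2*v) (by nlinarith) le_rfl (by linarith) (by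
      have := root_w1 rz hy
      convert this using 1; module)).2 rfl).1
    nlinarith
  have v2 : ¬ (1/2 < v ∧ 2 * v^2 < 1) := by
    rintro ⟨h1, h2⟩
    have := ((step (4*v^2 - 1) 0 (4*v*(1-2*v^2)) (by nlinarith) le_rfl
      (mul_nonneg (by linarith) (by linarith)) (by
      have := root_w2 rz hy
      convert this using 1; module)).2 rfl).1
    nlinarith
  have hth : ∀ e, bf M (y + (2*C) • x) e = bf M y e + 2*C*bf M x e := by
    intro e; simp
  have hz1 := hcon z hz
  rw [hth, hxz, hyz] at hz1
  -- d in terms of z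
  obtain ⟨g, a, b, hg, ed⟩ : ∃ g a b : ℝ, 0 < g ∧ d = g • z + a • x + b • y := by
    obtain ⟨g', a', b', e⟩ := hspan z hz
    have hLz := hL z hz
    have hLd := hL d hd
    have : L z = g' * L d := by
      have := congrArg L e
      simpa [Lx, Ly] using this
    have hg' : 0 < g' := by
      rw [this] at hLz
      exact pos_of_mul_pos_left hLz hLd.le
    refine ⟨1/g', -a'/g', -b'/g', by positivity, ?_⟩
    rw [e]
    match_scalars <;> field_simp <;> ring
  have rd := hR d hd
  obtain ⟨ha, ha'⟩ := mx g a b hg (by rw [← ed]; exact hd)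
  have hxi : bf M x d = g*l + a - b*C := by
    rw [ed]; simp only [map_add, map_smul, smul_eq_mul, hx.norm, hxy, hxz]; ring
  have hbe : bf M y d = g*v - a*C + b := by
    rw [ed]; simp only [map_add, map_smul, smul_eq_mul, hy.norm, hyx, hyz]; ring
  have hn : g^2 + a^2 + b^2 - 2*a*b*C + 2*g*a*l + 2*g*b*v = 1 := by
    rw [← rd.norm, ed]
    simp only [map_add, map_smul, smul_eq_mul, hx.norm, hy.norm, rz.norm, hxy, hyx, hxz, hyz,
      LinearMap.add_apply, LinearMap.smul_apply, ← hl, ← hv]; ring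
  have hd1 := hcon d hd
  rw [hth, hbe, hxi] at hd1
  rw [hxi] at hxd
  -- closure from d, coefficients in z
  have inN : ∀ c p q : ℝ, 0 < c → c * a ≤ p * g → c * b ≤ q * g → IsRt cs (c • z + p • x + q • y) →
      c • z + p • x + q • y ∈ N := by
    intro c p q hc hp hq hr
    have e : c • z + p • x + q • y = (c/g) • d + (p - c*a/g) • x + (q - c*b/g) • y := by
      rw [ed]
      match_scalars <;> field_simp <;> ring
    rw [e] at hr ⊢
    refine hcl d hd _ _ _ (by positivity) ?_ ?_ hr
    · rw [sub_nonneg, div_le_iff₀ hg]; exact hp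
    · rw [sub_nonneg, div_le_iff₀ hg]; exact hq
  have hC2 : 1/2 ≤ C := by nlinarith
  have hb0 : g*v - a*C + b < 0 := by nlinarith
  have hlcases : l = 0 ∨ (v = 0 ∧ l = 1/2) := by
    rcases l0.eq_or_lt with h | h
    · exact Or.inl h.symm
    right
    have h12 : 1/2 ≤ l := by
      by_contra hh; push Not at hh; exact l1 ⟨h, hh⟩
    have hl2 : l = 1/2 := by
      by_contra hh
      have h3 : 1/2 < l := lt_of_le_of_ne h12 (Ne.symm hh)
      have h4 : 1 ≤ 2 * l^2 := by
        by_contra h5; push Not at h5; exact l2 ⟨h3, h5⟩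
      have h5 : 1 ≤ 2*(C*l) := by
        have : (1:ℝ)/4 ≤ (C*l)^2 := by nlinarith
        nlinarith [mul_pos hC0 h]
      linarith
    refine ⟨?_, hl2⟩
    by_contra hh
    have h3 : 0 < v := lt_of_le_of_ne v0 (Ne.symm hh)
    have h4 : 1/2 ≤ v := by
      by_contra h5; push Not at h5; exact v1 ⟨h3, h5⟩
    rw [hl2] at hz1
    linarith
  rcases hlcases with h | ⟨hv0, hl2⟩
  · rw [h] at hxd hn hd1
    rcases v0.eq_or_lt with h0 | h0
    · rw [← h0] at hn
      have q1 : 1 ≤ (a - b*C)^2 := by nlinarith only [hxd]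
      have q2 : 0 ≤ b^2*(1-C^2) := mul_nonneg (sq_nonneg _) (by nlinarith only [hC0, hC1])
      have q3 : 0 < g^2 := by positivity
      linarith
    · have h4 : 1/2 ≤ v := by
        by_contra h5; push Not at h5; exact v1 ⟨h0, h5⟩
      have hvc : v = 1/2 ∨ 1 ≤ 2*v^2 := by
        by_cases hh : v = 1/2
        · exact Or.inl hh
        · right
          by_contra h5; push Not at h5
          exact v2 ⟨lt_of_le_of_ne h4 (Ne.symm hh), h5⟩
      have H1 : 1 ≤ a - b*C := by linarith
      have H2 : (g*v - a*C + b) + 2*C*(a - b*C) < 1 := by linarith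
      have H3 : g^2 + a^2 + b^2 - 2*a*b*C + 2*g*b*v = 1 := by linarith
      have hS := algA_S C v g a b hg hC H1 H3
      have hA := algA C v g a b hg hC0 hC hC1 ha h0 hvc H1 H2 H3
      have hr : IsRt cs ((2*v) • z + (0:ℝ) • x + (-1:ℝ) • y) := by
        have := (rz.s_root hy).neg
        convert this using 1
        rw [← hv]; module
      have hmem := inN (2*v) 0 (-1) (by linarith)
        (by have := mul_nonneg h0.le (neg_nonneg.2 ha); linarith) (by linarith) hr
      have := hcon _ hmem
      rw [hth] at this
      simp only [map_add, map_smul, smul_eq_mul, hx.norm, hy.norm, hxy, hyx, hxz, hyz, h] at this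
      linarith
  · rw [hl2] at hxd hn hd1
    rw [hv0] at hn hd1
    rw [hv0] at hb0
    have hbneg : b < 0 := by nlinarith
    have hag : a ≤ -g := by
      by_contra hh
      push Not at hh
      have hr : IsRt cs ((g + a) • z + (-a) • x + (-b) • y) := by
        have := (rz.s_root rd).neg
        convert this using 1
        rw [ed]
        simp only [map_add, map_smul, smul_eq_mul, rz.norm, ← hl, ← hv, hl2, hv0]
        module
      have h1 := (step (g+a) (-a) (-b) (by linarith) (by linarith) (by linarith) hr).1
      have h2 : a = 0 := by linarith
      have h3 := (ha' h2).1
      rw [h2] at hn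
      have : 0 < b^2 := by rw [sq]; exact mul_pos_of_neg_of_neg hbneg hbneg
      nlinarith
    have H1 : 1 ≤ g/2 + a - b*C := by linarith
    have H2 : (-a*C + b) + 2*C*(g/2 + a - b*C) < 1 := by linarith
    have H3 : g^2 + a^2 + b^2 - 2*a*b*C + g*a = 1 := by linarith
    have hS := algB_S C g a b hg hC H1 H3
    have hB := algB C g a b hg hC0 hC hC1 hag H1 H2 H3
    have hr : IsRt cs ((2*C) • z + (-(2*C)) • x + (-(4*C^2-1)) • y) := by
      have := (rz.s_root (hy.s_root (hx.s_root hy))).neg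
      convert this using 1
      simp only [map_sub, map_smul, smul_eq_mul, ← hl, ← hv, hl2, hv0, hxy, hyx, hy.norm]
      module
    have hmem := inN (2*C) (-(2*C)) (-(4*C^2-1)) (by linarith)
      (by have := mul_le_mul_of_nonneg_left hag hC0.le; linarith) (by linarith) hr
    have := hcon _ hmem
    rw [hth] at this
    simp only [map_add, map_smul, smul_eq_mul, hx.norm, hy.norm, hxy, hyx, hxz, hyz, hl2, hv0] at this
    nlinarith only [this, hS, sq_nonneg C]

end Alg
end ShiJoin
namespace ShiJoin

set_option linter.unusedSectionVars false

section Bip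
variable [Fintype B] [DecidableEq B] {cs : CoxeterSystem M W}

/-- vectors supported on two indices -/
def InPl (s t : B) (v : B → ℝ) : Prop := ∀ j, j ≠ s → j ≠ t → v j = 0

lemma InPl.eq {s t : B} (hst : s ≠ t) {v : B → ℝ} (h : InPl s t v) :
    v = v t • (al t : B → ℝ) + v s • (al s : B → ℝ) := by
  ext j
  by_cases h1 : j = s
  · subst h1; simp [al, hst]
  · by_cases h2 : j = t
    · subst h2; simp [al, hst.symm]
    · rw [h j h1 h2]; simp [al, h1, h2]

lemma InPl.al_left (s t : B) : InPl s t (al s : B → ℝ) := by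
  intro j h1 _; simp [al, h1]

lemma InPl.al_right (s t : B) : InPl s t (al t : B → ℝ) := by
  intro j _ h1; simp [al, h1]

lemma InPl.simple {s t i : B} (hi : i = s ∨ i = t) {v : B → ℝ} (h : InPl s t v) :
    InPl s t (rh cs (cs.simple i) v) := by
  intro j h1 h2
  rw [rh_simple]
  have : j ≠ i := by rcases hi with rfl | rfl <;> assumption
  simp [al, this, h j h1 h2]

lemma C_lt {h : W} {s t : B} (hst : s ≠ t) (hs : cs.IsRightDescent h s) (ht : cs.IsRightDescent h t) :
    -1 < cf M s t ∧ cf M s t ≤ 0 := by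
  have rs : IsRt cs (rh cs h (al s)) := (IsRt.al s).act h
  have rt : IsRt cs (rh cs h (al t)) := (IsRt.al t).act h
  have ns := nonpos_of_d cs hs
  have nt := nonpos_of_d cs ht
  refine ⟨?_, ?_⟩
  · by_contra hc
    push Not at hc
    refine lemD rs.neg rt.neg (neg_nonneg.2 ns) (neg_nonneg.2 nt) ?_ h⁻¹ ?_ ?_
    · simp only [map_neg, LinearMap.neg_apply, neg_neg, bf_rh, bf_al]; exact hc
    · rw [map_neg, rh_inv_apply]; exact neg_nonpos.2 (al_nonneg s)
    · rw [map_neg, rh_inv_apply]; exact neg_nonpos.2 (al_nonneg t)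
  · unfold cf
    have h1 := M.off_diagonal s t hst
    rw [neg_nonpos]
    have hpi := Real.pi_pos
    by_cases h0 : M s t = 0
    · simp [h0]
    · have h2 : (2:ℝ) ≤ M s t := by
        have : 2 ≤ M s t := by omega
        exact_mod_cast this
      apply Real.cos_nonneg_of_neg_pi_div_two_le_of_le
      · have : 0 ≤ Real.pi / M s t := by positivity
        linarith
      · exact div_le_div_of_nonneg_left hpi.le two_pos h2

theorem BIP {h : W} {s t : B} (hst : s ≠ t) (hs : cs.IsRightDescent h s)
    (ht : cs.IsRightDescent h t) (hne : ¬ IsElementary cs (h * cs.simple t * h⁻¹)) :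
    ∃ i : B, i ≠ s ∧ i ≠ t ∧ ∀ η : B → ℝ, IsRt cs η → 0 ≤ η → InPl s t η → η ≠ al s →
      ∃ e, IsRt cs e ∧ 0 ≤ e ∧ (rh cs h⁻¹ e) i < 0 ∧ 1 ≤ bf M (-rh cs h η) e := by
  obtain ⟨c1, c2⟩ := C_lt hst hs ht
  set C := - cf M s t with hC
  have hfst : cf M s t = -C := by rw [hC]; ring
  have hfts : cf M t s = -C := by rw [cf_symm, hfst]
  set X := - rh cs h (al t) with hX
  set Y := - rh cs h (al s) with hY
  have rX : IsRt cs X := ((IsRt.al t).act h).neg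
  have rY : IsRt cs Y := ((IsRt.al s).act h).neg
  have pX : 0 ≤ X := neg_nonneg.2 (nonpos_of_d cs ht)
  have pY : 0 ≤ Y := neg_nonneg.2 (nonpos_of_d cs hs)
  have hXY : bf M X Y = -C := by
    rw [hX, hY]; simp only [map_neg, LinearMap.neg_apply, neg_neg, bf_rh, bf_al]; exact hfts
  have hrX : rf cs X = h * cs.simple t * h⁻¹ := by
    rw [hX, rf_neg ((IsRt.al t).act h), rf_conj]
  obtain ⟨q, hq⟩ : ∃ q, SepIdWall cs q (rf cs X) := by
    by_contra hc
    apply hne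
    rw [← hrX]
    exact ⟨rf_isRefl rX, hc⟩
  obtain ⟨d, rd, pd, rfl⟩ := exists_rf hq.1
  have hXd := sep_bf rX rd pX pd hq
  have hXne := sep_ne rX hq
  have hnd : rh cs h⁻¹ d ≤ 0 := by
    rw [← inv_iff rd pd]
    exact hq.2 h ⟨t, by rw [hrX]; simp [mul_assoc]⟩
  have hbt : bf M X d = - bf M (al t) (rh cs h⁻¹ d) := by
    rw [hX, ← bf_rh_left]; simp
  obtain ⟨i, his, hit, hi⟩ : ∃ i, i ≠ s ∧ i ≠ t ∧ (rh cs h⁻¹ d) i ≠ 0 := by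
    by_contra hc
    push Not at hc
    have hp : InPl s t (rh cs h⁻¹ d) := hc
    have e := hp.eq hst
    set p := (rh cs h⁻¹ d) t
    set r := (rh cs h⁻¹ d) s
    have n := (rd.act h⁻¹).norm
    rw [hbt] at hXd
    rw [e] at n hXd
    simp only [map_add, map_smul, smul_eq_mul, LinearMap.add_apply, LinearMap.smul_apply, bf_al, cf_self,
      hfst, hfts] at n hXd
    have S0 : 0 < 1 - C^2 := by nlinarith
    have h1 : (p - r*C)^2 + r^2*(1-C^2) = 1 := by linarith
    have h2 : 1 ≤ (p - r*C)^2 := by nlinarith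
    have hr : r = 0 := by
      have : r^2 * (1-C^2) ≤ 0 := by linarith
      have : r^2 ≤ 0 := by
        by_contra hh; push Not at hh
        have := mul_pos hh S0
        linarith
      exact pow_eq_zero_iff (two_ne_zero) |>.1 (le_antisymm this (sq_nonneg r))
    rw [hr] at h1 hXd
    have hp1 : p = -1 := by nlinarith
    apply hXne
    have : d = rh cs h (rh cs h⁻¹ d) := (rh_apply_inv cs h d).symm
    rw [this, e, hr, hp1, hX]
    simp
  have hi0 : (rh cs h⁻¹ d) i < 0 := lt_of_le_of_ne (hnd i) hi
  refine ⟨i, his, hit, ?_⟩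
  let L : (B → ℝ) →ₗ[ℝ] ℝ := -((LinearMap.proj i) ∘ₗ (rh cs h⁻¹).toLinearMap)
  have Ldef : ∀ e, L e = -(rh cs h⁻¹ e) i := fun e => rfl
  have LX : L X = 0 := by rw [Ldef, hX, map_neg, rh_inv_apply]; simp [al, hit]
  have LY : L Y = 0 := by rw [Ldef, hY, map_neg, rh_inv_apply]; simp [al, his]
  let N : Set (B → ℝ) := {e | IsRt cs e ∧ 0 ≤ e ∧ 0 < L e ∧ ∃ g a b : ℝ, e = g • d + a • X + b • Y}
  have hdN : d ∈ N := ⟨rd, pd, by rw [Ldef]; linarith, 1, 0, 0, by module⟩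
  have hcl : ∀ e ∈ N, ∀ c a b : ℝ, 0 < c → 0 ≤ a → 0 ≤ b → IsRt cs (c • e + a • X + b • Y) →
      c • e + a • X + b • Y ∈ N := by
    rintro e ⟨e1, e2, e3, g', a', b', e4⟩ c a b hc ha hb hr
    refine ⟨hr, ?_, ?_, c*g', c*a'+a, c*b'+b, ?_⟩
    · exact add_nonneg (add_nonneg (smul_nonneg hc.le e2) (smul_nonneg ha pX)) (smul_nonneg hb pY)
    · simp only [map_add, map_smul, LX, LY, smul_eq_mul]
      have := mul_pos hc e3
      linarith
    · rw [e4]; module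
  have hfin : N.Finite := by
    refine (inv_finite cs h⁻¹).subset ?_
    rintro e ⟨e1, e2, e3, -⟩
    refine ⟨e1, e2, ?_⟩
    rcases (e1.act h⁻¹).sign with h1 | h1
    · have := h1 i
      rw [Ldef] at e3
      simp only [Pi.zero_apply] at this
      linarith
    · exact h1
  -- the rule
  have rule : ∀ ζ Θ : B → ℝ, ζ = X ∨ ζ = Y → (∃ e ∈ N, 1 ≤ bf M Θ e) → bf M ζ Θ ≤ 0 →
      ∃ e ∈ N, 1 ≤ bf M (Θ - (2 * bf M ζ Θ) • ζ) e := by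
    rintro ζ Θ hζ ⟨e, he, h1⟩ h2
    have rζ : IsRt cs ζ := by rcases hζ with rfl | rfl <;> assumption
    by_cases h3 : bf M ζ e ≤ 0
    · have hr := rζ.s_root he.1
      refine ⟨e - (2 * bf M ζ e) • ζ, ?_, ?_⟩
      · rcases hζ with rfl | rfl
        · have e0 : e - (2 * bf M X e) • X = (1:ℝ) • e + (-(2 * bf M X e)) • X + (0:ℝ) • Y := by module
          rw [e0] at hr ⊢
          exact hcl e he _ _ _ one_pos (by linarith) le_rfl hr
        · have e0 : e - (2 * bf M Y e) • Y = (1:ℝ) • e + (0:ℝ) • X + (-(2 * bf M Y e)) • Y := by module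
          rw [e0] at hr ⊢
          exact hcl e he _ _ _ one_pos le_rfl (by linarith) hr
      · simp only [map_sub, map_smul, smul_eq_mul, LinearMap.sub_apply, LinearMap.smul_apply, rζ.norm,
          bf_symm M Θ ζ]
        linarith
    · push Not at h3
      refine ⟨e, he, ?_⟩
      simp only [map_sub, map_smul, smul_eq_mul, LinearMap.sub_apply, LinearMap.smul_apply]
      have := mul_nonneg (neg_nonneg.2 h2) h3.le
      linarith
  have rule' : ∀ (j : B) (η : B → ℝ), j = s ∨ j = t → (∃ e ∈ N, 1 ≤ bf M (-rh cs h η) e) →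
      bf M (al j) η ≤ 0 → ∃ e ∈ N, 1 ≤ bf M (-rh cs h (rh cs (cs.simple j) η)) e := by
    intro j η hj hb hle
    have e1 : bf M (-rh cs h (al j)) (-rh cs h η) = bf M (al j) η := by
      simp [bf_rh]
    have := rule (-rh cs h (al j)) (-rh cs h η)
      (by rcases hj with rfl | rfl <;> simp [hX, hY]) hb (by rw [e1]; exact hle)
    convert this using 6
    rw [e1, rh_simple, map_sub, map_smul]; module
  -- main induction
  have main : ∀ n : ℕ, ∀ η : B → ℝ, cs.length (rf cs η) = n → IsRt cs η → 0 ≤ η → InPl s t η →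
      η ≠ al s → ∃ e ∈ N, 1 ≤ bf M (-rh cs h η) e := by
    intro n
    induction n using Nat.strong_induction_on with
    | _ n ih =>
    intro η hn rη pη iη hη
    have ss : ∀ j, rh cs (cs.simple j) (rh cs (cs.simple j) η) = η := by
      intro j; rw [← rh_mul]; simp
    by_cases hηt : η = al t
    · exact ⟨d, hdN, by rw [hηt]; exact hXd⟩
    have ta : 0 < η t := by
      refine lt_of_le_of_ne (pη t) ?_
      intro h0
      apply hη
      apply root_eq_al rη pη s
      intro j hj
      by_cases hjt : j = t
      · rw [hjt, ← h0]
      · exact (iη j hj hjt).le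
    have red : ∀ j, j = s ∨ j = t → 0 < bf M η (al j) → rh cs (cs.simple j) η ≠ al s → η ≠ al j →
        ∃ e ∈ N, 1 ≤ bf M (-rh cs h η) e := by
      intro j hj hb hne1 hne2
      have h1 := ih _ (by rw [← hn]; exact rf_len_lt rη pη j hne2 hb) _ rfl
        (rη.act (cs.simple j)) (s_pos rη pη j hne2) (iη.simple hj) hne1
      have h2 := rule' j _ hj h1 (by
        rw [rh_simple, map_sub, map_smul, bf_al_self, bf_symm M (al j) η]
        simp only [smul_eq_mul]; linarith)
      rwa [ss j] at h2
    by_cases hbs : 0 < bf M η (al s)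
    · refine red s (Or.inl rfl) hbs ?_ hη
      intro h0
      have := congrFun h0 t
      rw [rh_simple] at this
      simp [al, hst.symm] at this
      linarith
    · obtain ⟨j, hj1, hj2⟩ := exists_pos_simple rη pη
      have hjs : j ≠ s := by rintro rfl; exact hbs hj2
      have hjt : j = t := by
        by_contra hc
        rw [iη j hjs hc] at hj1
        exact lt_irrefl _ hj1
      subst hjt
      by_cases h0 : rh cs (cs.simple j) η = al s
      · have e1 : η = al s + (2*C) • al j := by
          rw [← ss j, h0, rh_simple, bf_al, hfts]; module
        have hC2 : 1 ≤ 2 * C^2 := by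
          rw [e1] at hbs
          simp only [map_add, map_smul, smul_eq_mul, LinearMap.add_apply, LinearMap.smul_apply, bf_al,
            cf_self, hfts] at hbs
          linarith
        have hC0 : 0 < C := by
          refine lt_of_le_of_ne (by linarith) ?_
          intro h; rw [← h] at hC2; norm_num at hC2
        have := ALG rX rY hXY hC0 hC2 (by linarith) L LX LY N hfin hdN (fun e he => he.2.2.1)
          (fun e he => he.1) (fun e he => he.2.2.2) hcl hXd
        convert this using 6
        rw [e1, hX, hY, map_add, map_smul]; module
      · exact red j (Or.inr rfl) hj2 h0 hηt
  intro η rη pη iη hη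
  obtain ⟨e, he, h1⟩ := main _ η rfl rη pη iη hη
  refine ⟨e, he.1, he.2.1, ?_, h1⟩
  have := he.2.2.1
  rw [Ldef] at this
  linarith

end Bip
end ShiJoin
namespace ShiJoin

set_option linter.unusedSectionVars false

section Top
variable {cs : CoxeterSystem M W}

lemma wl_refl (cs : CoxeterSystem M W) (g : W) : WeakLe cs g g := by simp [WeakLe]

lemma wl_trans {p q r : W} (h1 : WeakLe cs p q) (h2 : WeakLe cs q r) : WeakLe cs p r := by
  unfold WeakLe at *
  have a := cs.length_mul_le (p⁻¹ * q) (q⁻¹ * r)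
  have b := cs.length_mul_le p (p⁻¹ * r)
  have e1 : p⁻¹ * q * (q⁻¹ * r) = p⁻¹ * r := by group
  have e2 : p * (p⁻¹ * r) = r := by group
  rw [e1] at a; rw [e2] at b
  omega

lemma wl_antisymm {p q : W} (h1 : WeakLe cs p q) (h2 : WeakLe cs q p) : p = q := by
  unfold WeakLe at *
  have : cs.length (p⁻¹ * q) = 0 := by omega
  rw [cs.length_eq_zero_iff] at this
  exact inv_mul_eq_one.1 this

lemma wl_step {g : W} {i : B} (h : ¬ cs.IsRightDescent g i) : WeakLe cs g (g * cs.simple i) := by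
  unfold WeakLe
  rw [cs.not_isRightDescent_iff] at h
  simp [h]

lemma step_symm {g h : W} (H : ShiStep cs g h) : ShiStep cs h g := by
  obtain ⟨i, rfl, hi⟩ := H
  refine ⟨i, by simp, ?_⟩
  have : g * cs.simple i * cs.simple i * (g * cs.simple i)⁻¹ = g * cs.simple i * g⁻¹ := by
    simp [mul_assoc]
  rwa [this]

lemma same_symm {g h : W} (H : SameShiPart cs g h) : SameShiPart cs h g := by
  unfold SameShiPart at *
  induction H with
  | refl => exact Relation.ReflTransGen.refl
  | tail _ h2 ih => exact Relation.ReflTransGen.head (step_symm h2) ih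

lemma same_trans {g h k : W} (H : SameShiPart cs g h) (H2 : SameShiPart cs h k) :
    SameShiPart cs g k := Relation.ReflTransGen.trans H H2

lemma same_step {g : W} {i : B} (h : ¬ IsElementary cs (g * cs.simple i * g⁻¹)) :
    SameShiPart cs g (g * cs.simple i) := Relation.ReflTransGen.single ⟨i, rfl, h⟩

variable [Fintype B] [DecidableEq B]

lemma al_not_nonpos (cs : CoxeterSystem M W) (i : B) (h : (al i : B → ℝ) ≤ 0) : False :=
  (IsRt.al (cs := cs) i).absurd (al_nonneg i) h

lemma cross {g p : W} (H : SameShiPart cs g p) {b : B → ℝ} (hb : IsRt cs b)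
    (h1 : rh cs g⁻¹ b ≤ 0) (h2 : 0 ≤ rh cs p⁻¹ b) : ¬ IsElementary cs (rf cs b) := by
  unfold SameShiPart at H
  induction H using Relation.ReflTransGen.head_induction_on with
  | refl => exact ((hb.act p⁻¹).absurd h2 h1).elim
  | head hs _ ih =>
    rename_i a c _
    obtain ⟨i, rfl, hi⟩ := hs
    by_cases hc : rh cs a⁻¹ b = - al i
    · have : b = rh cs a (- al i) := by rw [← hc, rh_apply_inv]
      rw [this, map_neg, rf_neg ((IsRt.al i).act a), rf_conj]
      exact hi
    · apply ih
      have := s_pos (hb.act a⁻¹).neg (neg_nonneg.2 h1) i (by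
        intro e; exact hc (by rw [← e, neg_neg]))
      rw [map_neg] at this
      rw [mul_inv_rev, cs.inv_simple, rh_mul]
      exact neg_nonneg.1 this

/-- the dihedral parabolic subgroup -/
def Kg (cs : CoxeterSystem M W) (s t : B) : Subgroup W :=
  Subgroup.closure {cs.simple s, cs.simple t}

lemma Kg.s_mem {s t i : B} (hi : i = s ∨ i = t) : cs.simple i ∈ Kg cs s t := by
  apply Subgroup.subset_closure
  rcases hi with rfl | rfl <;> simp

lemma Kg.coord {s t : B} {v : W} (hv : v ∈ Kg cs s t) (j : B) (h1 : j ≠ s) (h2 : j ≠ t) :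
    ∀ x : B → ℝ, (rh cs v x) j = x j := by
  unfold Kg at hv
  induction hv using Subgroup.closure_induction with
  | mem x hx =>
    intro y
    rcases hx with rfl | rfl
    · rw [rh_simple]; simp [al, h1]
    · rw [rh_simple]; simp [al, h2]
  | one => intro x; rw [rh_one]
  | mul a b _ _ ha hb => intro x; rw [rh_mul, ha, hb]
  | inv a _ ha => intro x; rw [← ha (rh cs a⁻¹ x), rh_apply_inv]

lemma Kg.inPl {s t : B} {v : W} (hv : v ∈ Kg cs s t) {x : B → ℝ} (hx : InPl s t x) :
    InPl s t (rh cs v x) := by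
  intro j h1 h2
  rw [Kg.coord hv j h1 h2, hx j h1 h2]

lemma inPl_al {s t i : B} (hi : i = s ∨ i = t) : InPl s t (al i : B → ℝ) := by
  rcases hi with rfl | rfl
  · exact InPl.al_left _ _
  · exact InPl.al_right _ _

lemma InPl.pos {s t : B} (hst : s ≠ t) {x : B → ℝ} (hx : InPl s t x) (px : 0 ≤ x) {k : W}
    (h1 : 0 ≤ rh cs k (al s)) (h2 : 0 ≤ rh cs k (al t)) : 0 ≤ rh cs k x := by
  rw [hx.eq hst, map_add, map_smul, map_smul]
  exact add_nonneg (smul_nonneg (px t) h2) (smul_nonneg (px s) h1)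

lemma InPl.npos {s t : B} (hst : s ≠ t) {x : B → ℝ} (hx : InPl s t x) (px : 0 ≤ x) {k : W}
    (h1 : rh cs k (al s) ≤ 0) (h2 : rh cs k (al t) ≤ 0) : rh cs k x ≤ 0 := by
  rw [hx.eq hst, map_add, map_smul, map_smul]
  exact add_nonpos (smul_nonpos_of_nonneg_of_nonpos (px t) h2)
    (smul_nonpos_of_nonneg_of_nonpos (px s) h1)

lemma Kg.uniq {s t : B} (hst : s ≠ t) {h v v' : W} (hv : v ∈ Kg cs s t) (hv' : v' ∈ Kg cs s t)
    (h1 : 0 ≤ rh cs (h * v) (al s)) (h2 : 0 ≤ rh cs (h * v) (al t))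
    (h3 : 0 ≤ rh cs (h * v') (al s)) (h4 : 0 ≤ rh cs (h * v') (al t)) : v = v' := by
  by_contra hne
  have hu : v⁻¹ * v' ≠ 1 := fun e => hne (inv_mul_eq_one.1 e)
  obtain ⟨i, hi⟩ := cs.exists_rightDescent_of_ne_one hu
  have hn := nonpos_of_d cs hi
  have hK : v⁻¹ * v' ∈ Kg cs s t := mul_mem (inv_mem hv) hv'
  have hist : i = s ∨ i = t := by
    by_contra hc
    push Not at hc
    have e := Kg.coord hK i hc.1 hc.2 (al i)
    have := hn i
    rw [e] at this
    simp [al] at this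
    linarith
  have ip : InPl s t (-rh cs (v⁻¹ * v') (al i)) := by
    intro j a b
    have := Kg.inPl hK (inPl_al hist) j a b
    rw [Pi.neg_apply, this, neg_zero]
  have h5 := ip.pos hst (neg_nonneg.2 hn) h1 h2
  rw [map_neg, ← rh_mul] at h5
  have e : h * v * (v⁻¹ * v') = h * v' := by group
  rw [e] at h5
  have h6 : 0 ≤ rh cs (h * v') (al i) := by rcases hist with rfl | rfl <;> assumption
  exact ((IsRt.al i).act (h * v')).absurd h6 (neg_nonneg.1 h5)

theorem Kg.wall {h : W} {s t : B} (hst : s ≠ t) (hs : cs.IsRightDescent h s)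
    (ht : cs.IsRightDescent h t) (hne : ¬ IsElementary cs (h * cs.simple t * h⁻¹))
    {v : W} (hv : v ∈ Kg cs s t) {i : B} (hi : i = s ∨ i = t)
    (h1 : rh cs v (al i) ≠ al s) (h2 : rh cs v (al i) ≠ - al s) :
    ¬ IsElementary cs (h * v * cs.simple i * (h * v)⁻¹) := by
  obtain ⟨a, as, at', H⟩ := BIP hst hs ht hne
  -- general form
  have key : ∀ u ∈ Kg cs s t, rh cs u (al i) ≤ 0 → rh cs u (al i) ≠ - al s →
      ¬ IsElementary cs (h * u * cs.simple i * (h * u)⁻¹) := by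
    intro u hu un une
    have ru : IsRt cs (rh cs u (al i)) := (IsRt.al i).act u
    have iu : InPl s t (-rh cs u (al i)) := by
      intro j a b
      have := Kg.inPl hu (inPl_al hi) j a b
      simp [this]
    obtain ⟨e, re, pe, hea, hbe⟩ := H _ ru.neg (neg_nonneg.2 un) iu (by
      intro e; exact une (by rw [← e, neg_neg]))
    rw [map_neg (rh cs h), neg_neg, ← rh_mul] at hbe
    have hw : ∀ x : B → ℝ, rh cs (h * u)⁻¹ x = rh cs u⁻¹ (rh cs h⁻¹ x) := by
      intro x; rw [mul_inv_rev, rh_mul]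
    have S := sep_of_block ((IsRt.al i).act (h * u)) re pe hbe (by
      intro e'
      rw [← e', rh_mul, rh_inv_apply, Kg.coord hu a as at'] at hea
      have := inPl_al hi a as at'
      linarith) (h * u) (by rw [rh_inv_apply]; exact al_nonneg i) (by
      rcases (re.act (h * u)⁻¹).sign with h3 | h3
      · exfalso
        have := h3 a
        rw [hw, Kg.coord (inv_mem hu) a as at'] at this
        exact absurd this (not_le.2 hea)
      · exact h3)
    rw [rf_conj] at S
    exact fun E => E.2 ⟨_, S⟩
  rcases ((IsRt.al (cs := cs) i).act v).sign with h3 | h3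
  · have := key (v * cs.simple i) (mul_mem hv (Kg.s_mem hi))
      (by rw [rh_mul, rh_simple_self, map_neg]; exact neg_nonpos.2 h3)
      (by rw [rh_mul, rh_simple_self, map_neg]; exact fun e => h1 (neg_injective e))
    have e : h * (v * cs.simple i) * cs.simple i * (h * (v * cs.simple i))⁻¹ =
      h * v * cs.simple i * (h * v)⁻¹ := by simp [mul_assoc]
    rwa [e] at this
  · exact key v hv h3 h2

theorem D1 {h : W} {s t : B} (hst : s ≠ t) (hs : cs.IsRightDescent h s)
    (ht : cs.IsRightDescent h t) (hne : ¬ IsElementary cs (h * cs.simple t * h⁻¹)) (n : ℕ) :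
    ∀ v ∈ Kg cs s t, cs.length (h * v) = n → rh cs v⁻¹ (al s) ≤ 0 →
      ∃ v' ∈ Kg cs s t, SameShiPart cs (h * v) (h * v') ∧
        0 ≤ rh cs (h * v') (al s) ∧ 0 ≤ rh cs (h * v') (al t) := by
  induction n using Nat.strong_induction_on with
  | _ n ih =>
  intro v hv hn hneg
  by_cases hd : ∃ i, (i = s ∨ i = t) ∧ cs.IsRightDescent (h * v) i
  · obtain ⟨i, hi, hd⟩ := hd
    have hd' := nonpos_of_d cs hd
    have n1 : rh cs v (al i) ≠ al s := by
      intro e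
      rw [← e, rh_inv_apply] at hneg
      exact al_not_nonpos cs i hneg
    have n2 : rh cs v (al i) ≠ - al s := by
      intro e
      rw [rh_mul, e, map_neg] at hd'
      exact ((IsRt.al s).act h).absurd (neg_nonpos.1 hd') (nonpos_of_d cs hs)
    have W := Kg.wall hst hs ht hne hv hi n1 n2
    obtain ⟨v', a, b, c⟩ := ih _ (by rw [← hn]; exact hd) (v * cs.simple i)
      (mul_mem hv (Kg.s_mem hi)) (by rw [mul_assoc]) (by
        have := s_pos ((IsRt.al s).act v⁻¹).neg (neg_nonneg.2 hneg) i (by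
          intro e
          apply n2
          rw [← e, map_neg, rh_apply_inv])
        rw [map_neg] at this
        rw [mul_inv_rev, cs.inv_simple, rh_mul]
        exact neg_nonneg.1 this)
    refine ⟨v', a, same_trans (same_step W) ?_, c⟩
    rwa [mul_assoc]
  · push Not at hd
    exact ⟨v, hv, Relation.ReflTransGen.refl, nonneg_of_nd cs (hd s (Or.inl rfl)),
      nonneg_of_nd cs (hd t (Or.inr rfl))⟩

theorem D2 {h : W} {s t : B} (hst : s ≠ t) (hs : cs.IsRightDescent h s)
    (ht : cs.IsRightDescent h t) (hne : ¬ IsElementary cs (h * cs.simple t * h⁻¹)) (n : ℕ) :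
    ∀ v ∈ Kg cs s t, cs.length (h * v) = n → 0 ≤ rh cs v⁻¹ (al s) →
      ∃ v' ∈ Kg cs s t, ∃ i, (i = s ∨ i = t) ∧ SameShiPart cs (h * v) (h * v') ∧
        cs.length (h * v') ≤ n ∧ rh cs v' (al i) = al s := by
  induction n using Nat.strong_induction_on with
  | _ n ih =>
  intro v hv hn hpos
  by_cases hd : ∃ i, (i = s ∨ i = t) ∧ cs.IsRightDescent (h * v) i ∧ rh cs v (al i) ≠ al s
  · obtain ⟨i, hi, hd, n1⟩ := hd
    have hd' := nonpos_of_d cs hd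
    have n2 : rh cs v (al i) ≠ - al s := by
      intro e
      rw [rh_mul, e, map_neg] at hd'
      exact ((IsRt.al s).act h).absurd (neg_nonpos.1 hd') (nonpos_of_d cs hs)
    have W := Kg.wall hst hs ht hne hv hi n1 n2
    have hlt : cs.length (h * v * cs.simple i) < n := by rw [← hn]; exact hd
    obtain ⟨v', a, j, hj, b, c, d⟩ := ih _ hlt (v * cs.simple i)
      (mul_mem hv (Kg.s_mem hi)) (by rw [mul_assoc]) (by
        have := s_pos ((IsRt.al s).act v⁻¹) hpos i (by
          intro e
          apply n1
          rw [← e, rh_apply_inv])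
        rw [mul_inv_rev, cs.inv_simple, rh_mul]
        exact this)
    refine ⟨v', a, j, hj, same_trans (same_step W) ?_, by omega, d⟩
    rwa [mul_assoc]
  · push Not at hd
    by_cases he : ∃ i, (i = s ∨ i = t) ∧ rh cs v (al i) = al s
    · obtain ⟨i, hi, e⟩ := he
      exact ⟨v, hv, i, hi, Relation.ReflTransGen.refl, hn.le, e⟩
    · exfalso
      push Not at he
      have q : ∀ i, (i = s ∨ i = t) → 0 ≤ rh cs (h * v) (al i) := by
        intro i hi
        apply nonneg_of_nd
        intro hd2
        exact he i hi (hd i hi hd2)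
      have := (Kg.inPl (inv_mem hv) (InPl.al_left s t)).pos hst hpos (q s (Or.inl rfl))
        (q t (Or.inr rfl))
      rw [rh_mul, rh_apply_inv] at this
      exact ((IsRt.al s).act h).absurd this (nonpos_of_d cs hs)

theorem MON (m : W → W) (hm : ∀ g : W, SameShiPart cs g (m g) ∧
      ∀ h : W, SameShiPart cs g h → WeakLe cs (m g) h) (n : ℕ) :
    ∀ (g : W) (s : B), cs.length g = n → ¬ cs.IsRightDescent g s →
      WeakLe cs (m g) (m (g * cs.simple s)) := by
  have mc : ∀ g h, SameShiPart cs g h → m g = m h := by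
    intro g h H
    apply wl_antisymm
    · exact (hm g).2 _ (same_trans H (hm h).1)
    · exact (hm h).2 _ (same_trans (same_symm H) (hm g).1)
  have mle : ∀ g, WeakLe cs (m g) g := fun g => (hm g).2 g Relation.ReflTransGen.refl
  induction n using Nat.strong_induction_on with
  | _ n ih =>
  intro g s hn hnd
  by_cases hE : IsElementary cs (g * cs.simple s * g⁻¹)
  swap
  · rw [mc _ _ (same_step hE)]; exact wl_refl cs _
  obtain ⟨h, hh⟩ : ∃ h, h = g * cs.simple s := ⟨_, rfl⟩
  rw [← hh]
  have hgh : g = h * cs.simple s := by rw [hh]; simp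
  have lh : cs.length h = n + 1 := by
    rw [hh, ← hn]; exact (cs.not_isRightDescent_iff).1 hnd
  have hs : cs.IsRightDescent h s := by
    unfold CoxeterSystem.IsRightDescent
    rw [← hgh, hn, lh]; omega
  have hEs : IsElementary cs (h * cs.simple s * h⁻¹) := by
    have : h * cs.simple s * h⁻¹ = g * cs.simple s * g⁻¹ := by rw [hgh]; simp [mul_assoc]
    rwa [this]
  by_cases hmh : m h = h
  · rw [hmh]
    exact wl_trans (mle g) (by rw [hh]; exact wl_step hnd)
  have hu : (m h)⁻¹ * h ≠ 1 := fun e => hmh (inv_mul_eq_one.1 e)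
  obtain ⟨t, hut⟩ := cs.exists_rightDescent_of_ne_one hu
  have ht : cs.IsRightDescent h t := by
    have a := mle h
    unfold WeakLe at a
    unfold CoxeterSystem.IsRightDescent at hut ⊢
    have b := cs.length_mul_le (m h) ((m h)⁻¹ * h * cs.simple t)
    have e : m h * ((m h)⁻¹ * h * cs.simple t) = h * cs.simple t := by group
    rw [e] at b
    omega
  have hne : ¬ IsElementary cs (h * cs.simple t * h⁻¹) := by
    have := cross (hm h).1 ((IsRt.al t).act h).neg
      (by rw [map_neg, rh_inv_apply]; exact neg_nonpos.2 (al_nonneg t))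
      (by rw [map_neg, ← rh_mul]; exact neg_nonneg.2 (nonpos_of_d cs hut))
    rwa [rf_neg ((IsRt.al t).act h), rf_conj] at this
  have hst : s ≠ t := by
    rintro rfl; exact hne hEs
  -- first descent
  obtain ⟨v1, k1, S1, p1, p1'⟩ := D1 hst hs ht hne _ (cs.simple s) (Kg.s_mem (Or.inl rfl)) rfl
    (by rw [cs.inv_simple, rh_simple_self]; exact neg_nonpos.2 (al_nonneg s))
  obtain ⟨v2, k2, i, hi, S2, l2, e2⟩ := D2 hst hs ht hne _ (cs.simple t) (Kg.s_mem (Or.inr rfl)) rfl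
    (by
      rw [cs.inv_simple]
      apply s_pos (IsRt.al s) (al_nonneg s)
      intro e
      have := congrFun e s
      simp [al, hst] at this)
  have hd2 : cs.IsRightDescent (h * v2) i := by
    rw [descent_iff, rh_mul, e2]; exact nonpos_of_d cs hs
  obtain ⟨v3, k3, S3, p3, p3'⟩ := D1 hst hs ht hne _ (v2 * cs.simple i)
    (mul_mem k2 (Kg.s_mem hi)) rfl
    (by
      rw [← e2, ← rh_mul]
      have : (v2 * cs.simple i)⁻¹ * v2 = cs.simple i := by simp
      rw [this, rh_simple_self]; exact neg_nonpos.2 (al_nonneg i))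
  have hv : v1 = v3 := Kg.uniq hst k1 k3 p1 p1' p3 p3'
  have lt1 : cs.length (h * cs.simple t) < cs.length h := ht
  have lt2 : cs.length (h * v2 * cs.simple i) < cs.length (h * v2) := hd2
  have F := ih (cs.length (h * v2 * cs.simple i)) (by omega) (h * v2 * cs.simple i) i rfl (by
    unfold CoxeterSystem.IsRightDescent
    simp
    omega)
  have e3 : h * v2 * cs.simple i * cs.simple i = h * v2 := by simp
  rw [e3] at F
  have q1 : m g = m (h * v2 * cs.simple i) := by
    rw [hgh, mc _ _ S1, hv, ← mc _ _ S3, mul_assoc]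
  have q2 : m h = m (h * v2) := by
    rw [← mc _ _ S2]
    exact mc _ _ (same_step hne)
  rw [q1, q2]
  exact F

theorem MON2 (m : W → W) (hm : ∀ g : W, SameShiPart cs g (m g) ∧
      ∀ h : W, SameShiPart cs g h → WeakLe cs (m g) h) (n : ℕ) :
    ∀ g j : W, cs.length (g⁻¹ * j) = n → WeakLe cs g j → WeakLe cs (m g) (m j) := by
  induction n with
  | zero =>
    intro g j h0 _
    rw [cs.length_eq_zero_iff] at h0
    rw [inv_mul_eq_one.1 h0]
    exact wl_refl cs _
  | succ n ih =>
    intro g j hn hgj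
    have hu : g⁻¹ * j ≠ 1 := by
      intro e; rw [e] at hn; simp at hn
    obtain ⟨i, hi⟩ := cs.exists_rightDescent_of_ne_one hu
    rw [cs.isRightDescent_iff] at hi
    have e1 : g⁻¹ * j * cs.simple i = g⁻¹ * (j * cs.simple i) := by group
    have e2 : g * (g⁻¹ * (j * cs.simple i)) = j * cs.simple i := by group
    rw [e1] at hi
    have b := cs.length_mul_le g (g⁻¹ * (j * cs.simple i))
    rw [e2] at b
    unfold WeakLe at hgj
    have c : cs.length j ≤ cs.length (j * cs.simple i) + 1 := by
      have := cs.length_mul_le (j * cs.simple i) (cs.simple i)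
      simpa using this
    have h1 := ih g (j * cs.simple i) (by omega) (by unfold WeakLe; omega)
    have h2 := MON m hm _ (j * cs.simple i) i rfl (by
      unfold CoxeterSystem.IsRightDescent
      simp
      omega)
    rw [cs.simple_mul_simple_cancel_right] at h2
    exact wl_trans h1 h2

theorem final (m : W → W) (hm : ∀ g : W, SameShiPart cs g (m g) ∧
      ∀ h : W, SameShiPart cs g h → WeakLe cs (m g) h) :
    ∀ g ∈ Set.range m, ∀ g' ∈ Set.range m, ∀ j : W,
      IsJoin cs g g' j → j ∈ Set.range m := by
  have mm : ∀ g, m (m g) = m g := by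
    intro g
    apply wl_antisymm
    · exact (hm (m g)).2 _ Relation.ReflTransGen.refl
    · exact (hm g).2 _ (same_trans (hm g).1 (hm (m g)).1)
  rintro _ ⟨g, rfl⟩ _ ⟨g', rfl⟩ j ⟨h1, h2, h3⟩
  have a := MON2 m hm _ _ _ rfl h1
  have b := MON2 m hm _ _ _ rfl h2
  rw [mm] at a b
  exact ⟨j, wl_antisymm ((hm j).2 _ Relation.ReflTransGen.refl) (h3 _ a b)⟩

end Top
end ShiJoin
/-- For `g, g' ∈ M = {m(g) : g ∈ W}`, if the join of `g` and `g'` exists,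
then it belongs to `M`. -/
theorem join_mem_M [Finite B] (cs : CoxeterSystem M W) (m : W → W)
    (hm : ∀ g : W, SameShiPart cs g (m g) ∧
      ∀ h : W, SameShiPart cs g h → WeakLe cs (m g) h) :
    ∀ g ∈ Set.range m, ∀ g' ∈ Set.range m, ∀ j : W,
      IsJoin cs g g' j → j ∈ Set.range m := by
  classical
  haveI := Fintype.ofFinite B
  exact ShiJoin.final m hm
end
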